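/- arXiv:1601.05918 — 5 statements merged into one kernel-verified Lean document; each statement's English description precedes it below -/
import Mathlib

section
/- For every integer r ≥ 1, the function s ↦ ζ_r(s₁,…,s_r), defined by its multiple series, is analytic (holomorphic as a function of several complex variables) on the open set D_r = {s ∈ ℂ^r : Re(s_j+⋯+s_r) > r−j+1 for 1 ≤ j ≤ r}. -/
/-- The Euler–Zagier `r`-ple zeta-function, defined by its multiple series
`ζ_r(s) = ∑_{n₁,…,n_r ≥ 1} n₁^{-s₁}(n₁+n₂)^{-s₂}⋯(n₁+⋯+n_r)^{-s_r}`. -/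
noncomputable def eulerZagierZeta {r : ℕ} (s : Fin r → ℂ) : ℂ :=
  ∑' n : Fin r → ℕ+, ∏ j : Fin r, (((∑ i ∈ Finset.Iic j, (n i : ℕ)) : ℂ) ^ (-(s j)))

open Finset in
/-- A sum of exponentials of continuous linear forms is analytic at `0`. -/
theorem analyticAt_tsum_exp {ι E : Type*} [NormedAddCommGroup E] [NormedSpace ℂ E]
    (a : ι → ℂ) (L : ι → E →L[ℂ] ℂ) (ρ : ℝ) (hρ : 0 < ρ)
    (h : Summable fun i => ‖a i‖ * Real.exp (ρ * ‖L i‖)) :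
    AnalyticAt ℂ (fun x : E => ∑' i, a i * Complex.exp (L i x)) 0 := by
  let q : ι → (k : ℕ) → ContinuousMultilinearMap ℂ (fun _ : Fin k => E) ℂ := fun i k =>
    (a i / (k.factorial : ℂ)) •
      (ContinuousMultilinearMap.mkPiAlgebraFin ℂ k ℂ).compContinuousLinearMap (fun _ => L i)
  have hqn : ∀ i k, ‖q i k‖ * ρ ^ k ≤ ‖a i‖ * ((ρ * ‖L i‖) ^ k / k.factorial) := by
    intro i k
    have h1 : ‖q i k‖ ≤ (‖a i‖ / k.factorial) * ‖L i‖ ^ k := by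
      simp only [q, norm_smul, norm_div, Complex.norm_natCast]
      gcongr
      refine (ContinuousMultilinearMap.norm_compContinuousLinearMap_le _ _).trans ?_
      simp
    calc ‖q i k‖ * ρ ^ k ≤ ((‖a i‖ / k.factorial) * ‖L i‖ ^ k) * ρ ^ k := by gcongr
      _ = _ := by rw [mul_pow]; ring
  have hqa : ∀ i k (x : E), q i k (fun _ => x) = a i * ((L i x) ^ k / k.factorial) := by
    intro i k x
    simp [q, List.ofFn_const]
    ring
  have hB : Summable fun z : ι × ℕ => ‖a z.1‖ * ((ρ * ‖L z.1‖) ^ z.2 / z.2.factorial) := by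
    have hs : ∀ i, HasSum (fun k : ℕ => ‖a i‖ * ((ρ * ‖L i‖) ^ k / k.factorial))
        (‖a i‖ * Real.exp (ρ * ‖L i‖)) := by
      intro i
      rw [Real.exp_eq_exp_ℝ]
      exact (NormedSpace.expSeries_div_hasSum_exp (ρ * ‖L i‖)).mul_left _
    rw [summable_prod_of_nonneg (fun z => by simp only [Pi.zero_apply]; positivity)]
    refine ⟨fun i => (hs i).summable, ?_⟩
    simpa only [(hs _).tsum_eq] using h
  have hN : Summable fun z : ι × ℕ => ‖q z.1 z.2‖ * ρ ^ z.2 :=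
    Summable.of_nonneg_of_le (fun z => by positivity) (fun z => hqn z.1 z.2) hB
  have hN' : Summable fun z : ℕ × ι => ‖q z.2 z.1‖ * ρ ^ z.1 := hN.prod_symm
  have hN2 := (summable_prod_of_nonneg (fun z => by simp only [Pi.zero_apply]; positivity)).1 hN'
  have hqk : ∀ k, Summable fun i => ‖q i k‖ := by
    intro k
    have := (hN2.1 k).mul_right (ρ ^ k)⁻¹
    refine this.congr fun i => ?_
    field_simp
  let p : FormalMultilinearSeries ℂ E ℂ := fun k => ∑' i, q i k
  lift ρ to NNReal using hρ.le
  refine ⟨p, (ρ : ENNReal), ?_, by exact_mod_cast hρ, ?_⟩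
  · apply FormalMultilinearSeries.le_radius_of_summable
    refine Summable.of_nonneg_of_le (fun k => by positivity) (fun k => ?_) hN2.2
    have e1 : ‖∑' i, q i k‖ ≤ ∑' i, ‖q i k‖ := norm_tsum_le_tsum_norm (hqk k)
    have e2 : ‖∑' i, q i k‖ * (ρ : ℝ) ^ k ≤ ∑' i, ‖q i k‖ * (ρ : ℝ) ^ k := by
      rw [tsum_mul_right]
      exact mul_le_mul_of_nonneg_right e1 (by positivity)
    exact e2
  · intro y hy
    have hy' : ‖y‖ ≤ ρ := by
      have : y ∈ Metric.ball (0 : E) ρ := by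
        rw [← Metric.eball_coe]; exact hy
      simpa using (mem_ball_zero_iff.1 this).le
    have hS : Summable fun z : ι × ℕ => q z.1 z.2 (fun _ => y) := by
      refine Summable.of_norm_bounded hN fun z => ?_
      refine (ContinuousMultilinearMap.le_opNorm _ _).trans ?_
      simp only [Finset.prod_const, Finset.card_univ, Fintype.card_fin]
      gcongr
    have h1 : ∀ i, HasSum (fun k => q i k (fun _ => y)) (a i * Complex.exp (L i y)) := by
      intro i
      simp only [hqa, Complex.exp_eq_exp_ℂ]
      exact (NormedSpace.expSeries_div_hasSum_exp (L i y)).mul_left _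
    have h2 := hS.hasSum.prod_fiberwise h1
    have h3 : HasSum (fun z : ℕ × ι => q z.2 z.1 (fun _ => y)) (∑' z : ι × ℕ, q z.1 z.2 (fun _ => y)) :=
      (Equiv.prodComm ℕ ι).hasSum_iff.2 hS.hasSum
    simp only [zero_add]
    rw [h2.tsum_eq]
    refine h3.prod_fiberwise fun k => ?_
    have hs : Summable fun i => q i k := (hqk k).of_norm
    have e3 : HasSum (fun i => q i k (fun _ => y)) ((∑' i, q i k) (fun _ => y)) :=
      ContinuousMultilinearMap.hasSum_eval hs.hasSum (fun _ => y)
    exact e3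

/-- Abel summation inequality. -/
theorem abel_nonneg (r : ℕ) : ∀ (δ l : Fin r → ℝ), Monotone l → (∀ j, 0 ≤ l j) →
    (∀ j : Fin r, 0 ≤ ∑ i, if j ≤ i then δ i else 0) → 0 ≤ ∑ j, δ j * l j := by
  induction r with
  | zero => intro δ l _ _ _; simp
  | succ r ih =>
    intro δ l hm hl hδ
    have h0 := hδ 0
    simp only [Fin.zero_le, if_true] at h0
    have h1 := ih (fun j => δ j.succ) (fun j => l j.succ - l 0)
      (fun i j hij => by simpa using hm (Fin.succ_le_succ_iff.2 hij))
      (fun j => by simpa using hm (Fin.zero_le j.succ))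
      (fun j => by
        have := hδ j.succ
        rw [Fin.sum_univ_succ] at this
        simpa [Fin.succ_le_succ_iff] using this)
    have h2 : ∑ j, δ j * l j = l 0 * (∑ j, δ j) + ∑ j : Fin r, δ j.succ * (l j.succ - l 0) := by
      rw [Fin.sum_univ_succ, Fin.sum_univ_succ]
      simp only [mul_sub, Finset.sum_sub_distrib, ← Finset.sum_mul]
      ring
    rw [h2]
    exact add_nonneg (mul_nonneg (hl 0) h0) h1

theorem summable_pi_prod {α : Type*} (f : α → ℝ) (hf : Summable f) (h0 : ∀ x, 0 ≤ f x) (r : ℕ) :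
    Summable fun m : Fin r → α => ∏ j, f (m j) := by
  induction r with
  | zero => exact Summable.of_finite
  | succ r ih =>
    rw [← (Fin.consEquiv (fun _ : Fin (r + 1) => α)).summable_iff]
    refine (hf.mul_of_nonneg ih h0 (fun m => Finset.prod_nonneg fun j _ => h0 _)).congr fun x => ?_
    simp [Fin.prod_univ_succ, Fin.consEquiv]

/-- The partial sums `n₁ + ⋯ + n_j`. -/
def psum {r : ℕ} (n : Fin r → ℕ+) (j : Fin r) : ℕ := ∑ i ∈ Finset.Iic j, (n i : ℕ)

theorem psum_pos {r : ℕ} (n : Fin r → ℕ+) (j : Fin r) : 0 < psum n j :=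
  Finset.sum_pos (fun i _ => (n i).pos) ⟨j, by simp⟩

theorem psum_mono {r : ℕ} (n : Fin r → ℕ+) : Monotone (psum n) := fun _ _ h =>
  Finset.sum_le_sum_of_subset (Finset.Iic_subset_Iic.2 h)

theorem psum_eq {r : ℕ} (n : Fin r → ℕ+) (j : Fin r) :
    psum n j = (∑ i ∈ Finset.Iio j, (n i : ℕ)) + n j := by
  have : Finset.Iic j = insert j (Finset.Iio j) := (Finset.Iio_insert j).symm
  rw [psum, this, Finset.sum_insert (by simp), add_comm]

theorem psum_injective (r : ℕ) : Function.Injective (psum : (Fin r → ℕ+) → Fin r → ℕ) := by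
  intro n m h
  have key : ∀ k : ℕ, ∀ j : Fin r, j.1 = k → n j = m j := by
    intro k
    induction k using Nat.strong_induction_on with
    | _ k ih =>
      intro j hj
      have h1 := congrFun h j
      rw [psum_eq, psum_eq] at h1
      have h2 : ∑ i ∈ Finset.Iio j, (n i : ℕ) = ∑ i ∈ Finset.Iio j, (m i : ℕ) :=
        Finset.sum_congr rfl fun i hi => by
          rw [ih i.1 (by rw [← hj]; exact Fin.lt_def.1 (Finset.mem_Iio.1 hi)) i rfl]
      exact PNat.coe_injective (by lia)
  funext j
  exact key j.1 j rfl

/-- The linear form `h ↦ -∑ h_j log (n₁ + ⋯ + n_j)`. -/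
noncomputable def logForm {r : ℕ} (n : Fin r → ℕ+) : (Fin r → ℂ) →L[ℂ] ℂ :=
  ∑ j, (-(Real.log (psum n j) : ℂ)) • ContinuousLinearMap.proj (R := ℂ) (φ := fun _ : Fin r => ℂ) j

theorem logForm_apply {r : ℕ} (n : Fin r → ℕ+) (s : Fin r → ℂ) :
    logForm n s = ∑ j, (Real.log (psum n j) : ℂ) * (-(s j)) := by
  simp [logForm]

theorem log_psum_nonneg {r : ℕ} (n : Fin r → ℕ+) (j : Fin r) : 0 ≤ Real.log (psum n j) :=
  Real.log_natCast_nonneg _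

theorem norm_logForm_le {r : ℕ} (n : Fin r → ℕ+) : ‖logForm n‖ ≤ ∑ j, Real.log (psum n j) := by
  refine ContinuousLinearMap.opNorm_le_bound _
    (Finset.sum_nonneg fun j _ => log_psum_nonneg n j) fun s => ?_
  rw [logForm_apply, Finset.sum_mul]
  refine (norm_sum_le _ _).trans (Finset.sum_le_sum fun j _ => ?_)
  rw [norm_mul, norm_neg, Complex.norm_real, Real.norm_of_nonneg (log_psum_nonneg n j)]
  exact mul_le_mul_of_nonneg_left (norm_le_pi_norm s j) (log_psum_nonneg n j)

theorem eulerZagierZeta_eq {r : ℕ} (s : Fin r → ℂ) :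
    eulerZagierZeta s = ∑' n : Fin r → ℕ+, Complex.exp (logForm n s) := by
  unfold eulerZagierZeta
  refine tsum_congr fun n => ?_
  rw [logForm_apply, Complex.exp_sum]
  refine Finset.prod_congr rfl fun j _ => ?_
  have h : (∑ i ∈ Finset.Iic j, ((n i : ℕ) : ℂ)) = (psum n j : ℂ) := by simp [psum]
  have h0 : (psum n j : ℂ) ≠ 0 := by exact_mod_cast (psum_pos n j).ne'
  rw [h, Complex.cpow_def_of_ne_zero h0, Complex.natCast_log]

theorem exists_eps {r : ℕ} (s : Fin r → ℂ)
    (hs : ∀ j : Fin r, ((r : ℝ) - (j : ℕ)) < (∑ i ∈ Finset.Ici j, s i).re) :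
    ∃ ε > 0, ∀ j : Fin r, 0 ≤ ∑ i, if j ≤ i then ((s i).re - 1 - 2 * ε) else 0 := by
  have key : ∀ᶠ ε in nhdsWithin (0 : ℝ) (Set.Ioi 0),
      ∀ j : Fin r, 0 ≤ ∑ i, if j ≤ i then ((s i).re - 1 - 2 * ε) else 0 := by
    rw [Filter.eventually_all]
    intro j
    have hc : Continuous fun ε : ℝ => ∑ i ∈ Finset.Ici j, ((s i).re - 1 - 2 * ε) := by fun_prop
    have h0 : 0 < ∑ i ∈ Finset.Ici j, ((s i).re - 1 - 2 * (0 : ℝ)) := by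
      have := hs j
      have hj : j.1 ≤ r := j.2.le
      rw [Complex.re_sum] at this
      simp only [mul_zero, sub_zero, Finset.sum_sub_distrib, Finset.sum_const, Fin.card_Ici,
        nsmul_eq_mul, mul_one, Nat.cast_sub hj]
      linarith
    have := (hc.tendsto 0).eventually (lt_mem_nhds h0)
    filter_upwards [nhdsWithin_le_nhds this] with ε hε
    rw [← Finset.sum_filter]
    have hI : Finset.univ.filter (fun i => j ≤ i) = Finset.Ici j := by ext; simp
    rw [hI]
    exact hε.le
  obtain ⟨ε, h1, h2⟩ := (key.and self_mem_nhdsWithin).exists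
  exact ⟨ε, h2, h1⟩

theorem summable_main {r : ℕ} (s : Fin r → ℂ) (ε : ℝ) (hε : 0 < ε)
    (hs : ∀ j : Fin r, 0 ≤ ∑ i, if j ≤ i then ((s i).re - 1 - 2 * ε) else 0) :
    Summable fun n : Fin r → ℕ+ => ‖Complex.exp (logForm n s)‖ * Real.exp (ε * ‖logForm n‖) := by
  have h1 : Summable fun m : ℕ => (m : ℝ) ^ (-(1 + ε)) :=
    Real.summable_nat_rpow.2 (by linarith)
  have h2 := (summable_pi_prod _ h1 (fun m => by positivity) r).comp_injective (psum_injective r)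
  refine Summable.of_nonneg_of_le (fun n => by positivity) (fun n => ?_) h2
  have hab := abel_nonneg r (fun i => (s i).re - 1 - 2 * ε) (fun j => Real.log (psum n j))
    (fun i j hij => Real.log_le_log (by exact_mod_cast psum_pos n i)
      (by exact_mod_cast psum_mono n hij)) (log_psum_nonneg n) hs
  have hre : (logForm n s).re = ∑ j, Real.log (psum n j) * (-(s j).re) := by
    rw [logForm_apply, Complex.re_sum]
    exact Finset.sum_congr rfl fun j _ => by rw [Complex.re_ofReal_mul, Complex.neg_re]
  have hr : (∏ j, ((psum n j : ℕ) : ℝ) ^ (-(1 + ε)))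
      = Real.exp (∑ j, Real.log (psum n j) * (-(1 + ε))) := by
    rw [Real.exp_sum]
    exact Finset.prod_congr rfl fun j _ =>
      Real.rpow_def_of_pos (by exact_mod_cast psum_pos n j) _
  simp only [Function.comp_apply]
  rw [Complex.norm_exp, ← Real.exp_add, hr, Real.exp_le_exp, hre]
  have hn := mul_le_mul_of_nonneg_left (norm_logForm_le n) hε.le
  have e : ∑ j, ((s j).re - 1 - 2 * ε) * Real.log (psum n j)
      = ∑ j, Real.log (psum n j) * (-(1 + ε)) - ∑ j, Real.log (psum n j) * (-(s j).re)
        - ε * ∑ j, Real.log (psum n j) := by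
    rw [Finset.mul_sum, ← Finset.sum_sub_distrib, ← Finset.sum_sub_distrib]
    exact Finset.sum_congr rfl fun j _ => by ring
  linarith


/-- For `r ≥ 1`, the Euler–Zagier `r`-ple zeta-function is analytic on the open set
`D_r = {s ∈ ℂ^r : Re(s_j + ⋯ + s_r) > r - j + 1 for 1 ≤ j ≤ r}` (written with `j : Fin r`,
so the condition reads `Re(∑_{i ≥ j} s_i) > r - j`). -/
theorem statement1 (r : ℕ) (hr : 1 ≤ r) :
    AnalyticOnNhd ℂ (fun s : Fin r → ℂ => eulerZagierZeta s)
      {s : Fin r → ℂ | ∀ j : Fin r, ((r : ℝ) - (j : ℕ)) < (∑ i ∈ Finset.Ici j, s i).re} := by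
  intro s hs
  obtain ⟨ε, hε, h⟩ := exists_eps s hs
  have h1 := analyticAt_tsum_exp (fun n : Fin r → ℕ+ => Complex.exp (logForm n s)) logForm ε hε
    (summable_main s ε hε h)
  have h2 : AnalyticAt ℂ (fun x : Fin r → ℂ => x - s) s := by fun_prop
  have h3 := AnalyticAt.comp_of_eq (f := fun x : Fin r → ℂ => x - s) h1 h2 (sub_self s)
  refine h3.congr (Filter.Eventually.of_forall fun x => ?_)
  simp only [Function.comp_apply]
  rw [eulerZagierZeta_eq]
  refine tsum_congr fun n => ?_
  rw [← Complex.exp_add, ← map_add, add_sub_cancel]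
end

section
/- Let M be a positive integer, 0 < η < 1, and let (s₁,s₂) ∈ ℂ² with Re s₂ > 1 and Re(s₁+s₂) > 2. Then ζ₂(s₁,s₂) = (1/(s₂−1)) ζ(s₁+s₂−1) + Σ_{k=0}^{M−1} C(−s₂,k) ζ(s₁+s₂+k) ζ(−k) + (1/Γ(s₂)) · (1/(2πi)) ∫_{Re z = M−η} Γ(s₂+z) Γ(−z) ζ(s₁+s₂+z) ζ(−z) dz, where C(−s₂,k) = (−s₂)(−s₂−1)⋯(−s₂−k+1)/k! is the generalized binomial coefficient, the integral being taken over the vertical line Re z = M−η (and this integral converges absolutely). -/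
open MeasureTheory

/-- The Euler–Zagier double zeta-function `ζ₂(s₁,s₂) = ∑_{0 < m < n} m^{-s₁} n^{-s₂}`. -/
noncomputable def zeta2 (s₁ s₂ : ℂ) : ℂ :=
  ∑' p : ℕ+ × ℕ+, ((p.1 : ℕ) : ℂ) ^ (-s₁) * ((((p.1 : ℕ) + (p.2 : ℕ)) : ℂ) ^ (-s₂))

/-- The generalized binomial coefficient `C(z,k) = z(z-1)⋯(z-k+1)/k!`. -/
noncomputable def genBinom (z : ℂ) (k : ℕ) : ℂ :=
  (∏ i ∈ Finset.range k, (z - (i : ℂ))) / (k.factorial : ℂ)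

lemma mb_cos_norm_ge (x y : ℝ) :
    |Real.cos x| * Real.cosh y ≤ ‖Complex.cos ((x:ℂ) + (y:ℂ) * Complex.I)‖ := by
  apply abs_le_of_sq_le_sq' _ (norm_nonneg _) |>.2
  rw [← Complex.normSq_eq_norm_sq, Complex.cos_add_mul_I, Complex.normSq_apply]
  have h1 : (Complex.cos x * Complex.cosh y - Complex.sin x * Complex.sinh y * Complex.I)
     = ((Real.cos x * Real.cosh y : ℝ) : ℂ) - ((Real.sin x * Real.sinh y : ℝ):ℂ) * Complex.I := by
    push_cast; ring
  rw [h1]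
  simp only [Complex.sub_re, Complex.ofReal_re, Complex.re_ofReal_mul, Complex.I_re, Complex.sub_im,
    Complex.ofReal_im, Complex.im_ofReal_mul, Complex.I_im]
  rw [mul_pow, sq_abs]
  nlinarith [sq_nonneg (Real.sin x * Real.sinh y)]

lemma mb_cosh_ge (y : ℝ) : 1 + y ^ 2 / 2 ≤ Real.cosh y := by
  have := Real.cosh_sq (y/2)
  have h2 := Real.cosh_two_mul (y/2)
  rw [show 2 * (y/2) = y by ring] at h2
  have h3 : (y/2)^2 ≤ Real.sinh (y/2) ^ 2 := by
    rw [sq_le_sq]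
    rw [Real.abs_sinh]
    exact Real.self_le_sinh_iff.2 (abs_nonneg _)
  nlinarith

lemma mb_cos_arg (σ τ : ℝ) : (Real.pi : ℂ) * ((σ : ℂ) + (τ : ℂ) * Complex.I) / 2 =
    ((Real.pi * σ / 2 : ℝ) : ℂ) + ((Real.pi * τ / 2 : ℝ) : ℂ) * Complex.I := by
  push_cast; ring

lemma mb_cos_ne (σ : ℝ) (hσ : Real.cos (Real.pi * σ / 2) ≠ 0) (τ : ℝ) :
    Complex.cos ((Real.pi : ℂ) * ((σ : ℂ) + (τ : ℂ) * Complex.I) / 2) ≠ 0 := by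
  rw [mb_cos_arg, ← norm_pos_iff]
  refine lt_of_lt_of_le ?_ (mb_cos_norm_ge _ _)
  have := Real.cosh_pos (Real.pi * τ / 2)
  positivity

lemma mb_cos_inv_integrable (σ : ℝ) (hσ : Real.cos (Real.pi * σ / 2) ≠ 0) :
    Integrable (fun τ : ℝ =>
      (Complex.cos ((Real.pi : ℂ) * ((σ : ℂ) + (τ : ℂ) * Complex.I) / 2))⁻¹) := by
  have hc : Continuous (fun τ : ℝ =>
      (Complex.cos ((Real.pi : ℂ) * ((σ : ℂ) + (τ : ℂ) * Complex.I) / 2))⁻¹) :=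
    Continuous.inv₀ (by fun_prop) (mb_cos_ne σ hσ)
  refine (integrable_inv_one_add_sq.const_mul (|Real.cos (Real.pi * σ / 2)|⁻¹)).mono'
    hc.aestronglyMeasurable (Filter.Eventually.of_forall fun τ => ?_)
  rw [norm_inv, ← mul_inv, mb_cos_arg]
  refine inv_anti₀ (by positivity) (le_trans ?_ (mb_cos_norm_ge _ _))
  refine mul_le_mul_of_nonneg_left (le_trans ?_ (mb_cosh_ge _)) (abs_nonneg _)
  have := Real.pi_gt_three
  nlinarith [sq_nonneg τ, mul_le_mul_of_nonneg_right (show (8:ℝ) ≤ Real.pi^2 by nlinarith) (sq_nonneg τ)]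

lemma mb_mellin_one (s : ℂ) (h0 : 0 < s.re) (h1 : s.re < 1) :
    mellin (fun t : ℝ => ((1 + t : ℝ) : ℂ)⁻¹) s = Real.pi / Complex.sin (Real.pi * s) := by
  rw [← Complex.Gamma_mul_Gamma_one_sub]
  have hs0 : s ≠ 0 := by rintro rfl; simp at h0
  have hmeas : AEStronglyMeasurable (Function.uncurry fun (t y : ℝ) =>
      (t : ℂ) ^ (s - 1) * Complex.exp (-(1 + t) * y))
      ((volume.restrict (Set.Ioi (0:ℝ))).prod (volume.restrict (Set.Ioi (0:ℝ)))) := by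
    refine Measurable.aestronglyMeasurable ?_
    unfold Function.uncurry
    fun_prop
  have hint : Integrable (Function.uncurry fun (t y : ℝ) =>
      (t : ℂ) ^ (s - 1) * Complex.exp (-(1 + t) * y))
      ((volume.restrict (Set.Ioi (0:ℝ))).prod (volume.restrict (Set.Ioi (0:ℝ)))) := by
    rw [integrable_prod_iff' hmeas]
    have hn : ∀ y : ℝ, ∀ t ∈ Set.Ioi (0:ℝ), ‖(t : ℂ) ^ (s - 1) * Complex.exp (-(1 + t) * y)‖ =
        Real.exp (-y) * (t ^ (s.re - 1) * Real.exp (-(y * t))) := by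
      intro y t ht
      rw [norm_mul, Complex.norm_cpow_eq_rpow_re_of_pos ht, Complex.norm_exp]
      have : (-(1 + (t:ℂ)) * y).re = - y + -(y * t) := by
        simp; ring
      rw [this, Real.exp_add]
      simp; ring
    constructor
    · refine (ae_restrict_iff' measurableSet_Ioi).2 (Filter.Eventually.of_forall fun y hy => ?_)
      simp only [Function.uncurry]
      have h := (Real.integral_rpow_mul_exp_neg_mul_Ioi h0 hy)
      have hh : Integrable (fun t : ℝ => Real.exp (-y) * (t ^ (s.re - 1) * Real.exp (-(y * t))))
          (volume.restrict (Set.Ioi (0:ℝ))) := by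
        apply Integrable.const_mul
        by_contra hcon
        rw [integral_undef hcon] at h
        have : 0 < (1 / y) ^ s.re * Real.Gamma s.re :=
          mul_pos (Real.rpow_pos_of_pos (by simpa using hy) _) (Real.Gamma_pos_of_pos h0)
        linarith
      refine Integrable.mono' hh ?_ ?_
      · exact Measurable.aestronglyMeasurable (by fun_prop)
      · exact (ae_restrict_iff' measurableSet_Ioi).2
          (Filter.Eventually.of_forall fun t ht => (hn y t ht).le)
    · have : ∀ y ∈ Set.Ioi (0:ℝ), (∫ t in Set.Ioi (0:ℝ),
          ‖(Function.uncurry fun (t y : ℝ) => (t : ℂ) ^ (s - 1) * Complex.exp (-(1 + t) * y)) (t, y)‖)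
          = (Real.exp (-y) * y ^ ((1 - s.re) - 1)) * Real.Gamma s.re := by
        intro y hy
        simp only [Function.uncurry]
        rw [setIntegral_congr_fun measurableSet_Ioi (g := fun t =>
          Real.exp (-y) * (t ^ (s.re - 1) * Real.exp (-(y * t)))) (fun t ht => hn y t ht)]
        rw [integral_const_mul, Real.integral_rpow_mul_exp_neg_mul_Ioi h0 hy, one_div,
          Real.inv_rpow (le_of_lt hy), ← Real.rpow_neg (le_of_lt hy)]
        rw [show 1 - s.re - 1 = -s.re by ring]; ring
      refine IntegrableOn.congr_fun ?_ (fun y hy => (this y hy).symm) measurableSet_Ioi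
      exact (Real.GammaIntegral_convergent (by linarith : 0 < 1 - s.re)).mul_const _
  have hswap := integral_integral_swap hint
  unfold mellin
  have e1 : ∀ t ∈ Set.Ioi (0:ℝ), (t:ℂ) ^ (s-1) • ((1 + t : ℝ) : ℂ)⁻¹ =
      ∫ y in Set.Ioi (0:ℝ), (t : ℂ) ^ (s - 1) * Complex.exp (-(1 + t) * y) := by
    intro t ht
    have ht' : (0:ℝ) < t := ht
    rw [integral_const_mul, integral_exp_mul_complex_Ioi (by simp; linarith)]
    simp [smul_eq_mul]
    left
    rw [show -(t:ℂ) + -1 = -(1+t) by ring, neg_div_neg_eq, one_div]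
  rw [setIntegral_congr_fun measurableSet_Ioi e1, hswap]
  have e2 : ∀ y ∈ Set.Ioi (0:ℝ), (∫ t in Set.Ioi (0:ℝ),
      (t : ℂ) ^ (s - 1) * Complex.exp (-(1 + t) * y)) =
      Complex.Gamma s * ((Real.exp (-y) : ℂ) * (y : ℂ) ^ ((1 - s) - 1)) := by
    intro y hy
    have hy' : (0:ℝ) < y := hy
    have := Complex.integral_cpow_mul_exp_neg_mul_Ioi (a := s) (r := y) h0 (by simpa using hy)
    have e3 : ∀ t : ℝ, (t : ℂ) ^ (s - 1) * Complex.exp (-(1 + t) * y) =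
        Complex.exp (-y) * ((t : ℂ) ^ (s - 1) * Complex.exp (-(y * t))) := by
      intro t
      rw [show -(1 + (t:ℂ)) * y = -y + -(y*t) by ring, Complex.exp_add]; ring
    simp_rw [e3]
    rw [integral_const_mul, this, show 1 - s - 1 = -s by ring, one_div,
      Complex.inv_cpow _ _ (by rw [Complex.arg_ofReal_of_nonneg hy'.le]; exact Real.pi_pos.ne),
      Complex.cpow_neg]
    push_cast; ring
  rw [setIntegral_congr_fun measurableSet_Ioi e2, integral_const_mul,
    Complex.Gamma_eq_integral (s := 1 - s) (by simpa using h1)]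
  rfl


lemma mb_mellin_two (s : ℂ) (h0 : 0 < s.re) (h1 : s.re < 2) :
    mellin (fun t : ℝ => ((1 + t ^ 2 : ℝ) : ℂ)⁻¹) s =
      (Real.pi / 2) / Complex.sin (Real.pi * s / 2) := by
  have h := mellin_comp_rpow (fun t : ℝ => ((1 + t : ℝ) : ℂ)⁻¹) s 2
  have hre : (s / 2).re = s.re / 2 := by
    rw [show (2:ℂ) = ((2:ℝ):ℂ) by norm_cast, Complex.div_ofReal_re]
  simp only [Real.rpow_two] at h
  rw [h, show (((2:ℝ)):ℂ) = 2 by norm_cast]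
  rw [mb_mellin_one _ (by rw [hre]; linarith) (by rw [hre]; linarith), ← mul_div_assoc]
  rw [abs_of_pos (by norm_num : (0:ℝ) < 2), Complex.real_smul]
  push_cast
  ring

lemma mb_mellin_conv (c : ℝ) (h0 : 0 < c) (h1 : c < 2) :
    MellinConvergent (fun t : ℝ => ((1 + t ^ 2 : ℝ) : ℂ)⁻¹) c := by
  have hcont : Continuous (fun t : ℝ => ((1 + t ^ 2 : ℝ) : ℂ)⁻¹) := by
    refine Continuous.inv₀ (by fun_prop) (fun t => ?_)
    rw [Complex.ofReal_ne_zero]; positivity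
  refine mellinConvergent_of_isBigO_rpow (a := 2) (b := 0)
    (hcont.locallyIntegrable.locallyIntegrableOn _) ?_ (by simpa using h1) ?_ (by simpa using h0)
  · refine Asymptotics.IsBigO.of_bound 1 ?_
    filter_upwards [Filter.eventually_gt_atTop 0] with t ht
    rw [norm_inv, Complex.norm_real, Real.norm_of_nonneg (by positivity),
      Real.norm_of_nonneg (by positivity), Real.rpow_neg ht.le, one_mul, Real.rpow_two]
    exact inv_anti₀ (by positivity) (by linarith)
  · refine Asymptotics.IsBigO.of_bound 1 (Filter.Eventually.of_forall fun t => ?_)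
    simp only [neg_zero, Real.rpow_zero, norm_one, mul_one]
    rw [norm_inv, Complex.norm_real, Real.norm_of_nonneg (by positivity)]
    exact inv_le_one_of_one_le₀ (by nlinarith [sq_nonneg t])

lemma mb_cos_real_ne (σ : ℝ) (J : ℕ) (h0 : -1 < σ - 2 * J) (h1 : σ - 2 * J < 1) :
    Real.cos (Real.pi * σ / 2) ≠ 0 := by
  have : Real.pi * σ / 2 = Real.pi * (σ - 2 * J) / 2 + J * Real.pi := by ring
  rw [this, Real.cos_add_nat_mul_pi]
  have : 0 < Real.cos (Real.pi * (σ - 2 * J) / 2) := by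
    apply Real.cos_pos_of_mem_Ioo
    constructor <;> nlinarith [Real.pi_pos]
  have h3 : (-1:ℝ)^J ≠ 0 := by simp
  positivity

lemma mb_kernel_zero (σ : ℝ) (h0 : -1 < σ) (h1 : σ < 1) (u : ℝ) (hu : 0 < u) :
    ∫ τ : ℝ, (u : ℂ) ^ ((σ : ℂ) + (τ : ℂ) * Complex.I) *
      (Complex.cos ((Real.pi : ℂ) * ((σ : ℂ) + (τ : ℂ) * Complex.I) / 2))⁻¹ =
      4 * u / (1 + u ^ 2) := by
  have hmel : ∀ τ : ℝ, mellin (fun t : ℝ => ((1 + t ^ 2 : ℝ) : ℂ)⁻¹)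
      (((1 + σ : ℝ) : ℂ) + τ * Complex.I) =
      (Real.pi / 2) * (Complex.cos ((Real.pi : ℂ) * ((σ : ℂ) + (τ : ℂ) * Complex.I) / 2))⁻¹ := by
    intro τ
    rw [mb_mellin_two _ (by simp; linarith) (by simp; linarith), div_eq_mul_inv]
    rw [← Complex.sin_add_pi_div_two]
    congr 3
    push_cast; ring
  have hne : Real.cos (Real.pi * σ / 2) ≠ 0 :=
    mb_cos_real_ne σ 0 (by simpa using h0) (by simpa using h1)
  have hinv := mellinInv_mellin_eq (1 + σ) (fun t : ℝ => ((1 + t ^ 2 : ℝ) : ℂ)⁻¹) (x := u⁻¹)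
    (by positivity) (mb_mellin_conv _ (by linarith) (by linarith)) (by
      unfold Complex.VerticalIntegrable
      simp_rw [hmel]
      exact (mb_cos_inv_integrable σ hne).const_mul _) (by
      refine ContinuousAt.inv₀ (by fun_prop) ?_
      rw [Complex.ofReal_ne_zero]; positivity)
  unfold mellinInv at hinv
  simp_rw [hmel] at hinv
  have hu' : (u : ℂ) ≠ 0 := by exact_mod_cast hu.ne'
  have e : ∀ τ : ℝ, ((u⁻¹ : ℝ) : ℂ) ^ (-(((1 + σ : ℝ) : ℂ) + τ * Complex.I)) •
      ((Real.pi / 2 : ℂ) * (Complex.cos ((Real.pi : ℂ) * ((σ : ℂ) + (τ : ℂ) * Complex.I) / 2))⁻¹)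
      = (Real.pi / 2 * u : ℂ) * ((u : ℂ) ^ ((σ : ℂ) + (τ : ℂ) * Complex.I) *
      (Complex.cos ((Real.pi : ℂ) * ((σ : ℂ) + (τ : ℂ) * Complex.I) / 2))⁻¹) := by
    intro τ
    rw [Complex.ofReal_inv, Complex.inv_cpow _ _
      (by rw [Complex.arg_ofReal_of_nonneg hu.le]; exact Real.pi_pos.ne),
      Complex.cpow_neg, inv_inv, smul_eq_mul]
    rw [show (((1 + σ : ℝ) : ℂ) + τ * Complex.I) = 1 + ((σ : ℂ) + τ * Complex.I) by push_cast; ring,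
      Complex.cpow_add _ _ hu', Complex.cpow_one]
    ring
  simp_rw [e] at hinv
  rw [integral_const_mul, Complex.real_smul] at hinv
  have hpi : (Real.pi : ℂ) ≠ 0 := by exact_mod_cast Real.pi_ne_zero
  have h3 : (1 + (u:ℂ) ^ 2) ≠ 0 := by
    exact_mod_cast (by positivity : (1 + u ^ 2 : ℝ) ≠ 0)
  set X := ∫ τ : ℝ, (u : ℂ) ^ ((σ : ℂ) + (τ : ℂ) * Complex.I) *
      (Complex.cos ((Real.pi : ℂ) * ((σ : ℂ) + (τ : ℂ) * Complex.I) / 2))⁻¹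
  push_cast at hinv
  have h4 : (1 + ((u:ℂ)⁻¹) ^ 2)⁻¹ = (u : ℂ) ^ 2 / (1 + (u : ℂ) ^ 2) := by
    rw [show 1 + ((u:ℂ)⁻¹) ^ 2 = (1 + (u : ℂ) ^ 2) / (u : ℂ) ^ 2 by field_simp; ring, inv_div]
  rw [h4] at hinv
  have h5 : 1 / (2 * (Real.pi : ℂ)) * (Real.pi / 2 * u * X) = u * X / 4 := by
    field_simp; ring
  rw [h5] at hinv
  rw [eq_div_iff h3]
  rw [eq_div_iff h3] at hinv
  apply mul_left_cancel₀ hu'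
  linear_combination 4 * hinv

lemma mb_kernel (σ : ℝ) (J : ℕ) (h0 : -1 < σ - 2 * J) (h1 : σ - 2 * J < 1) (u : ℝ) (hu : 0 < u) :
    ∫ τ : ℝ, (u : ℂ) ^ ((σ : ℂ) + (τ : ℂ) * Complex.I) *
      (Complex.cos ((Real.pi : ℂ) * ((σ : ℂ) + (τ : ℂ) * Complex.I) / 2))⁻¹ =
      4 * u / (1 + u ^ 2) * (-(u : ℂ) ^ 2) ^ J := by
  have hu' : (u : ℂ) ≠ 0 := by exact_mod_cast hu.ne'
  rw [← mb_kernel_zero (σ - 2 * J) h0 h1 u hu, ← integral_mul_const]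
  congr 1
  ext τ
  have e1 : (σ : ℂ) + (τ : ℂ) * Complex.I =
      (((σ - 2 * J : ℝ) : ℂ) + (τ : ℂ) * Complex.I) + ((2 * J : ℕ) : ℂ) := by push_cast; ring
  rw [e1, Complex.cpow_add _ _ hu', Complex.cpow_natCast, pow_mul]
  set z := ((σ - 2 * J : ℝ) : ℂ) + (τ : ℂ) * Complex.I
  rw [show (Real.pi : ℂ) * (z + ((2 * J : ℕ) : ℂ)) / 2 = Real.pi * z / 2 + J * Real.pi by
    push_cast; ring, Complex.cos_antiperiodic.add_nat_mul_eq]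
  rw [neg_pow ((u:ℂ) ^ 2), mul_inv, ← inv_pow, inv_neg, inv_one]
  ring


lemma mb_gamma_zeta (z : ℂ) (hz : 0 < z.re) (hn : ∀ n : ℤ, (n : ℝ) ≠ z.re) :
    Complex.Gamma (-z) * riemannZeta (-z) =
      Real.pi * (2 * Real.pi : ℂ) ^ (-(1 + z)) * riemannZeta (1 + z) *
        (Complex.cos (Real.pi * z / 2))⁻¹ := by
  have hpi : (Real.pi : ℂ) ≠ 0 := by exact_mod_cast Real.pi_ne_zero
  have hs : Complex.sin (Real.pi * z / 2) ≠ 0 := by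
    rw [Ne, Complex.sin_eq_zero_iff]
    rintro ⟨k, hk⟩
    apply hn (2 * k)
    have : z = ((2 * k : ℤ) : ℂ) := by
      push_cast
      field_simp at hk
      linear_combination hk
    rw [this, Complex.intCast_re]
  have hc : Complex.cos (Real.pi * z / 2) ≠ 0 := by
    rw [Ne, Complex.cos_eq_zero_iff]
    rintro ⟨k, hk⟩
    apply hn (2 * k + 1)
    have : z = ((2 * k + 1 : ℤ) : ℂ) := by
      push_cast
      field_simp at hk
      linear_combination hk
    rw [this, Complex.intCast_re]
  have h1 := riemannZeta_one_sub (s := 1 + z) (by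
    intro n h
    have := congrArg Complex.re h
    simp at this
    have h2 : (0:ℝ) ≤ n := Nat.cast_nonneg n
    linarith) (by
    intro h
    have := congrArg Complex.re h
    simp at this
    linarith)
  rw [show 1 - (1 + z) = -z by ring] at h1
  have h2 := Complex.Gamma_mul_Gamma_one_sub (-z)
  rw [show 1 - -z = 1 + z by ring] at h2
  have h3 : Complex.sin (Real.pi * -z) =
      -(2 * Complex.sin (Real.pi * z / 2) * Complex.cos (Real.pi * z / 2)) := by
    rw [← Complex.sin_two_mul, ← Complex.sin_neg]; congr 1; ring
  have h4 : Complex.cos (Real.pi * (1 + z) / 2) = - Complex.sin (Real.pi * z / 2) := by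
    rw [← Complex.cos_add_pi_div_two]; congr 1; ring
  rw [h3] at h2
  rw [h1, h4]
  calc _ = (Complex.Gamma (-z) * Complex.Gamma (1 + z)) * (2 * (2 * Real.pi : ℂ) ^ (-(1 + z)) *
      -Complex.sin (Real.pi * z / 2) * riemannZeta (1 + z)) := by ring
    _ = _ := by
      rw [h2]; field_simp

/-- points on the line -/
lemma mb_line_re (σ τ : ℝ) : ((σ : ℂ) + (τ : ℂ) * Complex.I).re = σ := by simp

lemma mb_zeta_hasSum (s : ℂ) (hs : 1 < s.re) :
    HasSum (fun n : ℕ => ((n : ℂ) + 1) ^ (-s)) (riemannZeta s) := by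
  have h := zeta_eq_tsum_one_div_nat_add_one_cpow hs
  have h2 := (Complex.summable_one_div_nat_cpow (p := s)).2 hs
  have h3 := (summable_nat_add_iff 1).2 h2
  rw [h]
  have e : (fun n : ℕ => 1 / (((n + 1 : ℕ) : ℂ)) ^ s) = (fun n : ℕ => ((n : ℂ) + 1) ^ (-s)) := by
    funext n; rw [Complex.cpow_neg, one_div]; push_cast; rfl
  have e' : (fun n : ℕ => 1 / ((n : ℂ) + 1) ^ s) = (fun n : ℕ => ((n : ℂ) + 1) ^ (-s)) := by
    funext n; rw [Complex.cpow_neg, one_div]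
  rw [e'] 
  rw [e] at h3
  exact h3.hasSum

lemma mb_zeta_bound (s : ℂ) (hs : 1 < s.re) :
    ‖riemannZeta s‖ ≤ ∑' n : ℕ, ((n : ℝ) + 1) ^ (-s.re) := by
  rw [← (mb_zeta_hasSum s hs).tsum_eq]
  have e : ∀ n : ℕ, ‖((n : ℂ) + 1) ^ (-s)‖ = ((n : ℝ) + 1) ^ (-s.re) := by
    intro n
    have := Complex.norm_cpow_eq_rpow_re_of_pos (x := (n:ℝ) + 1) (by positivity) (-s)
    push_cast at this
    simpa using this
  simp_rw [← e]
  apply norm_tsum_le_tsum_norm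
  exact (mb_zeta_hasSum s hs).summable.norm

lemma mb_zeta_cont (c : ℂ) (σ : ℝ) (h : 1 < c.re + σ) :
    Continuous (fun τ : ℝ => riemannZeta (c + ((σ : ℂ) + (τ : ℂ) * Complex.I))) := by
  rw [continuous_iff_continuousAt]
  intro τ
  have : ContinuousAt riemannZeta (c + ((σ : ℂ) + (τ : ℂ) * Complex.I)) := by
    refine (differentiableAt_riemannZeta ?_).continuousAt
    intro h1
    have := congrArg Complex.re h1
    simp at this
    linarith
  exact ContinuousAt.comp (f := fun τ : ℝ => (c + ((σ : ℂ) + (τ : ℂ) * Complex.I))) this (by fun_prop)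

lemma mb_phi_integrable (σ : ℝ) (h0 : 0 < σ) (hn : ∀ n : ℤ, (n : ℝ) ≠ σ) :
    Integrable (fun τ : ℝ => Complex.Gamma (-((σ : ℂ) + (τ : ℂ) * Complex.I)) *
      riemannZeta (-((σ : ℂ) + (τ : ℂ) * Complex.I))) := by
  have hpi : (2 * Real.pi : ℂ) ≠ 0 := by simp [Real.pi_ne_zero]
  have hcos : Real.cos (Real.pi * σ / 2) ≠ 0 := by
    rw [Ne, Real.cos_eq_zero_iff]
    rintro ⟨k, hk⟩
    apply hn (2 * k + 1)
    push_cast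
    have := Real.pi_ne_zero
    field_simp at hk
    linarith
  have e : ∀ τ : ℝ, Complex.Gamma (-((σ : ℂ) + (τ : ℂ) * Complex.I)) *
      riemannZeta (-((σ : ℂ) + (τ : ℂ) * Complex.I)) =
      (Real.pi * (2 * Real.pi : ℂ) ^ (-(1 + ((σ : ℂ) + (τ : ℂ) * Complex.I))) *
        riemannZeta (1 + ((σ : ℂ) + (τ : ℂ) * Complex.I))) *
        (Complex.cos (Real.pi * ((σ : ℂ) + (τ : ℂ) * Complex.I) / 2))⁻¹ := fun τ =>
    mb_gamma_zeta _ (by simpa using h0) (by simpa using hn)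
  simp_rw [e]
  refine Integrable.bdd_mul (c := Real.pi * (2 * Real.pi) ^ (-(1 + σ)) * ∑' n : ℕ, ((n : ℝ) + 1) ^ (-(1 + σ)))
    (mb_cos_inv_integrable σ hcos) ?_ ?_
  · apply Continuous.aestronglyMeasurable
    have := mb_zeta_cont 1 σ (by simpa using h0)
    refine Continuous.mul (Continuous.mul continuous_const ?_) this
    refine Continuous.const_cpow (by fun_prop) (Or.inl hpi)
  · refine Filter.Eventually.of_forall fun τ => ?_
    rw [norm_mul, norm_mul]
    have h1 := mb_zeta_bound (1 + ((σ : ℂ) + (τ : ℂ) * Complex.I)) (by simpa using h0)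
    have h2 := Complex.norm_cpow_eq_rpow_re_of_pos (x := 2 * Real.pi) (by positivity)
      (-(1 + ((σ : ℂ) + (τ : ℂ) * Complex.I)))
    push_cast at h2
    rw [h2]
    have h3 : (1 + ((σ : ℂ) + (τ : ℂ) * Complex.I)).re = 1 + σ := by simp
    rw [Complex.neg_re, h3]
    rw [h3] at h1
    rw [Complex.norm_real, Real.norm_of_nonneg Real.pi_pos.le]
    gcongr

lemma mb_G (σ : ℝ) (J : ℕ) (h0 : 0 < σ) (hn : ∀ n : ℤ, (n : ℝ) ≠ σ)
    (h1 : -1 < σ - 2 * J) (h2 : σ - 2 * J < 1) (t : ℝ) (ht : 0 < t) :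
    HasSum (fun n : ℕ => (2 * Real.pi : ℂ) * (2 * t / ((2 * Real.pi * (n + 1)) ^ 2 + t ^ 2) *
        (-((t : ℂ) ^ 2 / (2 * Real.pi * (n + 1)) ^ 2)) ^ J))
      (∫ τ : ℝ, (t : ℂ) ^ ((σ : ℂ) + (τ : ℂ) * Complex.I) *
        (Complex.Gamma (-((σ : ℂ) + (τ : ℂ) * Complex.I)) *
      riemannZeta (-((σ : ℂ) + (τ : ℂ) * Complex.I)))) := by
  have hcos := mb_cos_real_ne σ J h1 h2
  set F : ℕ → ℝ → ℂ := fun n τ => ((Real.pi : ℂ) / (2 * Real.pi * (n + 1))) *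
    (((t / (2 * Real.pi * (n + 1)) : ℝ) : ℂ) ^ ((σ : ℂ) + (τ : ℂ) * Complex.I) *
      (Complex.cos (Real.pi * ((σ : ℂ) + (τ : ℂ) * Complex.I) / 2))⁻¹) with hF
  have hu : ∀ n : ℕ, 0 < t / (2 * Real.pi * (n + 1)) := fun n => by positivity
  have hnorm : ∀ n τ, ‖F n τ‖ = (Real.pi * (t / (2 * Real.pi)) ^ σ / (2 * Real.pi)) *
      ((n : ℝ) + 1) ^ (-(1 + σ)) *
      ‖(Complex.cos (Real.pi * ((σ : ℂ) + (τ : ℂ) * Complex.I) / 2))⁻¹‖ := by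
    intro n τ
    have hn1 : (0:ℝ) < n + 1 := by positivity
    simp only [hF]
    rw [norm_mul, norm_mul, Complex.norm_cpow_eq_rpow_re_of_pos (hu n), mb_line_re]
    have e1 : ‖(Real.pi : ℂ) / (2 * Real.pi * (n + 1))‖ = Real.pi / (2 * Real.pi * (n + 1)) := by
      rw [show (Real.pi : ℂ) / (2 * Real.pi * (n + 1)) =
        ((Real.pi / (2 * Real.pi * (n + 1)) : ℝ) : ℂ) by push_cast; rfl, Complex.norm_real,
        Real.norm_of_nonneg (by positivity)]
    rw [e1, ← div_div t, Real.div_rpow (by positivity) hn1.le, Real.rpow_neg hn1.le,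
      Real.rpow_add hn1, Real.rpow_one]
    field_simp
  have hint : ∀ n, Integrable (F n) := by
    intro n
    refine Integrable.mono' ((mb_cos_inv_integrable σ hcos).norm.const_mul _) ?_
      (Filter.Eventually.of_forall fun τ => (hnorm n τ).le)
    refine AEStronglyMeasurable.const_mul (AEStronglyMeasurable.mul ?_
      (mb_cos_inv_integrable σ hcos).aestronglyMeasurable) _
    refine (Continuous.const_cpow (by fun_prop) (Or.inl ?_)).aestronglyMeasurable
    exact_mod_cast (hu n).ne'
  have hsum : Summable fun n => ∫ τ, ‖F n τ‖ := by
    simp_rw [hnorm, integral_const_mul]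
    refine Summable.mul_right _ (Summable.mul_left _ ?_)
    have := (Real.summable_nat_rpow (p := -(1 + σ))).2 (by linarith)
    have h := (summable_nat_add_iff 1).2 this
    simpa using h
  have hmain := hasSum_integral_of_summable_integral_norm hint hsum
  refine Eq.mp (congrArg₂ (fun f a => HasSum f a) (funext fun n => ?_) ?_) hmain
  · symm
    simp only [hF]
    rw [integral_const_mul, mb_kernel σ J h1 h2 _ (hu n)]
    have hpi : (Real.pi : ℂ) ≠ 0 := by exact_mod_cast Real.pi_ne_zero
    have hn1 : (n : ℂ) + 1 ≠ 0 := by exact_mod_cast Nat.succ_ne_zero n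
    push_cast
    rw [div_pow]
    rw [← mul_assoc, ← mul_assoc]
    congr 1
    have h5 : (2 * Real.pi * ((n:ℂ) + 1)) ^ 2 + t ^ 2 ≠ 0 := by
      exact_mod_cast (by positivity : (2 * Real.pi * ((n:ℝ) + 1)) ^ 2 + t ^ 2 ≠ 0)
    have h6 : 1 + (t:ℂ) ^ 2 / (2 * Real.pi * ((n:ℂ) + 1)) ^ 2 =
        ((2 * Real.pi * ((n:ℂ) + 1)) ^ 2 + t ^ 2) / (2 * Real.pi * ((n:ℂ) + 1)) ^ 2 := by
      field_simp
    rw [h6]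
    generalize hD : (2 * Real.pi * ((n:ℂ) + 1)) ^ 2 + (t:ℂ) ^ 2 = D at h5
    field_simp
    ring
  · symm
    congr 1
    ext τ
    rw [mb_gamma_zeta _ (by simpa using h0) (by simpa using hn)]
    set z := (σ : ℂ) + (τ : ℂ) * Complex.I with hz
    have hzs := mb_zeta_hasSum (1 + z) (by simpa [hz] using h0)
    have := (hzs.mul_left ((t : ℂ) ^ z * (Real.pi * (2 * Real.pi : ℂ) ^ (-(1 + z))))).mul_right
      ((Complex.cos (Real.pi * z / 2))⁻¹)
    rw [show (t : ℂ) ^ z * (Real.pi * (2 * Real.pi : ℂ) ^ (-(1 + z)) * riemannZeta (1 + z) *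
        (Complex.cos (Real.pi * z / 2))⁻¹) = (t : ℂ) ^ z * (Real.pi * (2 * Real.pi : ℂ) ^ (-(1 + z))) *
        riemannZeta (1 + z) * (Complex.cos (Real.pi * z / 2))⁻¹ by ring]
    rw [← this.tsum_eq]
    refine tsum_congr fun n => ?_
    simp only [hF]
    rw [← hz]
    conv_rhs => rw [← mul_assoc]
    congr 1
    have hn1 : (0:ℝ) < 2 * Real.pi * (n + 1) := by positivity
    have hn2 : ((2 * Real.pi * (n + 1) : ℝ) : ℂ) ≠ 0 := by exact_mod_cast hn1.ne'
    have e2 : (2 * Real.pi : ℂ) ^ (-(1 + z)) * ((n : ℂ) + 1) ^ (-(1 + z)) =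
        ((2 * Real.pi * (n + 1) : ℝ) : ℂ) ^ (-(1 + z)) := by
      have := Complex.mul_cpow_ofReal_nonneg (a := 2 * Real.pi) (b := (n:ℝ) + 1)
        (by positivity) (by positivity) (-(1 + z))
      push_cast at this ⊢
      exact this.symm
    rw [mul_assoc, mul_assoc, e2, Complex.cpow_neg, Complex.cpow_add _ _ hn2, Complex.cpow_one]
    rw [div_eq_mul_inv t, Complex.ofReal_mul t, Complex.mul_cpow_ofReal_nonneg ht.le (by positivity),
      Complex.ofReal_inv, Complex.inv_cpow _ _
      (by rw [Complex.arg_ofReal_of_nonneg hn1.le]; exact Real.pi_pos.ne)]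
    push_cast
    rw [mul_inv]
    ring


lemma mb_cot (t : ℝ) (ht : 0 < t) :
    HasSum (fun n : ℕ => 2 * (t : ℂ) / ((2 * Real.pi * (n + 1)) ^ 2 + t ^ 2))
      ((Complex.exp t - 1)⁻¹ - (t : ℂ)⁻¹ + 1 / 2) := by
  have hpi : (Real.pi : ℂ) ≠ 0 := by exact_mod_cast Real.pi_ne_zero
  have ht' : (t : ℂ) ≠ 0 := by exact_mod_cast ht.ne'
  have hG := mb_G (1/2) 0 (by norm_num) (by
    intro n h
    have h2 : (2 * n : ℝ) = 1 := by linarith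
    have h3 : 2 * n = 1 := by exact_mod_cast h2
    omega) (by norm_num) (by norm_num) t ht
  have hS : Summable (fun n : ℕ => 2 * (t : ℂ) / ((2 * Real.pi * (n + 1)) ^ 2 + t ^ 2)) := by
    have := hG.summable
    rw [summable_mul_left_iff (by simp [hpi])] at this
    simpa using this
  have hx : Complex.I * t / (2 * Real.pi) ∈ Complex.integerComplement := by
    rw [Complex.mem_integerComplement_iff]
    rintro ⟨n, hn⟩
    have := congrArg Complex.im hn
    have e : (Complex.I * t / (2 * Real.pi)).im = t / (2 * Real.pi) := by
      rw [show Complex.I * t / (2 * Real.pi) = ((t / (2 * Real.pi) : ℝ) : ℂ) * Complex.I by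
        push_cast; ring]
      rw [Complex.im_ofReal_mul, Complex.I_im, mul_one]
    rw [e] at this
    have h2 : 0 < t / (2 * Real.pi) := by positivity
    rw [Complex.intCast_im] at this
    linarith
  have hcot := cot_series_rep' hx
  have hterm : ∀ n : ℕ, (1 / (Complex.I * t / (2 * Real.pi) - (n + 1)) +
      1 / (Complex.I * t / (2 * Real.pi) + (n + 1))) = (-2 * Real.pi * Complex.I) *
      (2 * (t : ℂ) / ((2 * Real.pi * (n + 1)) ^ 2 + t ^ 2)) := by
    intro n
    have h5 : (2 * Real.pi * ((n:ℂ) + 1)) ^ 2 + t ^ 2 ≠ 0 := by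
      exact_mod_cast (by positivity : (2 * Real.pi * ((n:ℝ) + 1)) ^ 2 + t ^ 2 ≠ 0)
    have h6 : ((2 * Real.pi * ((n:ℂ) + 1)) ^ 2 + t ^ 2) =
      (2 * Real.pi * ((n:ℂ) + 1) - Complex.I * t) * (2 * Real.pi * ((n:ℂ) + 1) + Complex.I * t) := by
      linear_combination ((t:ℂ)^2) * Complex.I_sq
    rw [h6] at h5 ⊢
    have h7 := left_ne_zero_of_mul h5
    have h8 := right_ne_zero_of_mul h5
    have h9 : Complex.I * t / (2 * Real.pi) - ((n:ℂ) + 1) =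
        -(2 * Real.pi * ((n:ℂ) + 1) - Complex.I * t) / (2 * Real.pi) := by field_simp; ring
    have h10 : Complex.I * t / (2 * Real.pi) + ((n:ℂ) + 1) =
        (2 * Real.pi * ((n:ℂ) + 1) + Complex.I * t) / (2 * Real.pi) := by field_simp; ring
    rw [h9, h10, one_div_div, one_div_div]
    generalize hA : 2 * Real.pi * ((n:ℂ) + 1) - Complex.I * t = A at *
    generalize hB : 2 * Real.pi * ((n:ℂ) + 1) + Complex.I * t = B at *
    have hAB : B - A = 2 * Complex.I * t := by rw [← hA, ← hB]; ring
    field_simp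
    linear_combination (-1 : ℂ) * hAB
  simp_rw [hterm] at hcot
  rw [tsum_mul_left] at hcot
  have hexp : Complex.exp t - 1 ≠ 0 := by
    rw [← Complex.ofReal_exp]
    have := Real.add_one_lt_exp ht.ne'
    have h2 : 0 < Real.exp t - 1 := by linarith
    exact_mod_cast h2.ne'
  have hlhs : (Real.pi : ℂ) * Complex.cot (Real.pi * (Complex.I * t / (2 * Real.pi))) -
      1 / (Complex.I * t / (2 * Real.pi)) = (-2 * Real.pi * Complex.I) *
      ((Complex.exp t - 1)⁻¹ - (t : ℂ)⁻¹ + 1 / 2) := by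
    rw [Complex.cot_eq_exp_ratio]
    rw [show 2 * Complex.I * (Real.pi * (Complex.I * t / (2 * Real.pi))) = -t by
      field_simp; linear_combination Complex.I_sq]
    rw [Complex.exp_neg]
    have hE := Complex.exp_ne_zero (t : ℂ)
    generalize Complex.exp (t : ℂ) = E at *
    have h11 : 1 - E⁻¹ ≠ 0 := by
      rw [show 1 - E⁻¹ = (E - 1) / E by field_simp]
      exact div_ne_zero hexp hE
    have hI := Complex.I_ne_zero
    rw [show 1 - E⁻¹ = (E - 1) / E by field_simp]
    field_simp
    rw [Complex.I_sq]
    ring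
  rw [hlhs] at hcot
  have := mul_left_cancel₀ (by simp [hpi]) hcot
  rw [this]
  exact hS.hasSum

lemma mb_zeta_odd (j : ℕ) : riemannZeta (-((2 * j + 1 : ℕ) : ℂ)) =
    -(2 * (-1) ^ j * (2 * Real.pi : ℂ)⁻¹ ^ (2 * j + 2) * ((2 * j + 1).factorial : ℂ) *
      riemannZeta ((2 * j + 2 : ℕ) : ℂ)) := by
  have h1 := riemannZeta_one_sub (s := ((2 * j + 2 : ℕ) : ℂ)) (by
    intro n h
    have := congrArg Complex.re h
    simp at this
    have h2 : (0:ℝ) ≤ n := Nat.cast_nonneg n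
    have h3 : (0:ℝ) ≤ j := Nat.cast_nonneg j
    linarith) (by
    intro h
    have := congrArg Complex.re h
    simp at this
    have h3 : (0:ℝ) ≤ j := Nat.cast_nonneg j
    linarith)
  rw [show (1 : ℂ) - ((2 * j + 2 : ℕ) : ℂ) = -((2 * j + 1 : ℕ) : ℂ) by push_cast; ring] at h1
  rw [h1, Complex.cpow_neg, Complex.cpow_natCast]
  rw [show Complex.Gamma ((2 * j + 2 : ℕ) : ℂ) = ((2 * j + 1).factorial : ℂ) by
    rw [← Complex.Gamma_nat_eq_factorial]; congr 1; push_cast; ring]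
  rw [show (Real.pi : ℂ) * ((2 * j + 2 : ℕ) : ℂ) / 2 = 0 + ((j + 1 : ℕ) : ℂ) * Real.pi by
    push_cast; ring, Complex.cos_antiperiodic.add_nat_mul_eq, Complex.cos_zero]
  rw [pow_succ (-1 : ℂ) j, inv_pow]
  ring

/-- The Taylor coefficients of `1/(e^t-1)`. -/
noncomputable def mbCoef (k : ℕ) : ℂ := riemannZeta (-(k : ℂ)) * (-1) ^ k / (k.factorial : ℂ)

lemma mb_coef_odd (j : ℕ) : mbCoef (2 * j + 1) =
    2 * (-1) ^ j * (2 * Real.pi : ℂ)⁻¹ ^ (2 * j + 2) * riemannZeta ((2 * j + 2 : ℕ) : ℂ) := by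
  unfold mbCoef
  rw [mb_zeta_odd]
  have : ((2 * j + 1).factorial : ℂ) ≠ 0 := by exact_mod_cast Nat.factorial_ne_zero _
  rw [div_eq_iff this, pow_succ (-1 : ℂ) (2 * j), pow_mul (-1 : ℂ) 2 j]
  simp
  ring

lemma mb_coef_even (j : ℕ) : mbCoef (2 * (j + 1)) = 0 := by
  unfold mbCoef
  rw [show -((2 * (j + 1) : ℕ) : ℂ) = -2 * ((j : ℂ) + 1) by push_cast; ring,
    riemannZeta_neg_two_mul_nat_add_one]
  simp

lemma mb_coef_zero : mbCoef 0 = -1 / 2 := by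
  simp [mbCoef, riemannZeta_zero]

lemma mb_sum_odd (J : ℕ) (x : ℂ) : ∑ k ∈ Finset.range (2 * J + 1), mbCoef k * x ^ k =
    -1 / 2 + ∑ j ∈ Finset.range J, mbCoef (2 * j + 1) * x ^ (2 * j + 1) := by
  induction J with
  | zero => simp [mb_coef_zero]
  | succ J ih =>
    rw [show 2 * (J + 1) + 1 = 2 * J + 1 + 1 + 1 by ring, Finset.sum_range_succ,
      Finset.sum_range_succ, ih, Finset.sum_range_succ,
      show 2 * J + 1 + 1 = 2 * (J + 1) by ring, mb_coef_even]
    ring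

lemma mb_sum (M : ℕ) (hM : 1 ≤ M) (x : ℂ) : ∑ k ∈ Finset.range M, mbCoef k * x ^ k =
    -1 / 2 + ∑ j ∈ Finset.range (M / 2), mbCoef (2 * j + 1) * x ^ (2 * j + 1) := by
  rcases Nat.even_or_odd' M with ⟨J, h | h⟩
  · have : M / 2 = J := by omega
    rw [this, ← mb_sum_odd, Finset.sum_range_succ, ← h]
    obtain ⟨i, rfl⟩ : ∃ i, J = i + 1 := ⟨J - 1, by omega⟩
    rw [h, mb_coef_even]; simp
  · have : M / 2 = J := by omega
    rw [this, ← mb_sum_odd, h]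

lemma mb_coef_hasSum (j : ℕ) (t : ℝ) :
    HasSum (fun n : ℕ => 2 * (t : ℂ) / (2 * Real.pi * (n + 1)) ^ 2 *
      (-((t : ℂ) ^ 2 / (2 * Real.pi * (n + 1)) ^ 2)) ^ j) (mbCoef (2 * j + 1) * t ^ (2 * j + 1)) := by
  have h := mb_zeta_hasSum ((2 * j + 2 : ℕ) : ℂ) (by
    rw [Complex.natCast_re]; push_cast
    have h3 : (0:ℝ) ≤ j := Nat.cast_nonneg j
    linarith)
  have h2 := h.mul_left (2 * (-1) ^ j * (2 * Real.pi : ℂ)⁻¹ ^ (2 * j + 2) * t ^ (2 * j + 1))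
  refine Eq.mp (congrArg₂ (fun f a => HasSum f a) (funext fun n => ?_) ?_) h2
  · rw [Complex.cpow_neg, Complex.cpow_natCast, neg_pow ((t : ℂ) ^ 2 / _)]
    rw [div_pow, ← pow_mul, ← pow_mul, inv_pow]
    have hpi : (Real.pi : ℂ) ≠ 0 := by exact_mod_cast Real.pi_ne_zero
    have hn1 : (n : ℂ) + 1 ≠ 0 := by exact_mod_cast Nat.succ_ne_zero n
    rw [mul_pow _ ((n:ℂ) + 1) (2 * j), mul_pow _ ((n:ℂ) + 1) 2, pow_add, pow_add, pow_add]
    field_simp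
  · rw [mb_coef_odd]; ring

lemma mb_g (M : ℕ) (hM : 1 ≤ M) (σ : ℝ) (h1 : (M : ℝ) - 1 < σ) (h2 : σ < M) (t : ℝ) (ht : 0 < t) :
    (∫ τ : ℝ, (t : ℂ) ^ ((σ : ℂ) + (τ : ℂ) * Complex.I) *
        (Complex.Gamma (-((σ : ℂ) + (τ : ℂ) * Complex.I)) *
      riemannZeta (-((σ : ℂ) + (τ : ℂ) * Complex.I)))) =
    2 * Real.pi * ((Complex.exp t - 1)⁻¹ - (t : ℂ)⁻¹ - ∑ k ∈ Finset.range M, mbCoef k * t ^ k) := by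
  have hM' : (1 : ℝ) ≤ M := by exact_mod_cast hM
  have hJ1 : (2 * (M / 2 : ℕ) : ℝ) ≤ M := by exact_mod_cast (by omega : 2 * (M / 2) ≤ M)
  have hJ2 : (M : ℝ) ≤ 2 * (M / 2 : ℕ) + 1 := by exact_mod_cast (by omega : M ≤ 2 * (M / 2) + 1)
  have hG := mb_G σ (M / 2) (by linarith) (by
    intro n h
    rw [← h] at h1 h2
    have h3 : (M : ℤ) - 1 < n := by exact_mod_cast h1
    have h4 : n < (M : ℤ) := by exact_mod_cast h2
    omega) (by linarith) (by linarith) t ht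
  refine hG.unique ?_
  refine HasSum.mul_left _ ?_
  rw [mb_sum M hM]
  have h3 := (mb_cot t ht).sub (hasSum_sum (s := Finset.range (M / 2))
    (fun j _ => mb_coef_hasSum j t))
  refine Eq.mp (congrArg₂ (fun f a => HasSum f a) (funext fun n => ?_) ?_) h3
  · have hpi : (Real.pi : ℂ) ≠ 0 := by exact_mod_cast Real.pi_ne_zero
    have hn1 : (n : ℂ) + 1 ≠ 0 := by exact_mod_cast Nat.succ_ne_zero n
    have h5 : (2 * Real.pi * ((n:ℂ) + 1)) ^ 2 + t ^ 2 ≠ 0 := by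
      exact_mod_cast (by positivity : (2 * Real.pi * ((n:ℝ) + 1)) ^ 2 + t ^ 2 ≠ 0)
    have h6 : (2 * Real.pi * ((n:ℂ) + 1)) ^ 2 ≠ 0 := by simp [hpi, hn1]
    rw [← Finset.mul_sum]
    generalize (2 * Real.pi * ((n:ℂ) + 1)) ^ 2 = a at *
    have hg := geom_sum_mul (-((t:ℂ) ^ 2 / a)) (M / 2)
    generalize (∑ i ∈ Finset.range (M / 2), (-((t:ℂ) ^ 2 / a)) ^ i) = S at *
    generalize (-((t:ℂ) ^ 2 / a)) ^ (M / 2) = P at *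
    have hP : P = S * (-((t:ℂ) ^ 2 / a) - 1) + 1 := by rw [hg]; ring
    rw [hP]
    field_simp
    ring
  · ring


lemma mb_int_exp (a : ℂ) (ha : 0 < a.re) (r : ℝ) (hr : 0 < r) :
    IntegrableOn (fun t : ℝ => (t : ℂ) ^ (a - 1) * Complex.exp (-(r * t))) (Set.Ioi 0) ∧
    ∫ t : ℝ in Set.Ioi 0, (t : ℂ) ^ (a - 1) * Complex.exp (-(r * t)) =
      Complex.Gamma a * (r : ℂ) ^ (-a) := by
  have h := Complex.integral_cpow_mul_exp_neg_mul_Ioi (a := a) (r := r) ha (by simpa using hr)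
  rw [one_div, Complex.inv_cpow _ _
      (by rw [Complex.arg_ofReal_of_nonneg hr.le]; exact Real.pi_pos.ne), ← Complex.cpow_neg,
      mul_comm] at h
  refine ⟨?_, h⟩
  by_contra hcon
  rw [integral_undef hcon] at h
  have h1 := Complex.Gamma_ne_zero_of_re_pos ha
  have h2 : (r : ℂ) ^ (-a) ≠ 0 := by
    rw [Ne, Complex.cpow_eq_zero_iff]
    rintro ⟨h, -⟩
    exact hr.ne' (by exact_mod_cast h)
  exact mul_ne_zero h1 h2 h.symm

lemma mb_norm_exp (a : ℂ) (r : ℝ) (t : ℝ) (ht : 0 < t) :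
    ‖(t : ℂ) ^ (a - 1) * Complex.exp (-(r * t))‖ = t ^ (a.re - 1) * Real.exp (-(r * t)) := by
  rw [norm_mul, Complex.norm_cpow_eq_rpow_re_of_pos ht, Complex.norm_exp]
  simp

lemma mb_int_exp_real (a : ℝ) (ha : 0 < a) (r : ℝ) (hr : 0 < r) :
    IntegrableOn (fun t : ℝ => t ^ (a - 1) * Real.exp (-(r * t))) (Set.Ioi 0) := by
  have h := (mb_int_exp a (by simpa using ha) r hr).1.norm
  refine IntegrableOn.congr_fun h (fun t ht => ?_) measurableSet_Ioi
  simpa using mb_norm_exp a r t ht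

lemma mb_Gamma_bound (a : ℂ) (ha : 0 < a.re) : ‖Complex.Gamma a‖ ≤ Real.Gamma a.re := by
  have h := (mb_int_exp a ha 1 one_pos).2
  simp only [Complex.ofReal_one, Complex.one_cpow, mul_one] at h
  rw [← h]
  refine (norm_integral_le_integral_norm _).trans ?_
  have h2 := Real.integral_rpow_mul_exp_neg_mul_Ioi ha one_pos
  simp only [div_one, Real.one_rpow, one_mul] at h2
  rw [← h2]
  refine le_of_eq (setIntegral_congr_fun measurableSet_Ioi fun t ht => ?_)
  have := mb_norm_exp a 1 t ht
  simpa using this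

lemma mb_hurwitz (s : ℂ) (hs : 1 < s.re) (r : ℝ) (hr : 0 < r) :
    IntegrableOn (fun t : ℝ => (t : ℂ) ^ (s - 1) * Complex.exp (-(r * t)) * (Complex.exp t - 1)⁻¹)
      (Set.Ioi 0) ∧
    HasSum (fun n : ℕ => Complex.Gamma s * ((r + (n + 1) : ℝ) : ℂ) ^ (-s))
      (∫ t : ℝ in Set.Ioi 0,
        (t : ℂ) ^ (s - 1) * Complex.exp (-(r * t)) * (Complex.exp t - 1)⁻¹) := by
  constructor
  · refine Integrable.mono' (mb_int_exp_real (s.re - 1) (by linarith) r hr) ?_ ?_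
    · exact Measurable.aestronglyMeasurable (by fun_prop)
    · refine (ae_restrict_iff' measurableSet_Ioi).2 (Filter.Eventually.of_forall fun t ht => ?_)
      have ht' : (0:ℝ) < t := ht
      rw [norm_mul, mb_norm_exp s r t ht, norm_inv]
      have h1 : ‖Complex.exp t - 1‖ = Real.exp t - 1 := by
        rw [show Complex.exp t - 1 = ((Real.exp t - 1 : ℝ) : ℂ) by push_cast; rfl,
          Complex.norm_real, Real.norm_of_nonneg]
        linarith [Real.add_one_le_exp t]
      rw [h1, show s.re - 1 - 1 = (s.re - 1) + (-1) by ring, Real.rpow_add ht', Real.rpow_neg_one]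
      have h2 : (Real.exp t - 1)⁻¹ ≤ t⁻¹ := inv_anti₀ ht' (by linarith [Real.add_one_le_exp t])
      have h3 : 0 ≤ t ^ (s.re - 1) * Real.exp (-(r * t)) := by positivity
      nlinarith [mul_le_mul_of_nonneg_left h2 h3]
  · have hpos : ∀ n : ℕ, 0 < r + ((n : ℝ) + 1) := fun n => by positivity
    have h1 : ∀ n : ℕ, Integrable (fun t : ℝ => (t : ℂ) ^ (s - 1) *
        Complex.exp (-(((r + (n + 1) : ℝ) : ℂ) * t))) (volume.restrict (Set.Ioi 0)) :=
      fun n => (mb_int_exp s (by linarith) _ (hpos n)).1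
    have h2 : ∀ n : ℕ, ∫ t in Set.Ioi (0:ℝ), ‖(t : ℂ) ^ (s - 1) *
        Complex.exp (-(((r + (n + 1) : ℝ) : ℂ) * t))‖ =
        (r + (n + 1)) ^ (-s.re) * Real.Gamma s.re := by
      intro n
      rw [setIntegral_congr_fun measurableSet_Ioi (fun t ht => mb_norm_exp s _ t ht),
        Real.integral_rpow_mul_exp_neg_mul_Ioi (by linarith) (hpos n), one_div,
        Real.inv_rpow (hpos n).le, Real.rpow_neg (hpos n).le]
    have h3 : Summable fun n : ℕ => ∫ t in Set.Ioi (0:ℝ), ‖(t : ℂ) ^ (s - 1) *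
        Complex.exp (-(((r + (n + 1) : ℝ) : ℂ) * t))‖ := by
      simp_rw [h2]
      refine Summable.mul_right _ ?_
      have := (Real.summable_nat_rpow (p := -s.re)).2 (by linarith)
      have h := (summable_nat_add_iff 1).2 this
      refine Summable.of_nonneg_of_le (fun n => (Real.rpow_pos_of_pos (hpos n) _).le) (fun n => ?_) h
      push_cast
      exact Real.rpow_le_rpow_of_nonpos (by positivity) (by linarith) (by linarith)
    have h4 := hasSum_integral_of_summable_integral_norm h1 h3
    refine Eq.mp (congrArg₂ (fun f a => HasSum f a) (funext fun n => ?_) ?_) h4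
    · exact (mb_int_exp s (by linarith) _ (hpos n)).2
    · refine setIntegral_congr_fun measurableSet_Ioi fun t ht => ?_
      have ht' : (0:ℝ) < t := ht
      have hq : ‖Complex.exp (-(t:ℂ))‖ < 1 := by
        rw [Complex.norm_exp]; simpa using ht'
      have hg := (hasSum_geometric_of_norm_lt_one hq).mul_left
        ((t : ℂ) ^ (s - 1) * Complex.exp (-(r * t)) * Complex.exp (-(t:ℂ)))
      have e : ∀ n : ℕ, (t : ℂ) ^ (s - 1) * Complex.exp (-(((r + (n + 1) : ℝ) : ℂ) * t)) =
          ((t : ℂ) ^ (s - 1) * Complex.exp (-(r * t)) * Complex.exp (-(t:ℂ))) *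
            Complex.exp (-(t:ℂ)) ^ n := by
        intro n
        rw [← Complex.exp_nat_mul, mul_assoc, mul_assoc, ← Complex.exp_add, ← Complex.exp_add]
        congr 2
        push_cast; ring
      simp_rw [e]
      rw [hg.tsum_eq, mul_assoc]
      congr 1
      have hE := Complex.exp_ne_zero (t : ℂ)
      rw [Complex.exp_neg]
      rw [show 1 - (Complex.exp (t:ℂ))⁻¹ = (Complex.exp t - 1) / Complex.exp t by field_simp, inv_div]
      field_simp

lemma mb_parseval (σ : ℝ) (Φ : ℝ → ℂ) (hΦ : Integrable Φ) (s : ℂ) (hs : 0 < s.re + σ)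
    (r : ℝ) (hr : 0 < r) :
    ∫ τ : ℝ, Complex.Gamma (s + ((σ : ℂ) + (τ : ℂ) * Complex.I)) *
      (r : ℂ) ^ (-(s + ((σ : ℂ) + (τ : ℂ) * Complex.I))) * Φ τ =
    ∫ t : ℝ in Set.Ioi 0, (t : ℂ) ^ (s - 1) * Complex.exp (-(r * t)) *
      ∫ τ : ℝ, (t : ℂ) ^ ((σ : ℂ) + (τ : ℂ) * Complex.I) * Φ τ := by
  set K : ℝ → ℝ → ℂ := fun τ t => (t : ℂ) ^ (s + ((σ : ℂ) + (τ : ℂ) * Complex.I) - 1) *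
    Complex.exp (-(r * t)) * Φ τ with hK
  have hint : Integrable (Function.uncurry K) (volume.prod (volume.restrict (Set.Ioi (0:ℝ)))) := by
    have h1 := (hΦ.norm).mul_prod (mb_int_exp_real (s.re + σ) hs r hr)
    refine Integrable.mono' h1 ?_ ?_
    · have h2 : AEStronglyMeasurable (fun p : ℝ × ℝ => Φ p.1)
          (volume.prod (volume.restrict (Set.Ioi (0:ℝ)))) := hΦ.aestronglyMeasurable.comp_fst
      refine AEStronglyMeasurable.mul (f := fun p : ℝ × ℝ =>
        (p.2 : ℂ) ^ (s + ((σ : ℂ) + (p.1 : ℂ) * Complex.I) - 1) * Complex.exp (-(r * p.2))) ?_ h2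
      exact Measurable.aestronglyMeasurable (by fun_prop)
    · have h3 : ∀ᵐ t ∂(volume.restrict (Set.Ioi (0:ℝ))), t ∈ Set.Ioi (0:ℝ) :=
        ae_restrict_mem measurableSet_Ioi
      filter_upwards [Measure.quasiMeasurePreserving_snd.ae h3] with p hp
      simp only [Function.uncurry, hK]
      rw [norm_mul, mb_norm_exp _ r _ hp]
      rw [Complex.add_re, mb_line_re]
      exact le_of_eq (mul_comm _ _)
  have hsw := integral_integral_swap hint
  calc _ = ∫ τ : ℝ, ∫ t in Set.Ioi (0:ℝ), K τ t := by
        congr 1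
        ext τ
        simp only [hK]
        rw [integral_mul_const, (mb_int_exp _ (by simpa using hs) r hr).2]
    _ = _ := by
        rw [hsw]
        refine setIntegral_congr_fun measurableSet_Ioi fun t ht => ?_
        have ht' : (t : ℂ) ≠ 0 := by
          have : (0:ℝ) < t := ht
          exact_mod_cast this.ne'
        simp only [hK]
        rw [← integral_const_mul]
        congr 1
        ext τ
        rw [show s + ((σ : ℂ) + (τ : ℂ) * Complex.I) - 1 =
          (s - 1) + ((σ : ℂ) + (τ : ℂ) * Complex.I) by ring, Complex.cpow_add _ _ ht']
        ring

lemma mb_H (M : ℕ) (hM : 1 ≤ M) (σ : ℝ) (h1 : (M : ℝ) - 1 < σ) (h2 : σ < M)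
    (s : ℂ) (hs : 1 < s.re) (r : ℝ) (hr : 0 < r) :
    ∫ τ : ℝ, Complex.Gamma (s + ((σ : ℂ) + (τ : ℂ) * Complex.I)) *
      (r : ℂ) ^ (-(s + ((σ : ℂ) + (τ : ℂ) * Complex.I))) *
        (Complex.Gamma (-((σ : ℂ) + (τ : ℂ) * Complex.I)) *
          riemannZeta (-((σ : ℂ) + (τ : ℂ) * Complex.I))) =
    2 * Real.pi * (Complex.Gamma s * (∑' n : ℕ, ((r + (n + 1) : ℝ) : ℂ) ^ (-s)) -
      Complex.Gamma (s - 1) * (r : ℂ) ^ (-(s - 1)) -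
      ∑ k ∈ Finset.range M, mbCoef k * (Complex.Gamma (s + k) * (r : ℂ) ^ (-(s + k)))) := by
  have hM' : (1 : ℝ) ≤ M := by exact_mod_cast hM
  have hΦ := mb_phi_integrable σ (by linarith) (by
    intro n h
    rw [← h] at h1 h2
    have h3 : (M : ℤ) - 1 < n := by exact_mod_cast h1
    have h4 : n < (M : ℤ) := by exact_mod_cast h2
    omega)
  rw [mb_parseval σ _ hΦ s (by linarith) r hr]
  obtain ⟨i1, e1⟩ := mb_hurwitz s hs r hr
  obtain ⟨i2, e2⟩ := mb_int_exp (s - 1) (by simpa using hs) r hr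
  have hk : ∀ k : ℕ, 0 < (s + k).re := fun k => by
    simp; have : (0:ℝ) ≤ k := Nat.cast_nonneg k
    linarith
  have i3 : ∀ k ∈ Finset.range M, Integrable (fun t : ℝ => mbCoef k *
      ((t : ℂ) ^ (s + k - 1) * Complex.exp (-(r * t)))) (volume.restrict (Set.Ioi 0)) :=
    fun k _ => (mb_int_exp (s + k) (hk k) r hr).1.const_mul _
  have e : ∀ t ∈ Set.Ioi (0:ℝ), ((t : ℂ) ^ (s - 1) * Complex.exp (-(r * t)) *
      ∫ τ : ℝ, (t : ℂ) ^ ((σ : ℂ) + (τ : ℂ) * Complex.I) *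
        (Complex.Gamma (-((σ : ℂ) + (τ : ℂ) * Complex.I)) *
      riemannZeta (-((σ : ℂ) + (τ : ℂ) * Complex.I)))) =
      2 * Real.pi * ((t : ℂ) ^ (s - 1) * Complex.exp (-(r * t)) * (Complex.exp t - 1)⁻¹ -
        (t : ℂ) ^ (s - 1 - 1) * Complex.exp (-(r * t)) - ∑ k ∈ Finset.range M, mbCoef k *
      ((t : ℂ) ^ (s + k - 1) * Complex.exp (-(r * t)))) := by
    intro t ht
    have ht' : (t : ℂ) ≠ 0 := by
      have : (0:ℝ) < t := ht
      exact_mod_cast this.ne'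
    rw [mb_g M hM σ h1 h2 t ht]
    have e3 : (t : ℂ) ^ (s - 1 - 1) = (t : ℂ) ^ (s - 1) * (t : ℂ)⁻¹ := by
      rw [Complex.cpow_sub _ _ ht', Complex.cpow_one, div_eq_mul_inv]
    have e4 : ∀ k : ℕ, (t : ℂ) ^ (s + k - 1) = (t : ℂ) ^ (s - 1) * (t : ℂ) ^ k := by
      intro k
      rw [show s + k - 1 = s - 1 + k by ring, Complex.cpow_add _ _ ht', Complex.cpow_natCast]
    simp_rw [e4, e3]
    have e5 : ∑ k ∈ Finset.range M, mbCoef k *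
      ((t : ℂ) ^ (s - 1) * (t : ℂ) ^ k * Complex.exp (-(r * t))) =
      ((t : ℂ) ^ (s - 1) * Complex.exp (-(r * t))) * ∑ k ∈ Finset.range M, mbCoef k * (t : ℂ) ^ k := by
      rw [Finset.mul_sum]
      refine Finset.sum_congr rfl fun k _ => by ring
    rw [e5]
    ring
  have i12 : Integrable (fun t : ℝ => (t : ℂ) ^ (s - 1) * Complex.exp (-(r * t)) *
      (Complex.exp t - 1)⁻¹ - (t : ℂ) ^ (s - 1 - 1) * Complex.exp (-(r * t)))
      (volume.restrict (Set.Ioi 0)) := i1.sub i2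
  rw [setIntegral_congr_fun measurableSet_Ioi e, integral_const_mul, integral_sub i12
    (integrable_finsetSum _ i3), integral_sub i1 i2, integral_finsetSum _ i3, e2, ← e1.tsum_eq,
    tsum_mul_left]
  congr 2
  refine Finset.sum_congr rfl fun k _ => ?_
  rw [integral_const_mul, (mb_int_exp (s + k) (hk k) r hr).2]


lemma mb_dz_summable (s₁ s₂ : ℂ) (h₂ : 1 < s₂.re) (h₁₂ : 2 < (s₁ + s₂).re) :
    Summable (fun p : ℕ × ℕ => ((p.1 : ℂ) + 1) ^ (-s₁) *
      ((((p.1 : ℝ) + 1) + ((p.2 : ℝ) + 1) : ℝ) : ℂ) ^ (-s₂)) := by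
  rw [Complex.add_re] at h₁₂
  obtain ⟨ε, h0, h1, h3⟩ : ∃ ε : ℝ, 0 < ε ∧ ε ≤ s₂.re - 1 ∧ ε < s₁.re + s₂.re - 2 := by
    obtain ⟨ε, h, h'⟩ := exists_between (a₁ := (0:ℝ)) (a₂ := min (s₂.re - 1) (s₁.re + s₂.re - 2))
      (lt_min (by linarith) (by linarith))
    exact ⟨ε, h, h'.le.trans (min_le_left _ _), h'.trans_le (min_le_right _ _)⟩
  have sm : ∀ a : ℝ, 1 < a → Summable fun n : ℕ => ((n : ℝ) + 1) ^ (-a) := fun a ha => by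
    have := (summable_nat_add_iff 1).2 ((Real.summable_nat_rpow (p := -a)).2 (by linarith))
    refine this.congr fun n => ?_
    push_cast; rfl
  have hs := Summable.mul_of_nonneg (sm (s₁.re + s₂.re - 1 - ε) (by linarith))
    (sm (1 + ε) (by linarith)) (fun n => by positivity) (fun n => by positivity)
  refine Summable.of_norm_bounded hs fun p => ?_
  have hp : (0:ℝ) < (p.1 : ℝ) + 1 := by positivity
  have hq : (0:ℝ) < (p.2 : ℝ) + 1 := by positivity
  have e : ((p.1 : ℂ) + 1) = (((p.1 : ℝ) + 1 : ℝ) : ℂ) := by push_cast; rfl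
  rw [norm_mul, e, Complex.norm_cpow_eq_rpow_re_of_pos hp,
    Complex.norm_cpow_eq_rpow_re_of_pos (by positivity), Complex.neg_re, Complex.neg_re]
  rw [show -(s₁.re + s₂.re - 1 - ε) = -s₁.re + -(s₂.re - 1 - ε) by ring, Real.rpow_add hp, mul_assoc]
  refine mul_le_mul_of_nonneg_left ?_ (by positivity)
  rw [show -s₂.re = -(s₂.re - 1 - ε) + -(1 + ε) by ring, Real.rpow_add (by positivity)]
  refine mul_le_mul ?_ ?_ (by positivity) (by positivity)
  · exact Real.rpow_le_rpow_of_nonpos hp (by linarith) (by linarith)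
  · exact Real.rpow_le_rpow_of_nonpos hq (by linarith) (by linarith)

lemma mb_zeta2 (s₁ s₂ : ℂ) (h₂ : 1 < s₂.re) (h₁₂ : 2 < (s₁ + s₂).re) :
    HasSum (fun m : ℕ => ((m : ℂ) + 1) ^ (-s₁) *
      ∑' n : ℕ, ((((m : ℝ) + 1) + ((n : ℝ) + 1) : ℝ) : ℂ) ^ (-s₂)) (zeta2 s₁ s₂) := by
  have hs := mb_dz_summable s₁ s₂ h₂ h₁₂
  have e : zeta2 s₁ s₂ = ∑' p : ℕ × ℕ, ((p.1 : ℂ) + 1) ^ (-s₁) *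
      ((((p.1 : ℝ) + 1) + ((p.2 : ℝ) + 1) : ℝ) : ℂ) ^ (-s₂) := by
    rw [zeta2, ← (Equiv.prodCongr Equiv.pnatEquivNat Equiv.pnatEquivNat).symm.tsum_eq]
    refine tsum_congr fun p => ?_
    simp
  have h := hs.hasSum
  rw [← e] at h
  have h' := h.prod_fiberwise (fun m => (hs.prod_factor m).hasSum)
  refine Eq.mp (congrArg₂ (fun f a => HasSum f a) (funext fun m => ?_) rfl) h'
  simp only [tsum_mul_left]

lemma mb_gphi_integrable (σ : ℝ) (h0 : 0 < σ) (hn : ∀ n : ℤ, (n : ℝ) ≠ σ) (s : ℂ)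
    (hs : 0 < s.re) :
    Integrable (fun τ : ℝ => Complex.Gamma (s + ((σ : ℂ) + (τ : ℂ) * Complex.I)) *
      (Complex.Gamma (-((σ : ℂ) + (τ : ℂ) * Complex.I)) *
          riemannZeta (-((σ : ℂ) + (τ : ℂ) * Complex.I)))) := by
  have hre : ∀ τ : ℝ, (s + ((σ : ℂ) + (τ : ℂ) * Complex.I)).re = s.re + σ := fun τ => by simp
  refine Integrable.bdd_mul (c := Real.Gamma (s.re + σ)) (mb_phi_integrable σ h0 hn) ?_ ?_
  · refine Continuous.aestronglyMeasurable ?_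
    rw [continuous_iff_continuousAt]
    intro τ
    have hc := Complex.continuousAt_Gamma (s + ((σ : ℂ) + (τ : ℂ) * Complex.I)) (by
      intro m h
      have := hre τ
      rw [h] at this
      simp at this
      have hm : (0:ℝ) ≤ m := Nat.cast_nonneg m
      linarith)
    refine ContinuousAt.comp (f := fun τ : ℝ => s + ((σ : ℂ) + (τ : ℂ) * Complex.I)) hc ?_
    exact Continuous.continuousAt (by fun_prop)
  · refine Filter.Eventually.of_forall fun τ => ?_
    have := mb_Gamma_bound (s + ((σ : ℂ) + (τ : ℂ) * Complex.I)) (by rw [hre]; linarith)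
    rwa [hre] at this

lemma mb_final_integrable (σ : ℝ) (h0 : 0 < σ) (hn : ∀ n : ℤ, (n : ℝ) ≠ σ) (s c : ℂ)
    (hs : 0 < s.re) (hc : 1 < c.re) :
    Integrable (fun τ : ℝ => riemannZeta (c + ((σ : ℂ) + (τ : ℂ) * Complex.I)) *
      (Complex.Gamma (s + ((σ : ℂ) + (τ : ℂ) * Complex.I)) *
      (Complex.Gamma (-((σ : ℂ) + (τ : ℂ) * Complex.I)) *
          riemannZeta (-((σ : ℂ) + (τ : ℂ) * Complex.I))))) := by
  have hre : ∀ τ : ℝ, (c + ((σ : ℂ) + (τ : ℂ) * Complex.I)).re = c.re + σ := fun τ => by simp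
  refine Integrable.bdd_mul (c := ∑' n : ℕ, ((n : ℝ) + 1) ^ (-(c.re + σ)))
    (mb_gphi_integrable σ h0 hn s hs) ?_ ?_
  · exact (mb_zeta_cont c σ (by linarith)).aestronglyMeasurable
  · refine Filter.Eventually.of_forall fun τ => ?_
    have := mb_zeta_bound (c + ((σ : ℂ) + (τ : ℂ) * Complex.I)) (by rw [hre]; linarith)
    rwa [hre] at this

lemma mb_final_hasSum (σ : ℝ) (h0 : 0 < σ) (hn : ∀ n : ℤ, (n : ℝ) ≠ σ) (s₁ s : ℂ)
    (hs : 0 < s.re) (hc : 1 < (s₁ + s).re) :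
    HasSum (fun m : ℕ => ((m : ℂ) + 1) ^ (-s₁) *
      ∫ τ : ℝ, Complex.Gamma (s + ((σ : ℂ) + (τ : ℂ) * Complex.I)) *
      (((m : ℝ) + 1 : ℝ) : ℂ) ^ (-(s + ((σ : ℂ) + (τ : ℂ) * Complex.I))) *
        (Complex.Gamma (-((σ : ℂ) + (τ : ℂ) * Complex.I)) *
          riemannZeta (-((σ : ℂ) + (τ : ℂ) * Complex.I))))
    (∫ τ : ℝ, riemannZeta (s₁ + s + ((σ : ℂ) + (τ : ℂ) * Complex.I)) *
      (Complex.Gamma (s + ((σ : ℂ) + (τ : ℂ) * Complex.I)) *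
      (Complex.Gamma (-((σ : ℂ) + (τ : ℂ) * Complex.I)) *
          riemannZeta (-((σ : ℂ) + (τ : ℂ) * Complex.I))))) := by
  have hG := mb_gphi_integrable σ h0 hn s hs
  set G : ℝ → ℂ := fun τ : ℝ => Complex.Gamma (s + ((σ : ℂ) + (τ : ℂ) * Complex.I)) *
      (Complex.Gamma (-((σ : ℂ) + (τ : ℂ) * Complex.I)) *
          riemannZeta (-((σ : ℂ) + (τ : ℂ) * Complex.I))) with hGdef
  have hre : ∀ τ : ℝ, (s₁ + s + ((σ : ℂ) + (τ : ℂ) * Complex.I)).re = (s₁ + s).re + σ :=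
    fun τ => by simp
  have hpos : ∀ m : ℕ, (0:ℝ) < (m : ℝ) + 1 := fun m => by positivity
  have hnorm : ∀ (m : ℕ) (τ : ℝ),
      ‖((m : ℂ) + 1) ^ (-(s₁ + s + ((σ : ℂ) + (τ : ℂ) * Complex.I)))‖ =
      ((m : ℝ) + 1) ^ (-((s₁ + s).re + σ)) := fun m τ => by
    rw [show ((m : ℂ) + 1) = (((m : ℝ) + 1 : ℝ) : ℂ) by push_cast; rfl,
      Complex.norm_cpow_eq_rpow_re_of_pos (hpos m), Complex.neg_re, hre]
  have hne : ∀ m : ℕ, ((m : ℂ) + 1) ≠ 0 := fun m => Nat.cast_add_one_ne_zero m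
  have i1 : ∀ m : ℕ, Integrable (fun τ : ℝ =>
      ((m : ℂ) + 1) ^ (-(s₁ + s + ((σ : ℂ) + (τ : ℂ) * Complex.I))) * G τ) := fun m => by
    refine Integrable.bdd_mul (c := ((m : ℝ) + 1) ^ (-((s₁ + s).re + σ))) hG ?_ ?_
    · refine Continuous.aestronglyMeasurable ?_
      refine Continuous.const_cpow (by fun_prop) (Or.inl (hne m))
    · exact Filter.Eventually.of_forall fun τ => (hnorm m τ).le
  have i2 : Summable fun m : ℕ => ∫ τ : ℝ,
      ‖((m : ℂ) + 1) ^ (-(s₁ + s + ((σ : ℂ) + (τ : ℂ) * Complex.I))) * G τ‖ := by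
    simp_rw [norm_mul, hnorm, integral_const_mul]
    refine Summable.mul_right _ ?_
    have := (summable_nat_add_iff 1).2
      ((Real.summable_nat_rpow (p := -((s₁ + s).re + σ))).2 (by linarith))
    refine this.congr fun n => ?_
    push_cast; rfl
  have h := hasSum_integral_of_summable_integral_norm i1 i2
  refine Eq.mp (congrArg₂ (fun f a => HasSum f a) (funext fun m => ?_) ?_) h
  · rw [← integral_const_mul]
    refine integral_congr_ae (Filter.Eventually.of_forall fun τ => ?_)
    simp only [hGdef]
    rw [show -(s₁ + s + ((σ : ℂ) + (τ : ℂ) * Complex.I)) =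
      -s₁ + -(s + ((σ : ℂ) + (τ : ℂ) * Complex.I)) by ring, Complex.cpow_add _ _ (hne m)]
    rw [show (((m : ℝ) + 1 : ℝ) : ℂ) = ((m : ℂ) + 1) by push_cast; rfl]
    ring
  · refine integral_congr_ae (Filter.Eventually.of_forall fun τ => ?_)
    simp only
    rw [tsum_mul_right, (mb_zeta_hasSum _ (by rw [hre]; linarith)).tsum_eq]

lemma mb_Gamma_genBinom (s : ℂ) (hs : 0 < s.re) (k : ℕ) :
    mbCoef k * Complex.Gamma (s + k) =
      Complex.Gamma s * (genBinom (-s) k * riemannZeta (-(k : ℂ))) := by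
  have h : Complex.Gamma (s + k) =
      Complex.Gamma s * (-1) ^ k * ∏ i ∈ Finset.range k, (-s - (i : ℂ)) := by
    induction k with
    | zero => simp
    | succ k ih =>
      have hne : s + k ≠ 0 := by
        intro h
        have := congrArg Complex.re h
        simp at this
        have hm : (0:ℝ) ≤ k := Nat.cast_nonneg k
        linarith
      rw [Nat.cast_add, Nat.cast_one, ← add_assoc, Complex.Gamma_add_one _ hne, ih,
        Finset.prod_range_succ]
      ring
  have h1 : ((-1 : ℂ) ^ k) * (-1) ^ k = 1 := by rw [← mul_pow]; simp
  rw [h, mbCoef, genBinom]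
  linear_combination (riemannZeta (-(k : ℂ)) / (k.factorial : ℂ) * Complex.Gamma s *
    ∏ i ∈ Finset.range k, (-s - (i : ℂ))) * h1


/-- The Mellin–Barnes integral formula for the double zeta-function: for a positive
integer `M`, `0 < η < 1`, `Re s₂ > 1` and `Re(s₁+s₂) > 2`,
`ζ₂(s₁,s₂) = ζ(s₁+s₂-1)/(s₂-1) + ∑_{k=0}^{M-1} C(-s₂,k) ζ(s₁+s₂+k) ζ(-k)
  + Γ(s₂)⁻¹ (2πi)⁻¹ ∫_{Re z = M-η} Γ(s₂+z)Γ(-z)ζ(s₁+s₂+z)ζ(-z) dz`,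
the vertical-line integral being parametrized by `z = (M-η) + τ i`, `τ ∈ ℝ` (so that
`(2πi)⁻¹ ∫ … dz = (2π)⁻¹ ∫_ℝ … dτ`), and this integral converging absolutely. -/
theorem statement7 (M : ℕ) (hM : 1 ≤ M) (η : ℝ) (hη₁ : 0 < η) (hη₂ : η < 1)
    (s₁ s₂ : ℂ) (h₂ : 1 < s₂.re) (h₁₂ : 2 < (s₁ + s₂).re) :
    Integrable (fun τ : ℝ =>
      Complex.Gamma (s₂ + ((M : ℂ) - (η : ℂ) + (τ : ℂ) * Complex.I)) *
        Complex.Gamma (-((M : ℂ) - (η : ℂ) + (τ : ℂ) * Complex.I)) *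
        riemannZeta (s₁ + s₂ + ((M : ℂ) - (η : ℂ) + (τ : ℂ) * Complex.I)) *
        riemannZeta (-((M : ℂ) - (η : ℂ) + (τ : ℂ) * Complex.I))) ∧
    zeta2 s₁ s₂ =
      (s₂ - 1)⁻¹ * riemannZeta (s₁ + s₂ - 1) +
        (∑ k ∈ Finset.range M,
          genBinom (-s₂) k * riemannZeta (s₁ + s₂ + (k : ℂ)) * riemannZeta (-(k : ℂ))) +
        (Complex.Gamma s₂)⁻¹ *
          ((2 * (Real.pi : ℂ))⁻¹ *
            ∫ τ : ℝ,
              Complex.Gamma (s₂ + ((M : ℂ) - (η : ℂ) + (τ : ℂ) * Complex.I)) *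
                Complex.Gamma (-((M : ℂ) - (η : ℂ) + (τ : ℂ) * Complex.I)) *
                riemannZeta (s₁ + s₂ + ((M : ℂ) - (η : ℂ) + (τ : ℂ) * Complex.I)) *
                riemannZeta (-((M : ℂ) - (η : ℂ) + (τ : ℂ) * Complex.I))) := by
  have hM' : (1 : ℝ) ≤ M := by exact_mod_cast hM
  obtain ⟨σ, hσ⟩ : ∃ σ : ℝ, σ = (M : ℝ) - η := ⟨_, rfl⟩
  have hσc : (M : ℂ) - (η : ℂ) = (σ : ℂ) := by rw [hσ]; push_cast; rfl
  have l1 : (M : ℝ) - 1 < σ := by linarith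
  have l2 : σ < M := by linarith
  have l0 : 0 < σ := by linarith
  have hn : ∀ n : ℤ, (n : ℝ) ≠ σ := by
    intro n h
    rw [← h] at l1 l2
    have h3 : (M : ℤ) - 1 < n := by exact_mod_cast l1
    have h4 : n < (M : ℤ) := by exact_mod_cast l2
    omega
  rw [hσc]
  have hf : (fun τ : ℝ =>
      Complex.Gamma (s₂ + ((σ : ℂ) + (τ : ℂ) * Complex.I)) *
        Complex.Gamma (-((σ : ℂ) + (τ : ℂ) * Complex.I)) *
        riemannZeta (s₁ + s₂ + ((σ : ℂ) + (τ : ℂ) * Complex.I)) *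
        riemannZeta (-((σ : ℂ) + (τ : ℂ) * Complex.I))) =
      (fun τ : ℝ => riemannZeta (s₁ + s₂ + ((σ : ℂ) + (τ : ℂ) * Complex.I)) *
      (Complex.Gamma (s₂ + ((σ : ℂ) + (τ : ℂ) * Complex.I)) *
      (Complex.Gamma (-((σ : ℂ) + (τ : ℂ) * Complex.I)) *
          riemannZeta (-((σ : ℂ) + (τ : ℂ) * Complex.I))))) := by
    ext τ; ring
  rw [hf]
  refine ⟨mb_final_integrable σ l0 hn s₂ (s₁ + s₂) (by linarith) (by linarith), ?_⟩
  have hI := mb_final_hasSum σ l0 hn s₁ s₂ (by linarith) (by linarith)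
  have hZ := mb_zeta2 s₁ s₂ h₂ h₁₂
  have hne : ∀ m : ℕ, ((m : ℂ) + 1) ≠ 0 := fun m => Nat.cast_add_one_ne_zero m
  have z1 := mb_zeta_hasSum (s₁ + s₂ - 1) (by rw [Complex.sub_re, Complex.one_re]; linarith)
  have zk := fun k : ℕ => mb_zeta_hasSum (s₁ + s₂ + k) (by
    rw [Complex.add_re _ (k : ℂ), Complex.natCast_re]
    have hm : (0:ℝ) ≤ k := Nat.cast_nonneg k
    linarith)
  have hS := hasSum_sum (s := Finset.range M) (fun k _ =>
    (zk k).mul_left (mbCoef k * Complex.Gamma (s₂ + k)))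
  have hR := (((hZ.mul_left (Complex.Gamma s₂)).sub
    (z1.mul_left (Complex.Gamma (s₂ - 1)))).sub hS).mul_left (2 * (Real.pi : ℂ))
  have key := hI.unique (Eq.mp (congrArg₂ (fun f a => HasSum f a) (funext fun m => ?_) rfl) hR)
  · rw [key]
    have hG := Complex.Gamma_ne_zero_of_re_pos (s := s₂) (by linarith)
    have hs1 : s₂ - 1 ≠ 0 := by
      intro h
      have := congrArg Complex.re h
      simp at this
      linarith
    have hG1 : Complex.Gamma s₂ = (s₂ - 1) * Complex.Gamma (s₂ - 1) := by
      have := Complex.Gamma_add_one (s₂ - 1) hs1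
      rwa [sub_add_cancel] at this
    have hpi : (2 * (Real.pi : ℂ)) ≠ 0 := by
      simp [Real.pi_ne_zero]
    have hsum : ∑ k ∈ Finset.range M, mbCoef k * Complex.Gamma (s₂ + k) *
        riemannZeta (s₁ + s₂ + k) = Complex.Gamma s₂ * ∑ k ∈ Finset.range M,
          genBinom (-s₂) k * riemannZeta (s₁ + s₂ + (k : ℂ)) * riemannZeta (-(k : ℂ)) := by
      rw [Finset.mul_sum]
      refine Finset.sum_congr rfl fun k _ => ?_
      rw [mb_Gamma_genBinom s₂ (by linarith) k]
      ring
    rw [hsum, inv_mul_cancel_left₀ hpi, mul_sub, mul_sub, inv_mul_cancel_left₀ hG,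
      inv_mul_cancel_left₀ hG]
    have hq : (Complex.Gamma s₂)⁻¹ * (Complex.Gamma (s₂ - 1) * riemannZeta (s₁ + s₂ - 1)) =
        (s₂ - 1)⁻¹ * riemannZeta (s₁ + s₂ - 1) := by
      have hG2 : Complex.Gamma (s₂ - 1) ≠ 0 := by
        intro h
        rw [h, mul_zero] at hG1
        exact hG hG1
      rw [hG1]
      field_simp
    rw [hq]
    ring
  · have hr : (0:ℝ) < (m : ℝ) + 1 := by positivity
    rw [mb_H M hM σ l1 l2 s₂ h₂ _ hr]
    have hcast : (((m : ℝ) + 1 : ℝ) : ℂ) = ((m : ℂ) + 1) := by push_cast; rfl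
    rw [hcast]
    have c1 : ((m : ℂ) + 1) ^ (-(s₁ + s₂ - 1)) =
        ((m : ℂ) + 1) ^ (-s₁) * ((m : ℂ) + 1) ^ (-(s₂ - 1)) := by
      rw [← Complex.cpow_add _ _ (hne m)]; congr 1; ring
    have ck : ∀ k : ℕ, ((m : ℂ) + 1) ^ (-(s₁ + s₂ + k)) =
        ((m : ℂ) + 1) ^ (-s₁) * ((m : ℂ) + 1) ^ (-(s₂ + k)) := fun k => by
      rw [← Complex.cpow_add _ _ (hne m)]; congr 1; ring
    have cS : ∑ k ∈ Finset.range M, mbCoef k * Complex.Gamma (s₂ + k) *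
        ((m : ℂ) + 1) ^ (-(s₁ + s₂ + k)) = ((m : ℂ) + 1) ^ (-s₁) * ∑ k ∈ Finset.range M,
        mbCoef k * (Complex.Gamma (s₂ + k) * ((m : ℂ) + 1) ^ (-(s₂ + k))) := by
      rw [Finset.mul_sum]
      refine Finset.sum_congr rfl fun k _ => ?_
      rw [ck]
      ring
    rw [cS, c1]
    ring
end

section
/- Let 0 < η < 1 and let (s₁,s₂,s₃) ∈ ℂ³ with Re s₃ > 1, Re(s₂+s₃) > 2 and Re(s₁+s₂+s₃) > 3. Then ζ₃(s₁,s₂,s₃) = (1/(s₃−1)) ζ₂(s₁, s₂+s₃−1) − (1/2) ζ₂(s₁, s₂+s₃) + (1/Γ(s₃)) · (1/(2πi)) ∫_{Re z = 1−η} Γ(s₃+z) Γ(−z) ζ₂(s₁, s₂+s₃+z) ζ(−z) dz, where the integral is over the vertical line Re z = 1−η, it converges absolutely, and every occurrence of ζ₂ is within its domain of absolute convergence. -/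
open MeasureTheory

/-- The Euler–Zagier triple zeta-function
`ζ₃(s₁,s₂,s₃) = ∑_{0 < l < m < n} l^{-s₁} m^{-s₂} n^{-s₃}`. -/
noncomputable def zeta3 (s₁ s₂ s₃ : ℂ) : ℂ :=
  ∑' p : ℕ+ × ℕ+ × ℕ+,
    ((p.1 : ℕ) : ℂ) ^ (-s₁) * ((((p.1 : ℕ) + (p.2.1 : ℕ)) : ℂ) ^ (-s₂)) *
      ((((p.1 : ℕ) + (p.2.1 : ℕ) + (p.2.2 : ℕ)) : ℂ) ^ (-s₃))

section
open Complex


lemma aux_sum_bound (σ x : ℝ) (hσ : 1 < σ) (hx : 0 < x) :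
    (Summable fun k : ℕ+ => (x + (k : ℕ)) ^ (-σ)) ∧
    ∑' k : ℕ+, (x + (k : ℕ)) ^ (-σ) ≤ x ^ (1 - σ) / (σ - 1) := by
  have key : ∀ n : ℕ, ∑ i ∈ Finset.range n, (x + ((i + 1 : ℕ) : ℝ)) ^ (-σ) ≤ x ^ (1 - σ) / (σ - 1) := by
    intro n
    have h1 := AntitoneOn.sum_le_integral (x₀ := x) (a := n) (f := fun u : ℝ => u ^ (-σ)) (by
      intro a ha b hb hab
      exact Real.rpow_le_rpow_of_nonpos (by linarith [ha.1]) hab (by linarith))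
    refine h1.trans ?_
    rw [integral_rpow]
    · have : (x + (n:ℝ)) ^ (-σ + 1) ≥ 0 := by positivity
      rw [show -σ + 1 = -(σ - 1) by ring, div_neg, ← neg_div, show (1 - σ) = -(σ-1) by ring]
      gcongr
      rw [show -σ + 1 = -(σ - 1) by ring] at this
      linarith
    · right
      refine ⟨by linarith, ?_⟩
      rw [Set.uIcc_of_le (by simp)]
      intro h
      linarith [h.1]
  have nn : ∀ i : ℕ, 0 ≤ (x + ((i + 1 : ℕ) : ℝ)) ^ (-σ) := fun i => by positivity
  constructor
  · have := summable_of_sum_range_le nn key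
    exact (summable_pnat_iff_summable_succ (f := fun n : ℕ => (x + (n : ℝ)) ^ (-σ))).2 this
  · have := Real.tsum_le_of_sum_range_le nn key
    rwa [← tsum_pnat_eq_tsum_succ (f := fun n : ℕ => (x + (n : ℝ)) ^ (-σ))] at this

lemma aux_summable2 (a b : ℝ) (hb : 1 < b) (hab : 2 < a + b) :
    Summable fun p : ℕ+ × ℕ+ => ((p.1 : ℕ) : ℝ) ^ (-a) * (((p.1 : ℕ) : ℝ) + ((p.2 : ℕ) : ℝ)) ^ (-b) := by
  refine (summable_prod_of_nonneg (fun p => by dsimp only [Pi.zero_apply]; positivity)).2 ?_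
  have hpos : ∀ l : ℕ+, (0:ℝ) < (l : ℕ) := fun l => by exact_mod_cast l.pos
  dsimp only
  refine ⟨fun l => (aux_sum_bound b _ hb (hpos l)).1.mul_left _, ?_⟩
  have h1 : Summable fun l : ℕ+ => ((l : ℕ) : ℝ) ^ (-(a + b - 1)) := by
    have : Summable fun l : ℕ => (l : ℝ) ^ (-(a + b - 1)) := Real.summable_nat_rpow.2 (by linarith)
    exact this.comp_injective PNat.coe_injective
  refine Summable.of_nonneg_of_le (fun l => tsum_nonneg fun k => by positivity) (fun l => ?_) (h1.mul_right (1 / (b - 1)))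
  rw [tsum_mul_left]
  refine (mul_le_mul_of_nonneg_left (aux_sum_bound b _ hb (hpos l)).2 (by positivity)).trans (le_of_eq ?_)
  rw [show -(a + b - 1) = -a + (1 - b) by ring, Real.rpow_add (hpos l)]
  ring

lemma aux_summable3 (a b c : ℝ) (hc : 1 < c) (hb : 2 < b + c) (hab : 3 < a + b + c) :
    Summable fun q : (ℕ+ × ℕ+) × ℕ+ => ((q.1.1 : ℕ) : ℝ) ^ (-a) *
      (((q.1.1 : ℕ) : ℝ) + ((q.1.2 : ℕ) : ℝ)) ^ (-b) *
      (((q.1.1 : ℕ) : ℝ) + ((q.1.2 : ℕ) : ℝ) + ((q.2 : ℕ) : ℝ)) ^ (-c) := by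
  refine (summable_prod_of_nonneg (fun p => by dsimp only [Pi.zero_apply]; positivity)).2 ?_
  have hpos : ∀ l : ℕ+ × ℕ+, (0:ℝ) < ((l.1 : ℕ) : ℝ) + ((l.2 : ℕ) : ℝ) := fun l => by
    have := l.1.pos
    positivity
  dsimp only
  refine ⟨fun l => (aux_sum_bound c _ hc (hpos l)).1.mul_left _, ?_⟩
  have h1 := aux_summable2 a (b + c - 1) (by linarith) (by linarith)
  refine Summable.of_nonneg_of_le (fun l => tsum_nonneg fun k => by positivity) (fun l => ?_) (h1.mul_right (1 / (c - 1)))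
  rw [tsum_mul_left]
  refine (mul_le_mul_of_nonneg_left (aux_sum_bound c _ hc (hpos l)).2 (by positivity)).trans (le_of_eq ?_)
  rw [show -(b + c - 1) = -b + (1 - c) by ring, Real.rpow_add (hpos l)]
  ring

lemma aux_cos_lower (c y : ℝ) (hc : -1 < c) (hc' : c < 1) :
    Real.cos (Real.pi * c / 2) * (1 + y ^ 2) ≤ ‖Complex.cos (Real.pi * (c + y * I) / 2)‖ := by
  have hcos : 0 < Real.cos (Real.pi * c / 2) :=
    Real.cos_pos_of_mem_Ioo ⟨by nlinarith [Real.pi_pos], by nlinarith [Real.pi_pos]⟩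
  have h1 : (Complex.cos (Real.pi * (c + y * I) / 2)).re =
      Real.cos (Real.pi * c / 2) * Real.cosh (Real.pi * y / 2) := by
    rw [show (Real.pi * (c + y * I) / 2 : ℂ) = ((Real.pi * c / 2 : ℝ) : ℂ) + ((Real.pi * y / 2 : ℝ) : ℂ) * I by
      push_cast; ring, Complex.cos_add_mul_I]
    rw [← Complex.ofReal_cos, ← Complex.ofReal_cosh, ← Complex.ofReal_sin, ← Complex.ofReal_sinh,
      ← Complex.ofReal_mul, ← Complex.ofReal_mul, Complex.sub_re, Complex.ofReal_re, Complex.re_ofReal_mul]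
    simp only [Complex.I_re, mul_zero, sub_zero]
  have h2 : 1 + y ^ 2 ≤ Real.cosh (Real.pi * y / 2) := by
    have e : Real.cosh (Real.pi * y / 2) = 1 + 2 * Real.sinh (Real.pi * y / 4) ^ 2 := by
      rw [show Real.pi * y / 2 = 2 * (Real.pi * y / 4) by ring, Real.cosh_two_mul, Real.cosh_sq]
      ring
    have s : (Real.pi * y / 4) ^ 2 ≤ Real.sinh (Real.pi * y / 4) ^ 2 := by
      rw [sq_le_sq]
      rcases le_total 0 (Real.pi * y / 4) with h | h
      · rw [abs_of_nonneg h, abs_of_nonneg (Real.sinh_nonneg_iff.2 h)]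
        exact Real.self_le_sinh_iff.2 h
      · rw [abs_of_nonpos h, abs_of_nonpos (Real.sinh_nonpos_iff.2 h)]
        exact neg_le_neg (Real.sinh_le_self_iff.2 h)
    have : 8 ≤ Real.pi ^ 2 := by nlinarith [Real.pi_gt_three]
    rw [e]
    nlinarith [sq_nonneg y]
  calc _ ≤ Real.cos (Real.pi * c / 2) * Real.cosh (Real.pi * y / 2) := by gcongr
    _ = _ := h1.symm
    _ ≤ _ := (le_abs_self _).trans (Complex.abs_re_le_norm _)

lemma aux_inv_cos_integrable (c : ℝ) (hc : -1 < c) (hc' : c < 1) :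
    Integrable (fun y : ℝ => (Complex.cos (Real.pi * (c + y * I) / 2))⁻¹) := by
  have hcos : 0 < Real.cos (Real.pi * c / 2) :=
    Real.cos_pos_of_mem_Ioo ⟨by nlinarith [Real.pi_pos], by nlinarith [Real.pi_pos]⟩
  refine (integrable_inv_one_add_sq.const_mul (Real.cos (Real.pi * c / 2))⁻¹).mono' ?_ ?_
  · apply Measurable.aestronglyMeasurable
    fun_prop
  · refine Filter.Eventually.of_forall fun y => ?_
    rw [norm_inv, ← mul_inv]
    exact inv_anti₀ (by positivity) (aux_cos_lower c y hc hc')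


lemma aux_cot (t : ℝ) (ht : 0 < t) :
    HasSum (fun n : ℕ+ => ((2 * t / (t ^ 2 + (2 * Real.pi * (n : ℕ)) ^ 2) : ℝ) : ℂ))
      (1 / (Real.exp t - 1 : ℝ) - 1 / t + 1 / 2 : ℂ) := by
  have hsum : Summable (fun n : ℕ+ => ((2 * t / (t ^ 2 + (2 * Real.pi * (n : ℕ)) ^ 2) : ℝ) : ℂ)) := by
    have h1 : Summable fun n : ℕ+ => 2 * t * (1 / ((n : ℕ) : ℝ) ^ 2) :=
      ((Real.summable_one_div_nat_pow.2 one_lt_two).comp_injective PNat.coe_injective).mul_left _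
    refine (Complex.summable_ofReal).2 (Summable.of_nonneg_of_le (fun n => by positivity) (fun n => ?_) h1)
    have hn : (0:ℝ) < (n : ℕ) := by exact_mod_cast n.pos
    rw [mul_one_div]
    have : (1:ℝ) ≤ 2 * Real.pi := by linarith [Real.pi_gt_three]
    gcongr
    nlinarith [sq_nonneg t, mul_le_mul_of_nonneg_right (show (1:ℝ) ≤ (2*Real.pi)^2 by nlinarith) (sq_nonneg ((n:ℕ):ℝ))]
  have hpi : (Real.pi : ℂ) ≠ 0 := by exact_mod_cast Real.pi_ne_zero
  have htc : (t : ℂ) ≠ 0 := by exact_mod_cast ht.ne'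
  let z : UpperHalfPlane := ⟨I * (t / (2 * Real.pi) : ℝ), by
    rw [mul_comm, Complex.im_ofReal_mul, Complex.I_im]; positivity⟩
  have hz : (z : ℂ) = I * t / (2 * Real.pi) := by
    change I * ((t / (2 * Real.pi) : ℝ) : ℂ) = _
    push_cast; ring
  have e1 := pi_mul_cot_pi_q_exp z
  have e2 := cot_series_rep (UpperHalfPlane.coe_mem_integerComplement z)
  rw [e1] at e2
  have e3 : ∀ n : ℕ+, (1 / ((z:ℂ) - (n : ℕ)) + 1 / ((z:ℂ) + (n : ℕ))) =
      (-2 * Real.pi * I) * ((2 * t / (t ^ 2 + (2 * Real.pi * (n : ℕ)) ^ 2) : ℝ) : ℂ) := by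
    intro n
    have hn : (0:ℝ) < (n : ℕ) := by exact_mod_cast n.pos
    have hd : (t ^ 2 + (2 * Real.pi * (n : ℕ)) ^ 2 : ℂ) ≠ 0 := by
      have : (t ^ 2 + (2 * Real.pi * (n : ℕ)) ^ 2 : ℝ) ≠ 0 := by positivity
      exact_mod_cast this
    have hd1 : ((z:ℂ) - (n : ℕ)) ≠ 0 := by
      intro h
      have := congrArg Complex.re h
      rw [hz] at this
      have h' : (I * t / (2 * Real.pi) : ℂ) = ((t / (2 * Real.pi) : ℝ) : ℂ) * I := by push_cast; ring
      rw [h', Complex.sub_re, Complex.re_ofReal_mul, Complex.I_re, Complex.natCast_re, Complex.zero_re] at this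
      linarith
    have hd2 : ((z:ℂ) + (n : ℕ)) ≠ 0 := by
      intro h
      have := congrArg Complex.re h
      rw [hz] at this
      have h' : (I * t / (2 * Real.pi) : ℂ) = ((t / (2 * Real.pi) : ℝ) : ℂ) * I := by push_cast; ring
      rw [h', Complex.add_re, Complex.re_ofReal_mul, Complex.I_re, Complex.natCast_re, Complex.zero_re] at this
      linarith
    push_cast
    rw [div_add_div _ _ hd1 hd2, mul_div_assoc', div_eq_div_iff (mul_ne_zero hd1 hd2) hd, hz]
    have hI : I ^ 2 = -1 := I_sq
    field_simp
    linear_combination (2 * I * t^3) * hI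
  have e4 : Complex.exp (2 * Real.pi * I * z) = ((Real.exp (-t) : ℝ) : ℂ) := by
    rw [hz, Complex.ofReal_exp]
    congr 1
    have hI : I ^ 2 = -1 := I_sq
    push_cast
    field_simp
    linear_combination hI
  have hlt : Real.exp (-t) < 1 := by simpa using ht
  rw [e4, tsum_geometric_of_norm_lt_one (by rw [Complex.norm_real, Real.norm_of_nonneg (Real.exp_pos _).le]; exact hlt)] at e2
  simp_rw [e3] at e2
  rw [tsum_mul_left] at e2
  convert hsum.hasSum using 1
  set T := ∑' n : ℕ+, ((2 * t / (t ^ 2 + (2 * Real.pi * (n : ℕ)) ^ 2) : ℝ) : ℂ)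
  have hE : (1 - ((Real.exp (-t) : ℝ) : ℂ))⁻¹ = 1 + 1 / ((Real.exp t - 1 : ℝ) : ℂ) := by
    have h0 : Real.exp t - 1 ≠ 0 := by
      have : 1 < Real.exp t := by simpa using ht
      linarith
    have : (1 - Real.exp (-t))⁻¹ = 1 + 1 / (Real.exp t - 1) := by
      rw [Real.exp_neg]
      field_simp
      ring
    rw [← Complex.ofReal_one, ← Complex.ofReal_sub, ← Complex.ofReal_inv, this]
    push_cast; ring
  rw [hE, hz] at e2
  have hI : I ^ 2 = -1 := I_sq
  have h5 : 1 / (I * t / (2 * Real.pi)) = -2 * Real.pi * I * (1 / t : ℂ) := by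
    field_simp
    linear_combination hI
  rw [h5] at e2
  have h6 : (-2 * Real.pi * I : ℂ) ≠ 0 := by simp [hpi]
  apply mul_left_cancel₀ h6
  linear_combination e2

/-- Mellin transform of `1/(1+u)`. -/
lemma aux_mellin1 (a : ℂ) (h0 : 0 < a.re) (h1 : a.re < 1) :
    MellinConvergent (fun u : ℝ => ((1 + u)⁻¹ : ℂ)) a ∧
    mellin (fun u : ℝ => ((1 + u)⁻¹ : ℂ)) a = Gamma a * Gamma (1 - a) := by
  let f : ℝ → ℝ → ℂ := fun u v => (u : ℂ) ^ (a - 1) * ((Real.exp (-(1 + u) * v) : ℝ) : ℂ)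
  have hmeas : Measurable (Function.uncurry f) := by
    unfold f Function.uncurry
    fun_prop
  have hnorm : ∀ v : ℝ, ∀ u ∈ Set.Ioi (0:ℝ), ‖f u v‖ = Real.exp (-v) * (u ^ (a.re - 1) * Real.exp (-(v * u))) := by
    intro v u hu
    simp only [f]
    rw [norm_mul, Complex.norm_cpow_eq_rpow_re_of_pos hu, Complex.norm_real, Real.norm_of_nonneg (Real.exp_pos _).le,
      show -(1 + u) * v = -v + -(v * u) by ring, Real.exp_add]
    simp only [sub_re, one_re]
    ring
  have hInt : Integrable (Function.uncurry f) ((volume.restrict (Set.Ioi 0)).prod (volume.restrict (Set.Ioi 0))) := by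
    rw [integrable_prod_iff' hmeas.aestronglyMeasurable]
    constructor
    · refine (ae_restrict_iff' measurableSet_Ioi).2 (Filter.Eventually.of_forall fun v hv => ?_)
      have hv : 0 < v := hv
      have := (integrableOn_rpow_mul_exp_neg_mul_rpow (p := 1) (s := a.re - 1) (b := v) (by linarith) one_pos hv).const_mul (Real.exp (-v))
      refine this.mono' (hmeas.comp (measurable_id.prodMk measurable_const)).aestronglyMeasurable ?_
      refine (ae_restrict_iff' measurableSet_Ioi).2 (Filter.Eventually.of_forall fun u hu => ?_)
      change ‖f u v‖ ≤ _
      rw [hnorm v u hu]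
      simp
    · have e : Set.EqOn (fun v : ℝ => Real.exp (-v) * v ^ ((1 - a.re) - 1) * Real.Gamma a.re)
          (fun v : ℝ => ∫ u in Set.Ioi 0, ‖f u v‖) (Set.Ioi 0) := by
        intro v hv
        have hv : 0 < v := hv
        simp only
        rw [setIntegral_congr_fun measurableSet_Ioi (hnorm v), integral_const_mul, Real.integral_rpow_mul_exp_neg_mul_Ioi h0 hv,
          one_div, Real.inv_rpow hv.le, ← Real.rpow_neg hv.le]
        ring_nf
      exact IntegrableOn.congr_fun ((Real.GammaIntegral_convergent (s := 1 - a.re) (by linarith)).mul_const (Real.Gamma a.re)) e measurableSet_Ioi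
  have hinner : ∀ u ∈ Set.Ioi (0:ℝ), ∫ v in Set.Ioi 0, f u v = (u : ℂ) ^ (a - 1) • ((1 + u)⁻¹ : ℂ) := by
    intro u hu
    have hu : 0 < u := hu
    simp only [f, smul_eq_mul]
    rw [integral_const_mul]
    congr 1
    refine (integral_ofReal (f := fun v => Real.exp (-(1 + u) * v))).trans ?_
    rw [integral_exp_mul_Ioi (by linarith)]
    simp
    rw [neg_div, ← div_neg]
    ring_nf
  have hinner2 : ∀ v ∈ Set.Ioi (0:ℝ), ∫ u in Set.Ioi 0, f u v = Gamma a * (((Real.exp (-v) : ℝ) : ℂ) * (v : ℂ) ^ ((1 - a) - 1)) := by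
    intro v hv
    have hv : 0 < v := hv
    have : ∀ u ∈ Set.Ioi (0:ℝ), f u v = ((Real.exp (-v) : ℝ) : ℂ) * ((u : ℂ) ^ (a - 1) * cexp (-(v * u))) := by
      intro u hu
      simp only [f]
      rw [show -(1 + u) * v = -v + -(v * u) by ring, Real.exp_add]
      push_cast
      ring
    rw [setIntegral_congr_fun measurableSet_Ioi this, integral_const_mul, Complex.integral_cpow_mul_exp_neg_mul_Ioi h0 hv]
    rw [show (1 - a) - 1 = -a by ring, Complex.cpow_neg, one_div, Complex.inv_cpow _ _ (by
      rw [Complex.arg_ofReal_of_nonneg hv.le]; exact Real.pi_pos.ne)]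
    ring
  constructor
  · exact IntegrableOn.congr_fun hInt.integral_prod_left hinner measurableSet_Ioi
  · rw [mellin, ← setIntegral_congr_fun measurableSet_Ioi hinner, integral_integral_swap hInt,
      setIntegral_congr_fun measurableSet_Ioi hinner2, integral_const_mul, Complex.Gamma_eq_integral (s := 1 - a) (by simpa using h1)]
    rfl

lemma aux_mellin2 (w : ℂ) (h0 : -1 < w.re) (h1 : w.re < 1) :
    MellinConvergent (fun u : ℝ => ((u / (1 + u ^ 2) : ℝ) : ℂ)) w ∧
    mellin (fun u : ℝ => ((u / (1 + u ^ 2) : ℝ) : ℂ)) w = Real.pi / 2 * (Complex.cos (Real.pi * w / 2))⁻¹ := by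
  have e : (fun u : ℝ => ((u / (1 + u ^ 2) : ℝ) : ℂ)) =
      fun u : ℝ => (u : ℂ) ^ (1 : ℂ) • (fun u : ℝ => (fun u : ℝ => ((1 + u)⁻¹ : ℂ)) (u ^ (2:ℝ))) u := by
    funext u
    simp only [Complex.cpow_one, smul_eq_mul, Real.rpow_two]
    push_cast
    rfl
  have hre : ((w + 1) / ((2:ℝ) : ℂ)).re = (w.re + 1) / 2 := by
    rw [Complex.div_ofReal_re]; simp
  obtain ⟨m1, m2⟩ := aux_mellin1 ((w + 1) / ((2:ℝ) : ℂ)) (by rw [hre]; linarith) (by rw [hre]; linarith)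
  constructor
  · rw [e, MellinConvergent.cpow_smul, MellinConvergent.comp_rpow (f := fun u : ℝ => ((1 + u)⁻¹ : ℂ)) two_ne_zero]
    exact m1
  · rw [e, mellin_cpow_smul, mellin_comp_rpow (fun u : ℝ => ((1 + u)⁻¹ : ℂ)), m2, Complex.Gamma_mul_Gamma_one_sub]
    rw [show (Real.pi : ℂ) * ((w + 1) / ((2:ℝ) : ℂ)) = Real.pi * w / 2 + Real.pi / 2 by push_cast; ring,
      Complex.sin_add_pi_div_two]
    rw [abs_of_pos two_pos, Complex.real_smul]
    push_cast
    ring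

lemma aux_zeta_pnat (s : ℂ) (hs : 1 < s.re) :
    HasSum (fun n : ℕ+ => ((n : ℕ) : ℂ) ^ (-s)) (riemannZeta s) := by
  have h1 : Summable fun n : ℕ+ => ((n : ℕ) : ℂ) ^ (-s) := by
    have := (Complex.summable_one_div_nat_cpow.2 hs).comp_injective PNat.coe_injective
    refine this.congr fun n => ?_
    simp [Complex.cpow_neg]
  convert h1.hasSum using 1
  rw [zeta_eq_tsum_one_div_nat_add_one_cpow hs, tsum_pnat_eq_tsum_succ (f := fun n : ℕ => (n : ℂ) ^ (-s))]
  refine tsum_congr fun n => ?_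
  simp [Complex.cpow_neg]

lemma aux_GZ (w : ℂ) (h0 : -1 < w.re) (h1 : w.re < 0) :
    Gamma w * riemannZeta w =
      (2 * Real.pi : ℂ) ^ (w - 1) * Real.pi * (Complex.cos (Real.pi * w / 2))⁻¹ * riemannZeta (1 - w) := by
  have hz := riemannZeta_one_sub (s := 1 - w) (fun n h => by
      have := congrArg Complex.re h
      simp at this
      have hn : (0:ℝ) ≤ n := n.cast_nonneg
      linarith) (fun h => by
      have := congrArg Complex.re h
      simp at this
      linarith)
  rw [sub_sub_cancel, neg_sub, show (Real.pi * (1 - w) / 2 : ℂ) = Real.pi / 2 - Real.pi * w / 2 by ring,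
    Complex.cos_pi_div_two_sub] at hz
  have hs : Complex.sin (Real.pi * w / 2) ≠ 0 := by
    intro h
    obtain ⟨k, hk⟩ := Complex.sin_eq_zero_iff.1 h
    have hpi : (Real.pi : ℂ) ≠ 0 := by exact_mod_cast Real.pi_ne_zero
    have hw : w = ((2 * k : ℤ) : ℂ) := by
      push_cast
      field_simp at hk
      linear_combination hk
    rw [hw, Complex.intCast_re] at h0 h1
    have a : (-1 : ℤ) < 2 * k := by exact_mod_cast h0
    have b : 2 * k < (0 : ℤ) := by exact_mod_cast h1
    omega
  have hG := Complex.Gamma_mul_Gamma_one_sub w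
  rw [show (Real.pi * w : ℂ) = 2 * (Real.pi * w / 2) by ring, Complex.sin_two_mul] at hG
  rw [hz]
  calc _ = (2 * (2 * Real.pi : ℂ) ^ (w - 1) * Complex.sin (Real.pi * w / 2) * riemannZeta (1 - w)) * (Gamma w * Gamma (1 - w)) := by ring
    _ = (2 * (2 * Real.pi : ℂ) ^ (w - 1) * Complex.sin (Real.pi * w / 2) * riemannZeta (1 - w)) *
        (Real.pi * (2⁻¹ * (Complex.sin (Real.pi * w / 2))⁻¹ * (Complex.cos (Real.pi * w / 2))⁻¹)) := by
          rw [hG, div_eq_mul_inv (Real.pi : ℂ), mul_inv, mul_inv]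
    _ = _ := by field_simp

lemma aux_bound_zeta (c y : ℝ) (hc : c < 0) :
    ‖riemannZeta (1 - (c + y * I))‖ ≤ ∑' n : ℕ+, ((n : ℕ) : ℝ) ^ (c - 1) := by
  have hre : (-(1 - (c + y * I)) : ℂ).re = c - 1 := by simp
  have hs := aux_zeta_pnat (1 - (c + y * I)) (by simp; linarith)
  rw [← hs.tsum_eq]
  have hn : ∀ n : ℕ+, ‖((n : ℕ) : ℂ) ^ (-(1 - (c + y * I)) : ℂ)‖ = ((n : ℕ) : ℝ) ^ (c - 1) := fun n => by
    rw [Complex.norm_natCast_cpow_of_pos n.pos, hre]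
  have hsum : Summable fun n : ℕ+ => ((n : ℕ) : ℝ) ^ (c - 1) :=
    (Real.summable_nat_rpow.2 (by linarith)).comp_injective PNat.coe_injective
  refine (norm_tsum_le_tsum_norm (by simpa only [hn] using hsum)).trans (le_of_eq ?_)
  exact tsum_congr hn

/-- integrability of `Γ(w)ζ(w)` on vertical lines -/
lemma aux_GZ_integrable (c : ℝ) (hc : -1 < c) (hc' : c < 0) :
    Integrable (fun y : ℝ => Gamma (c + y * I) * riemannZeta (c + y * I)) := by
  have h1 := aux_inv_cos_integrable c hc (by linarith)
  have hpi : (0:ℝ) < 2 * Real.pi := by positivity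
  have h2 : (fun y : ℝ => Gamma (c + y * I) * riemannZeta (c + y * I)) =
      fun y : ℝ => ((2 * Real.pi : ℂ) ^ ((c + y * I) - 1 : ℂ) * Real.pi * riemannZeta (1 - (c + y * I))) *
        (Complex.cos (Real.pi * (c + y * I) / 2))⁻¹ := by
    funext y
    rw [aux_GZ _ (by simpa using hc) (by simpa using hc')]
    ring
  rw [h2]
  refine h1.bdd_mul (c := (2 * Real.pi) ^ (c - 1) * Real.pi * ∑' n : ℕ+, ((n : ℕ) : ℝ) ^ (c - 1)) ?_ ?_
  · apply Continuous.aestronglyMeasurable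
    have hz : Continuous fun y : ℝ => riemannZeta (1 - (c + y * I)) := by
      rw [continuous_iff_continuousAt]
      intro y
      have : ContinuousAt riemannZeta (1 - (c + y * I)) := by
        refine (differentiableAt_riemannZeta ?_).continuousAt
        intro h
        have := congrArg Complex.re h
        simp at this
        linarith
      exact ContinuousAt.comp (f := fun y : ℝ => (1 - (c + y * I) : ℂ)) this (by fun_prop)
    have hp : Continuous fun y : ℝ => (2 * Real.pi : ℂ) ^ ((c + y * I) - 1 : ℂ) := by
      refine Continuous.const_cpow (by fun_prop) (Or.inl ?_)
      exact_mod_cast hpi.ne'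
    exact (hp.mul continuous_const).mul hz
  · refine Filter.Eventually.of_forall fun y => ?_
    rw [norm_mul, norm_mul]
    have e : ‖(2 * Real.pi : ℂ) ^ ((c + y * I) - 1 : ℂ)‖ = (2 * Real.pi) ^ (c - 1) := by
      rw [show (2 * Real.pi : ℂ) = ((2 * Real.pi : ℝ) : ℂ) by push_cast; rfl, Complex.norm_cpow_eq_rpow_re_of_pos hpi]
      simp
    rw [e, Complex.norm_real, Real.norm_of_nonneg Real.pi_pos.le]
    gcongr
    exact aux_bound_zeta c y hc'

lemma aux_h_inv (c u : ℝ) (hc : -1 < c) (hc' : c < 1) (hu : 0 < u) :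
    ∫ y : ℝ, (u : ℂ) ^ (-(c + y * I) : ℂ) * (Real.pi / 2 * (Complex.cos (Real.pi * (c + y * I) / 2))⁻¹) =
      2 * Real.pi * ((u / (1 + u ^ 2) : ℝ) : ℂ) := by
  let h : ℝ → ℂ := fun u : ℝ => ((u / (1 + u ^ 2) : ℝ) : ℂ)
  have hm : ∀ y : ℝ, mellin h (c + y * I) = Real.pi / 2 * (Complex.cos (Real.pi * (c + y * I) / 2))⁻¹ :=
    fun y => (aux_mellin2 (c + y * I) (by simpa using hc) (by simpa using hc')).2
  have hcont : Continuous h := by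
    refine Complex.continuous_ofReal.comp ?_
    refine Continuous.div continuous_id (by fun_prop) (fun x => by positivity)
  have := mellinInv_mellin_eq c h hu (aux_mellin2 c (by simpa using hc) (by simpa using hc')).1
    (by
      unfold VerticalIntegrable
      simp only [hm]
      exact (aux_inv_cos_integrable c hc hc').const_mul _) hcont.continuousAt
  rw [mellinInv] at this
  simp only [hm, smul_eq_mul] at this
  change _ = 2 * Real.pi * h u
  rw [← this, Complex.real_smul]
  have hpi : (Real.pi : ℂ) ≠ 0 := by exact_mod_cast Real.pi_ne_zero
  generalize (∫ y : ℝ, (u : ℂ) ^ (-(c + y * I) : ℂ) * (Real.pi / 2 * (Complex.cos (Real.pi * (c + y * I) / 2))⁻¹)) = J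
  push_cast
  field_simp

lemma aux_g_inv (c t : ℝ) (hc : -1 < c) (hc' : c < 0) (ht : 0 < t) :
    ∫ y : ℝ, (t : ℂ) ^ (-(c + y * I) : ℂ) * (Gamma (c + y * I) * riemannZeta (c + y * I)) =
      2 * Real.pi * (1 / (Real.exp t - 1 : ℝ) - 1 / t + 1 / 2 : ℂ) := by
  have hpi : (Real.pi : ℂ) ≠ 0 := by exact_mod_cast Real.pi_ne_zero
  have h2pi : (0:ℝ) < 2 * Real.pi := by positivity
  have hnpos : ∀ n : ℕ+, (0:ℝ) < (n : ℕ) := fun n => by exact_mod_cast n.pos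
  let F : ℕ+ → ℝ → ℂ := fun n y => (1 / (Real.pi * (n : ℕ)) : ℂ) *
    (((t / (2 * Real.pi * (n : ℕ)) : ℝ) : ℂ) ^ (-(c + y * I) : ℂ) *
      (Real.pi / 2 * (Complex.cos (Real.pi * (c + y * I) / 2))⁻¹))
  have hFnorm : ∀ n y, ‖F n y‖ = ((n : ℕ) : ℝ) ^ (c - 1) *
      (t ^ (-c) * (2 * Real.pi) ^ c * 2⁻¹ * ‖(Complex.cos (Real.pi * (c + y * I) / 2))⁻¹‖) := by
    intro n y
    have hn := hnpos n
    simp only [F]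
    rw [norm_mul, norm_mul, norm_mul, Complex.norm_cpow_eq_rpow_re_of_pos (by positivity)]
    rw [show (1 / (Real.pi * (n : ℕ)) : ℂ) = ((1 / (Real.pi * (n : ℕ)) : ℝ) : ℂ) by push_cast; rfl,
      show (Real.pi / 2 : ℂ) = ((Real.pi / 2 : ℝ) : ℂ) by push_cast; rfl, Complex.norm_real, Complex.norm_real,
      Real.norm_of_nonneg (by positivity), Real.norm_of_nonneg (by positivity)]
    have : (-(c + y * I) : ℂ).re = -c := by simp
    rw [this, Real.div_rpow ht.le (by positivity), Real.rpow_neg (x := 2 * Real.pi * (n : ℕ)) (by positivity), div_inv_eq_mul,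
      Real.mul_rpow h2pi.le hn.le, Real.rpow_sub hn, Real.rpow_one]
    field_simp
  have hFint : ∀ n, Integrable (F n) := by
    intro n
    have hn := hnpos n
    have := ((aux_inv_cos_integrable c hc (by linarith)).norm.const_mul (t ^ (-c) * (2 * Real.pi) ^ c * 2⁻¹)).const_mul (((n : ℕ) : ℝ) ^ (c - 1))
    refine this.mono' ?_ (Filter.Eventually.of_forall fun y => (hFnorm n y).le)
    apply Measurable.aestronglyMeasurable
    unfold F
    fun_prop
  have hFsum : Summable fun n => ∫ y, ‖F n y‖ := by
    simp only [hFnorm, integral_const_mul]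
    exact Summable.mul_right _ ((Real.summable_nat_rpow.2 (by linarith)).comp_injective PNat.coe_injective)
  have hs := hasSum_integral_of_summable_integral_norm hFint hFsum
  have hterm : ∀ n, ∫ y, F n y = 2 * Real.pi * ((2 * t / (t ^ 2 + (2 * Real.pi * (n : ℕ)) ^ 2) : ℝ) : ℂ) := by
    intro n
    have hn := hnpos n
    simp only [F]
    rw [integral_const_mul, aux_h_inv c _ hc (by linarith) (by positivity)]
    have : (1 / (Real.pi * (n : ℕ)) : ℝ) * (t / (2 * Real.pi * (n : ℕ)) / (1 + (t / (2 * Real.pi * (n : ℕ))) ^ 2)) =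
        2 * t / (t ^ 2 + (2 * Real.pi * (n : ℕ)) ^ 2) := by
      have hp := Real.pi_pos
      field_simp
      ring
    rw [← this]
    push_cast
    ring
  simp only [hterm] at hs
  rw [← hs.unique ((aux_cot t ht).mul_left _)]
  refine integral_congr_ae (Filter.Eventually.of_forall fun y => ?_)
  simp only
  rw [aux_GZ _ (by simpa using hc) (by simpa using hc')]
  have hz := (aux_zeta_pnat (1 - (c + y * I)) (by simp; linarith)).mul_left
    ((t : ℂ) ^ (-(c + y * I) : ℂ) * ((2 * Real.pi : ℂ) ^ ((c + y * I) - 1 : ℂ) * Real.pi * (Complex.cos (Real.pi * (c + y * I) / 2))⁻¹))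
  rw [← mul_assoc, ← hz.tsum_eq]
  refine tsum_congr fun n => ?_
  have hn := hnpos n
  have hnc : ((n : ℕ) : ℂ) ≠ 0 := by exact_mod_cast hn.ne'
  have hpc : (2 * Real.pi : ℂ) ≠ 0 := by exact_mod_cast h2pi.ne'
  simp only [F]
  have e : ((t / (2 * Real.pi * (n : ℕ)) : ℝ) : ℂ) ^ (-(c + y * I) : ℂ) =
      (t : ℂ) ^ (-(c + y * I) : ℂ) * ((2 * Real.pi : ℂ) ^ (c + y * I : ℂ) * ((n : ℕ) : ℂ) ^ (c + y * I : ℂ)) := by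
    rw [show ((t / (2 * Real.pi * (n : ℕ)) : ℝ) : ℂ) = (t : ℂ) * (((2 * Real.pi * (n : ℕ))⁻¹ : ℝ) : ℂ) by push_cast; ring,
      Complex.mul_cpow_ofReal_nonneg ht.le (by positivity)]
    congr 1
    rw [Complex.ofReal_inv, Complex.inv_cpow _ _ (by rw [Complex.arg_ofReal_of_nonneg (by positivity)]; exact Real.pi_pos.ne),
      Complex.cpow_neg, inv_inv, Complex.ofReal_mul, Complex.mul_cpow_ofReal_nonneg h2pi.le hn.le]
    push_cast
    rfl
  rw [e, neg_sub, Complex.cpow_sub _ _ hpc, Complex.cpow_sub _ _ hnc, Complex.cpow_one, Complex.cpow_one]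
  field_simp

lemma aux_cpow_exp_integrable (s : ℂ) (x : ℝ) (hs : 0 < s.re) (hx : 0 < x) :
    IntegrableOn (fun t : ℝ => (t : ℂ) ^ (s - 1) * cexp (-(x * t))) (Set.Ioi 0) := by
  have := integrableOn_rpow_mul_exp_neg_mul_rpow (p := 1) (s := s.re - 1) (b := x) (by linarith) one_pos hx
  refine Integrable.mono' this ?_ ?_
  · apply Measurable.aestronglyMeasurable
    fun_prop
  · refine (ae_restrict_iff' measurableSet_Ioi).2 (Filter.Eventually.of_forall fun u hu => ?_)
    rw [norm_mul, Complex.norm_cpow_eq_rpow_re_of_pos hu, Complex.norm_exp]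
    simp

lemma aux_cpow_exp_integral (s : ℂ) (x : ℝ) (hs : 0 < s.re) (hx : 0 < x) :
    ∫ t : ℝ in Set.Ioi 0, (t : ℂ) ^ (s - 1) * cexp (-(x * t)) = (x : ℂ) ^ (-s) * Gamma s := by
  rw [Complex.integral_cpow_mul_exp_neg_mul_Ioi hs hx, Complex.cpow_neg, one_div, Complex.inv_cpow _ _ (by
      rw [Complex.arg_ofReal_of_nonneg hx.le]; exact Real.pi_pos.ne)]

lemma aux_fubini (c x : ℝ) (s : ℂ) (hc : -1 < c) (hc' : c < 0) (hs : 1 < s.re) (hx : 0 < x) :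
    Integrable (Function.uncurry fun t y : ℝ => ((t : ℂ) ^ (s - 1) * cexp (-(x * t))) *
      ((t : ℂ) ^ (-(c + y * I) : ℂ) * (Gamma (c + y * I) * riemannZeta (c + y * I))))
      ((volume.restrict (Set.Ioi 0)).prod volume) := by
  have hG := aux_GZ_integrable c hc hc'
  have hm : AEStronglyMeasurable (Function.uncurry fun t y : ℝ => ((t : ℂ) ^ (s - 1) * cexp (-(x * t))) *
      ((t : ℂ) ^ (-(c + y * I) : ℂ) * (Gamma (c + y * I) * riemannZeta (c + y * I))))
      ((volume.restrict (Set.Ioi 0)).prod volume) := by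
    have h1 : AEStronglyMeasurable (fun p : ℝ × ℝ => Gamma (c + p.2 * I) * riemannZeta (c + p.2 * I))
      ((volume.restrict (Set.Ioi 0)).prod volume) := hG.aestronglyMeasurable.comp_snd
    have h2 : Measurable (fun p : ℝ × ℝ => (p.1 : ℂ) ^ (s - 1) * cexp (-(x * p.1))) := by fun_prop
    have h3 : Measurable (fun p : ℝ × ℝ => (p.1 : ℂ) ^ (-(c + p.2 * I) : ℂ)) := by fun_prop
    exact h2.aestronglyMeasurable.mul (h3.aestronglyMeasurable.mul h1)
  have hn : ∀ t ∈ Set.Ioi (0:ℝ), ∀ y : ℝ, ‖((t : ℂ) ^ (s - 1) * cexp (-(x * t))) *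
      ((t : ℂ) ^ (-(c + y * I) : ℂ) * (Gamma (c + y * I) * riemannZeta (c + y * I)))‖ =
      (t ^ (s.re - c - 1) * Real.exp (-x * t ^ (1:ℝ))) * ‖Gamma (c + y * I) * riemannZeta (c + y * I)‖ := by
    intro t ht y
    have ht : 0 < t := ht
    rw [norm_mul, norm_mul, norm_mul ((t : ℂ) ^ (-(c + y * I) : ℂ)), Complex.norm_cpow_eq_rpow_re_of_pos ht,
      Complex.norm_cpow_eq_rpow_re_of_pos ht, Complex.norm_exp]
    have e1 : (-(c + y * I) : ℂ).re = -c := by simp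
    have e2 : (-(x * t) : ℂ).re = -x * t := by simp
    rw [e1, e2, Real.rpow_one, show s.re - c - 1 = (s.re - 1) + (-c) by ring, Real.rpow_add ht]
    simp only [sub_re, one_re]
    ring
  rw [integrable_prod_iff hm]
  constructor
  · refine (ae_restrict_iff' measurableSet_Ioi).2 (Filter.Eventually.of_forall fun t ht => ?_)
    refine (hG.norm.const_mul (t ^ (s.re - c - 1) * Real.exp (-x * t ^ (1:ℝ)))).mono' ?_
      (Filter.Eventually.of_forall fun y => (hn t ht y).le)
    have h3 : Measurable (fun y : ℝ => (t : ℂ) ^ (-(c + y * I) : ℂ)) := by fun_prop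
    exact (h3.aestronglyMeasurable.mul hG.aestronglyMeasurable).const_mul ((t : ℂ) ^ (s - 1) * cexp (-(x * t)))
  · have := (integrableOn_rpow_mul_exp_neg_mul_rpow (p := 1) (s := s.re - c - 1) (b := x) (by linarith) one_pos hx).mul_const
      (∫ y : ℝ, ‖Gamma (c + y * I) * riemannZeta (c + y * I)‖)
    refine IntegrableOn.congr_fun this (fun t ht => ?_) measurableSet_Ioi
    simp only [Function.uncurry]
    simp only [hn t ht]
    rw [integral_const_mul]

lemma aux_inner (c x y : ℝ) (s : ℂ) (hc' : c < 0) (hs : 1 < s.re) (hx : 0 < x) :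
    ∫ t : ℝ in Set.Ioi 0, ((t : ℂ) ^ (s - 1) * cexp (-(x * t))) *
      ((t : ℂ) ^ (-(c + y * I) : ℂ) * (Gamma (c + y * I) * riemannZeta (c + y * I))) =
    (Gamma (c + y * I) * riemannZeta (c + y * I)) * Gamma (s - (c + y * I)) * (x : ℂ) ^ (-(s - (c + y * I))) := by
  have h := aux_cpow_exp_integral (s - (c + y * I)) x (by simp; linarith) hx
  rw [mul_assoc, mul_comm (Gamma (s - (c + y * I))), ← h, ← integral_const_mul]
  refine setIntegral_congr_fun measurableSet_Ioi fun t ht => ?_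
  have ht0 : (t : ℂ) ≠ 0 := by exact_mod_cast (ne_of_gt ht)
  rw [show s - (c + y * I) - 1 = (s - 1) + (-(c + y * I)) by ring, Complex.cpow_add _ _ ht0]
  ring

lemma aux_D_integrable (c : ℝ) (s : ℂ) (hc : -1 < c) (hc' : c < 0) (hs : 1 < s.re) :
    Integrable fun y : ℝ => (Gamma (c + y * I) * riemannZeta (c + y * I)) * Gamma (s - (c + y * I)) := by
  have := (aux_fubini c 1 s hc hc' hs one_pos).integral_prod_right
  refine this.congr (Filter.Eventually.of_forall fun y => ?_)
  have h := aux_inner c 1 y s hc' hs one_pos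
  rw [Complex.ofReal_one, Complex.one_cpow, mul_one] at h
  refine Eq.trans ?_ h
  simp only [Function.uncurry, Complex.ofReal_one]

lemma aux_x (c x : ℝ) (s : ℂ) (hc : -1 < c) (hc' : c < 0) (hs : 1 < s.re) (hx : 0 < x) :
    ∑' k : ℕ+, ((x : ℂ) + (k : ℕ)) ^ (-s) =
      (s - 1)⁻¹ * (x : ℂ) ^ (-(s - 1)) - (1 / 2) * (x : ℂ) ^ (-s) +
      (Gamma s)⁻¹ * ((2 * (Real.pi : ℂ))⁻¹ * ∫ y : ℝ,
        (Gamma (c + y * I) * riemannZeta (c + y * I)) * Gamma (s - (c + y * I)) * (x : ℂ) ^ (-(s - (c + y * I)))) := by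
  have hpi : (Real.pi : ℂ) ≠ 0 := by exact_mod_cast Real.pi_ne_zero
  have hGs : Gamma s ≠ 0 := Complex.Gamma_ne_zero_of_re_pos (by linarith)
  have hs1 : s - 1 ≠ 0 := by
    intro h
    have := congrArg Complex.re h
    simp at this
    linarith
  let F : ℝ → ℂ := fun t => cexp (-(x * t)) * (1 / (Real.exp t - 1 : ℝ) : ℂ)
  have hsum := hasSum_mellin (a := fun _ : ℕ+ => (1:ℂ)) (p := fun k : ℕ+ => x + (k : ℕ)) (F := F) (s := s)
    (fun k => Or.inr (by positivity)) (by linarith) (by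
      intro t ht
      have ht : 0 < t := ht
      have hlt : Real.exp (-t) < 1 := by simpa using ht
      have h1 := (hasSum_geometric_of_lt_one (Real.exp_pos (-t)).le hlt).mul_left (Real.exp (-(x * t)) * Real.exp (-t))
      have h2 : HasSum (fun k : ℕ+ => Real.exp (-(x + (k : ℕ)) * t)) (Real.exp (-(x * t)) * Real.exp (-t) * (1 - Real.exp (-t))⁻¹) := by
        have h3 := Equiv.pnatEquivNat.hasSum_iff.2 h1
        have hfe : (fun k : ℕ+ => Real.exp (-(x + (k : ℕ)) * t)) =
            (fun i : ℕ => Real.exp (-(x * t)) * Real.exp (-t) * Real.exp (-t) ^ i) ∘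
              Equiv.pnatEquivNat := by
          funext k
          simp only [Function.comp, Equiv.pnatEquivNat_apply]
          have hk : ((k : ℕ) : ℝ) = (k.natPred : ℝ) + 1 := by
            exact_mod_cast (PNat.natPred_add_one k).symm
          rw [← Real.exp_nat_mul, ← Real.exp_add, ← Real.exp_add, hk]
          congr 1
          ring
        rw [hfe]
        exact h3
      have h3 : F t = ((Real.exp (-(x * t)) * Real.exp (-t) * (1 - Real.exp (-t))⁻¹ : ℝ) : ℂ) := by
        have h0 : Real.exp t - 1 ≠ 0 := by
          have : 1 < Real.exp t := by simpa using ht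
          linarith
        have : Real.exp (-t) * (1 - Real.exp (-t))⁻¹ = 1 / (Real.exp t - 1) := by
          rw [Real.exp_neg]
          field_simp
        rw [mul_assoc, this]
        simp only [F]
        push_cast
        ring
      rw [h3]
      simpa using (Complex.hasSum_ofReal.2 h2))
    (by
      refine (aux_sum_bound s.re x hs hx).1.congr fun k => ?_
      rw [Real.rpow_neg (by positivity)]
      simp)
  have hsum' : Gamma s * ∑' k : ℕ+, ((x : ℂ) + (k : ℕ)) ^ (-s) = mellin F s := by
    rw [← hsum.tsum_eq, ← tsum_mul_left]
    refine tsum_congr fun k => ?_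
    rw [Complex.cpow_neg]
    push_cast
    ring
  set J := ∫ y : ℝ, (Gamma (c + y * I) * riemannZeta (c + y * I)) * Gamma (s - (c + y * I)) * (x : ℂ) ^ (-(s - (c + y * I))) with hJ
  have hfub := aux_fubini c x s hc hc' hs hx
  have hswap := integral_integral_swap hfub
  simp only [aux_inner c x _ s hc' hs hx] at hswap
  rw [← hJ] at hswap
  have hCint : Integrable (fun t : ℝ => ∫ y : ℝ, ((t : ℂ) ^ (s - 1) * cexp (-(x * t))) *
      ((t : ℂ) ^ (-(c + y * I) : ℂ) * (Gamma (c + y * I) * riemannZeta (c + y * I)))) (volume.restrict (Set.Ioi 0)) := hfub.integral_prod_left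
  have hA := aux_cpow_exp_integrable (s - 1) x (by simpa using hs) hx
  have hB := aux_cpow_exp_integrable s x (by linarith) hx
  have hmel : mellin F s = (x : ℂ) ^ (-(s - 1)) * Gamma (s - 1) - (1 / 2) * ((x : ℂ) ^ (-s) * Gamma s) + (2 * (Real.pi : ℂ))⁻¹ * J := by
    rw [← aux_cpow_exp_integral (s - 1) x (by simpa using hs) hx, ← aux_cpow_exp_integral s x (by linarith) hx, ← hswap,
      ← integral_const_mul, ← integral_const_mul, ← integral_sub hA (hB.const_mul _),
      ← integral_add (show Integrable (fun t : ℝ => (t : ℂ) ^ (s - 1 - 1) * cexp (-(x * t)) - 1 / 2 * ((t : ℂ) ^ (s - 1) * cexp (-(x * t)))) (volume.restrict (Set.Ioi 0)) from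
        hA.sub (hB.const_mul _)) (hCint.const_mul _), mellin]
    refine setIntegral_congr_fun measurableSet_Ioi fun t ht => ?_
    have ht0 : (t : ℂ) ≠ 0 := by exact_mod_cast (ne_of_gt ht)
    simp only [F, smul_eq_mul]
    rw [integral_const_mul, aux_g_inv c t hc hc' ht, Complex.cpow_sub (s - 1) 1 ht0, Complex.cpow_one]
    field_simp
    ring
  have hGs1 : Gamma s = (s - 1) * Gamma (s - 1) := by
    have := Complex.Gamma_add_one (s - 1) hs1
    rwa [sub_add_cancel] at this
  have hGs2 : Gamma (s - 1) = (s - 1)⁻¹ * Gamma s := by rw [hGs1]; field_simp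
  rw [hmel, hGs2] at hsum'
  apply mul_left_cancel₀ hGs
  rw [hsum']
  field_simp

/-- general term of `zeta2` -/
noncomputable def zterm (s₁ s : ℂ) (p : ℕ+ × ℕ+) : ℂ :=
  ((p.1 : ℕ) : ℂ) ^ (-s₁) * ((((p.1 : ℕ) + (p.2 : ℕ)) : ℂ) ^ (-s))

lemma zterm_norm (s₁ s : ℂ) (p : ℕ+ × ℕ+) :
    ‖zterm s₁ s p‖ = ((p.1 : ℕ) : ℝ) ^ (-s₁.re) * (((p.1 : ℕ) : ℝ) + ((p.2 : ℕ) : ℝ)) ^ (-s.re) := by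
  have h2 : ((((p.1 : ℕ) + (p.2 : ℕ)) : ℂ)) = (((p.1 : ℕ) + (p.2 : ℕ) : ℕ) : ℂ) := by push_cast; rfl
  rw [zterm, norm_mul, h2, Complex.norm_natCast_cpow_of_pos p.1.pos,
    Complex.norm_natCast_cpow_of_pos (Nat.add_pos_left p.1.pos _)]
  push_cast
  rfl

lemma zterm_summable_norm (s₁ s : ℂ) (h : 1 < s.re) (h' : 2 < s₁.re + s.re) :
    Summable fun p => ‖zterm s₁ s p‖ := by
  simp only [zterm_norm]
  exact aux_summable2 _ _ h h'

lemma zterm_hasSum (s₁ s : ℂ) (h : 1 < s.re) (h' : 2 < s₁.re + s.re) :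
    HasSum (zterm s₁ s) (zeta2 s₁ s) :=
  (zterm_summable_norm s₁ s h h').of_norm.hasSum

lemma zterm_mul (s₁ s₂ u : ℂ) (p : ℕ+ × ℕ+) :
    zterm s₁ s₂ p * (((((p.1 : ℕ) : ℝ) + ((p.2 : ℕ) : ℝ) : ℝ) : ℂ)) ^ (-u) = zterm s₁ (s₂ + u) p := by
  have h0 : ((((p.1 : ℕ) + (p.2 : ℕ)) : ℂ)) ≠ 0 := by
    have := p.1.pos
    exact_mod_cast (by omega : (p.1 : ℕ) + (p.2 : ℕ) ≠ 0)
  rw [zterm, zterm, neg_add, Complex.cpow_add _ _ h0]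
  push_cast
  ring

lemma aux_main (c : ℝ) (hc : -1 < c) (hc' : c < 0)
    (s₁ s₂ s₃ : ℂ) (h₃ : 1 < s₃.re) (h₂₃ : 2 < s₂.re + s₃.re)
    (h₁₂₃ : 3 < s₁.re + s₂.re + s₃.re) :
    Integrable (fun y : ℝ => (Gamma (c + y * I) * riemannZeta (c + y * I)) * Gamma (s₃ - (c + y * I)) *
      zeta2 s₁ (s₂ + (s₃ - (c + y * I)))) ∧
    zeta3 s₁ s₂ s₃ = (s₃ - 1)⁻¹ * zeta2 s₁ (s₂ + (s₃ - 1)) - (1 / 2) * zeta2 s₁ (s₂ + s₃) +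
      (Gamma s₃)⁻¹ * ((2 * (Real.pi : ℂ))⁻¹ *
        ∫ y : ℝ, (Gamma (c + y * I) * riemannZeta (c + y * I)) * Gamma (s₃ - (c + y * I)) *
          zeta2 s₁ (s₂ + (s₃ - (c + y * I)))) := by
  have hD := aux_D_integrable c s₃ hc hc' h₃
  set D : ℝ → ℂ := fun y : ℝ => (Gamma (c + y * I) * riemannZeta (c + y * I)) * Gamma (s₃ - (c + y * I)) with hDdef
  have hre : ∀ y : ℝ, (s₂ + (s₃ - (c + y * I))).re = s₂.re + s₃.re - c := fun y => by simp; ring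
  have hn : ∀ p (y : ℝ), ‖zterm s₁ (s₂ + (s₃ - (c + y * I))) p‖ = ‖zterm s₁ (s₂ + (s₃ - c)) p‖ := fun p y => by
    rw [zterm_norm, zterm_norm, hre]
    simp
    left
    congr 1
    ring
  have hzs : Summable fun p => ‖zterm s₁ (s₂ + (s₃ - c)) p‖ :=
    zterm_summable_norm _ _ (by simp; linarith) (by simp; linarith)
  have hzsum : ∀ y : ℝ, HasSum (zterm s₁ (s₂ + (s₃ - (c + y * I)))) (zeta2 s₁ (s₂ + (s₃ - (c + y * I)))) := fun y =>
    zterm_hasSum _ _ (by rw [hre]; linarith) (by rw [hre]; linarith)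
  have hcontp : ∀ p, Continuous fun y : ℝ => zterm s₁ (s₂ + (s₃ - (c + y * I))) p := by
    intro p
    have h0 : ((((p.1 : ℕ) + (p.2 : ℕ)) : ℂ)) ≠ 0 := by
      have := p.1.pos
      exact_mod_cast (by omega : (p.1 : ℕ) + (p.2 : ℕ) ≠ 0)
    unfold zterm
    exact continuous_const.mul (Continuous.const_cpow (by fun_prop) (Or.inl h0))
  have hcont : Continuous fun y : ℝ => zeta2 s₁ (s₂ + (s₃ - (c + y * I))) := by
    have := continuous_tsum hcontp hzs (fun p y => (hn p y).le)
    exact this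
  have hInt : Integrable (fun y : ℝ => D y * zeta2 s₁ (s₂ + (s₃ - (c + y * I)))) := by
    refine Integrable.congr (hD.bdd_mul (c := ∑' p, ‖zterm s₁ (s₂ + (s₃ - c)) p‖) hcont.aestronglyMeasurable
      (Filter.Eventually.of_forall fun y => ?_)) (Filter.Eventually.of_forall fun y => mul_comm _ _)
    rw [← (hzsum y).tsum_eq]
    refine (norm_tsum_le_tsum_norm (by simpa only [hn] using hzs)).trans (le_of_eq ?_)
    exact tsum_congr fun p => hn p y
  refine ⟨hInt, ?_⟩
  -- swapping sum and integral
  have hKint : ∀ p, Integrable fun y : ℝ => D y * zterm s₁ (s₂ + (s₃ - (c + y * I))) p := by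
    intro p
    refine Integrable.congr (hD.bdd_mul (c := ‖zterm s₁ (s₂ + (s₃ - c)) p‖) (hcontp p).aestronglyMeasurable
      (Filter.Eventually.of_forall fun y => (hn p y).le)) (Filter.Eventually.of_forall fun y => mul_comm _ _)
  have hKsum : Summable fun p => ∫ y : ℝ, ‖D y * zterm s₁ (s₂ + (s₃ - (c + y * I))) p‖ := by
    simp only [norm_mul, hn, integral_mul_const]
    exact hzs.mul_left _
  have hK := hasSum_integral_of_summable_integral_norm hKint hKsum
  have hKeq : ∀ y : ℝ, ∑' p, D y * zterm s₁ (s₂ + (s₃ - (c + y * I))) p = D y * zeta2 s₁ (s₂ + (s₃ - (c + y * I))) :=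
    fun y => ((hzsum y).mul_left _).tsum_eq
  simp only [hKeq] at hK
  -- the triple sum
  have h3sum : Summable fun q : (ℕ+ × ℕ+) × ℕ+ => zterm s₁ s₂ q.1 *
      ((((((q.1.1 : ℕ) : ℝ) + ((q.1.2 : ℕ) : ℝ) : ℝ) : ℂ)) + ((q.2 : ℕ) : ℂ)) ^ (-s₃) := by
    refine Summable.of_norm ?_
    refine (aux_summable3 s₁.re s₂.re s₃.re h₃ h₂₃ h₁₂₃).congr fun q => ?_
    have e : (((((q.1.1 : ℕ) : ℝ) + ((q.1.2 : ℕ) : ℝ) : ℝ) : ℂ)) + ((q.2 : ℕ) : ℂ) =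
      (((q.1.1 : ℕ) + (q.1.2 : ℕ) + (q.2 : ℕ) : ℕ) : ℂ) := by push_cast; rfl
    rw [norm_mul, zterm_norm, e, Complex.norm_natCast_cpow_of_pos (Nat.add_pos_right _ q.2.pos)]
    push_cast
    rfl
  have h3eq : zeta3 s₁ s₂ s₃ = ∑' p : ℕ+ × ℕ+, zterm s₁ s₂ p *
      ∑' k : ℕ+, ((((((p.1 : ℕ) : ℝ) + ((p.2 : ℕ) : ℝ) : ℝ) : ℂ)) + ((k : ℕ) : ℂ)) ^ (-s₃) := by
    simp only [← tsum_mul_left]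
    rw [← h3sum.tsum_prod, zeta3, ← (Equiv.prodAssoc ℕ+ ℕ+ ℕ+).tsum_eq]
    refine tsum_congr fun q => ?_
    simp only [Equiv.prodAssoc_apply, zterm]
    push_cast
    ring
  rw [h3eq]
  have h1 := (zterm_hasSum s₁ (s₂ + (s₃ - 1)) (by simp; linarith) (by simp; linarith)).mul_left (s₃ - 1)⁻¹
  have h2 := (zterm_hasSum s₁ (s₂ + s₃) (by simp; linarith) (by simp; linarith)).mul_left (1 / 2)
  have htot := (h1.sub h2).add ((hK.mul_left (2 * (Real.pi : ℂ))⁻¹).mul_left (Gamma s₃)⁻¹)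
  rw [← htot.tsum_eq]
  refine tsum_congr fun p => ?_
  have hx : (0:ℝ) < ((p.1 : ℕ) : ℝ) + ((p.2 : ℕ) : ℝ) := by
    have := p.1.pos
    positivity
  rw [aux_x c _ s₃ hc hc' h₃ hx]
  have hI : ∫ y : ℝ, D y * zterm s₁ (s₂ + (s₃ - (c + y * I))) p = zterm s₁ s₂ p * ∫ y : ℝ,
        (Gamma (c + y * I) * riemannZeta (c + y * I)) * Gamma (s₃ - (c + y * I)) *
          (((((p.1 : ℕ) : ℝ) + ((p.2 : ℕ) : ℝ) : ℝ) : ℂ)) ^ (-(s₃ - (c + y * I))) := by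
    rw [← integral_const_mul]
    congr 1
    funext y
    rw [← zterm_mul]
    simp only [hDdef]
    ring
  rw [hI, ← zterm_mul s₁ s₂ (s₃ - 1), ← zterm_mul s₁ s₂ s₃]
  ring


end

/-- The Mellin–Barnes integral formula for the triple zeta-function with `M = 1`: for
`0 < η < 1`, `Re s₃ > 1`, `Re(s₂+s₃) > 2`, `Re(s₁+s₂+s₃) > 3`,
`ζ₃(s₁,s₂,s₃) = ζ₂(s₁,s₂+s₃-1)/(s₃-1) - ζ₂(s₁,s₂+s₃)/2
  + Γ(s₃)⁻¹ (2πi)⁻¹ ∫_{Re z = 1-η} Γ(s₃+z)Γ(-z)ζ₂(s₁,s₂+s₃+z)ζ(-z) dz`,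
the vertical-line integral being parametrized by `z = (1-η) + τ i`, `τ ∈ ℝ` (so that
`(2πi)⁻¹ ∫ … dz = (2π)⁻¹ ∫_ℝ … dτ`), and this integral converging absolutely; every
occurrence of `ζ₂` above is within its domain of absolute convergence. -/
theorem statement8 (η : ℝ) (hη₁ : 0 < η) (hη₂ : η < 1)
    (s₁ s₂ s₃ : ℂ) (h₃ : 1 < s₃.re) (h₂₃ : 2 < (s₂ + s₃).re)
    (h₁₂₃ : 3 < (s₁ + s₂ + s₃).re) :
    Integrable (fun τ : ℝ =>
      Complex.Gamma (s₃ + (1 - (η : ℂ) + (τ : ℂ) * Complex.I)) *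
        Complex.Gamma (-(1 - (η : ℂ) + (τ : ℂ) * Complex.I)) *
        zeta2 s₁ (s₂ + s₃ + (1 - (η : ℂ) + (τ : ℂ) * Complex.I)) *
        riemannZeta (-(1 - (η : ℂ) + (τ : ℂ) * Complex.I))) ∧
    zeta3 s₁ s₂ s₃ =
      (s₃ - 1)⁻¹ * zeta2 s₁ (s₂ + s₃ - 1) - (1 / 2) * zeta2 s₁ (s₂ + s₃) +
        (Complex.Gamma s₃)⁻¹ *
          ((2 * (Real.pi : ℂ))⁻¹ *
            ∫ τ : ℝ,
              Complex.Gamma (s₃ + (1 - (η : ℂ) + (τ : ℂ) * Complex.I)) *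
                Complex.Gamma (-(1 - (η : ℂ) + (τ : ℂ) * Complex.I)) *
                zeta2 s₁ (s₂ + s₃ + (1 - (η : ℂ) + (τ : ℂ) * Complex.I)) *
                riemannZeta (-(1 - (η : ℂ) + (τ : ℂ) * Complex.I))) := by
  simp only [Complex.add_re] at h₂₃ h₁₂₃
  obtain ⟨hi, he⟩ := aux_main (η - 1) (by linarith) (by linarith) s₁ s₂ s₃ h₃ h₂₃ h₁₂₃
  let Φ : ℝ → ℂ := fun y : ℝ => (Complex.Gamma ((η - 1 : ℝ) + y * Complex.I) *
    riemannZeta ((η - 1 : ℝ) + y * Complex.I)) * Complex.Gamma (s₃ - ((η - 1 : ℝ) + y * Complex.I)) *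
      zeta2 s₁ (s₂ + (s₃ - ((η - 1 : ℝ) + y * Complex.I)))
  have hΦ : (fun τ : ℝ =>
      Complex.Gamma (s₃ + (1 - (η : ℂ) + (τ : ℂ) * Complex.I)) *
        Complex.Gamma (-(1 - (η : ℂ) + (τ : ℂ) * Complex.I)) *
        zeta2 s₁ (s₂ + s₃ + (1 - (η : ℂ) + (τ : ℂ) * Complex.I)) *
        riemannZeta (-(1 - (η : ℂ) + (τ : ℂ) * Complex.I))) = fun τ : ℝ => Φ (-τ) := by
    funext τ
    simp only [Φ]
    have e : (((η - 1 : ℝ) : ℂ) + ((-τ : ℝ) : ℂ) * Complex.I) = -(1 - (η : ℂ) + (τ : ℂ) * Complex.I) := by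
      push_cast; ring
    rw [e, sub_neg_eq_add, add_assoc s₂ s₃]
    ring
  rw [hΦ]
  refine ⟨hi.comp_neg, ?_⟩
  rw [integral_neg_eq_self Φ, add_sub_assoc]
  exact he
end

section
/- Let M be a positive integer and 0 < η < 1. Then the integral I(s₁,s₂; M−η) = (1/(2πi)) ∫_{Re z = M−η} Γ(s₂+z) Γ(−z) ζ(s₁+s₂+z) ζ(−z) dz, taken over the vertical line Re z = M−η, converges absolutely and defines an analytic function of (s₁,s₂) on the open region F₂(M,η) = {(s₁,s₂) ∈ ℂ² : Re(s₁+s₂) > 1−M+η and Re s₂ > −M+η}. In particular, for any (m₁,m₂) ∈ ℤ², if M ≥ max{−m₂, 1−m₁−m₂} + 1 then I(s₁,s₂; M−η) is analytic in a neighborhood of (m₁,m₂). -/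
open MeasureTheory

/-- The Mellin–Barnes integrand `Γ(s₂+z)Γ(-z)ζ(s₁+s₂+z)ζ(-z)` on the vertical line
`Re z = c`, parametrized by `z = c + τ i`, `τ ∈ ℝ`. -/
noncomputable def mbIntegrand (s₁ s₂ : ℂ) (c : ℝ) (τ : ℝ) : ℂ :=
  Complex.Gamma (s₂ + ((c : ℂ) + (τ : ℂ) * Complex.I)) *
    Complex.Gamma (-((c : ℂ) + (τ : ℂ) * Complex.I)) *
    riemannZeta (s₁ + s₂ + ((c : ℂ) + (τ : ℂ) * Complex.I)) *
    riemannZeta (-((c : ℂ) + (τ : ℂ) * Complex.I))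

/-- The Mellin–Barnes integral `I(s₁,s₂;c) = (2πi)⁻¹ ∫_{Re z = c} Γ(s₂+z)Γ(-z)ζ(s₁+s₂+z)ζ(-z) dz`,
written via the parametrization `z = c + τ i` (so `(2πi)⁻¹ ∫ … dz = (2π)⁻¹ ∫_ℝ … dτ`). -/
noncomputable def mbIntegral (c : ℝ) (p : ℂ × ℂ) : ℂ :=
  (2 * (Real.pi : ℂ))⁻¹ * ∫ τ : ℝ, mbIntegrand p.1 p.2 c τ


/-- Holomorphic on a right half plane, bounded on vertical strips of finite width. -/
def StripHol (a : ℝ) (f : ℂ → ℂ) : Prop :=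
  DifferentiableOn ℂ f {w : ℂ | a < w.re} ∧
    ∀ x₁ x₂ : ℝ, a < x₁ → ∃ K : ℝ, 0 ≤ K ∧ ∀ w : ℂ, x₁ ≤ w.re → w.re ≤ x₂ → ‖f w‖ ≤ K

lemma isOpen_halfplane (a : ℝ) : IsOpen {w : ℂ | a < w.re} :=
  isOpen_lt continuous_const Complex.continuous_re

lemma StripHol.differentiableAt {a : ℝ} {f : ℂ → ℂ} (hf : StripHol a f) {w : ℂ} (hw : a < w.re) :
    DifferentiableAt ℂ f w :=
  (hf.1 w hw).differentiableAt ((isOpen_halfplane a).mem_nhds hw)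

lemma re_near {w y : ℂ} {r : ℝ} (h : ‖y - w‖ ≤ r) : w.re - r ≤ y.re ∧ y.re ≤ w.re + r := by
  have := (Complex.abs_re_le_norm (y - w)).trans h
  rw [Complex.sub_re, abs_le] at this
  constructor <;> linarith [this.1, this.2]

lemma StripHol.deriv {a : ℝ} {f : ℂ → ℂ} (hf : StripHol a f) : StripHol a (deriv f) := by
  refine ⟨hf.1.deriv (isOpen_halfplane a), fun x₁ x₂ hx => ?_⟩
  set r := (x₁ - a) / 2 with hr
  have hr0 : 0 < r := by rw [hr]; linarith
  obtain ⟨K, hK0, hK⟩ := hf.2 (x₁ - r) (x₂ + r) (by rw [hr]; linarith)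
  refine ⟨K / r, by positivity, fun w h1 h2 => ?_⟩
  refine Complex.norm_deriv_le_of_forall_mem_sphere_norm_le hr0 ?_ ?_
  · refine DifferentiableOn.diffContOnCl (hf.1.mono ?_)
    intro y hy
    have hy' := Metric.closure_ball_subset_closedBall hy
    rw [Metric.mem_closedBall, dist_eq_norm] at hy'
    have := re_near hy'
    simp only [Set.mem_ofPred_eq]
    linarith [this.1]
  · intro y hy
    rw [mem_sphere_iff_norm] at hy
    have := re_near hy.le
    exact hK y (by linarith [this.1]) (by linarith [this.2])

/-- second order Taylor remainder, uniformly on a strip -/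
lemma StripHol.remainder {a : ℝ} {f : ℂ → ℂ} (hf : StripHol a f) {x r : ℝ} (hxr : a < x - r) :
    ∃ K : ℝ, ∀ w h : ℂ, w.re = x → ‖h‖ ≤ r →
      ‖f (w + h) - f w - h * _root_.deriv f w‖ ≤ K * ‖h‖ ^ 2 := by
  obtain ⟨K, hK0, hK⟩ := hf.deriv.deriv.2 (x - r) (x + r) hxr
  refine ⟨K, fun w h hw hh => ?_⟩
  have hin : ∀ y ∈ Metric.closedBall w ‖h‖, x - r ≤ y.re ∧ y.re ≤ x + r := by
    intro y hy
    rw [mem_closedBall_iff_norm] at hy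
    have := re_near (hy.trans hh)
    rwa [hw] at this
  have hwm : w ∈ Metric.closedBall w ‖h‖ := Metric.mem_closedBall_self (norm_nonneg _)
  have h1 : ∀ y ∈ Metric.closedBall w ‖h‖, ‖_root_.deriv f y - _root_.deriv f w‖ ≤ K * ‖h‖ := by
    intro y hy
    have := (convex_closedBall w ‖h‖).norm_image_sub_le_of_norm_deriv_le (f := _root_.deriv f)
      (C := K) (fun u hu => hf.deriv.differentiableAt (by linarith [(hin u hu).1]))
      (fun u hu => hK u (hin u hu).1 (hin u hu).2) hwm hy
    refine this.trans ?_
    rw [mem_closedBall_iff_norm] at hy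
    gcongr
  have hwh : w + h ∈ Metric.closedBall w ‖h‖ := by simp [mem_closedBall_iff_norm]
  have hd : ∀ y ∈ Metric.closedBall w ‖h‖,
      HasDerivAt (fun y => f y - y * _root_.deriv f w) (_root_.deriv f y - 1 * _root_.deriv f w) y := by
    intro y hy
    exact ((hf.differentiableAt (by linarith [(hin y hy).1])).hasDerivAt).sub
      ((hasDerivAt_id y).mul_const _)
  have := (convex_closedBall w ‖h‖).norm_image_sub_le_of_norm_hasDerivWithin_le
    (f := fun y => f y - y * _root_.deriv f w) (C := K * ‖h‖)
    (fun y hy => (hd y hy).hasDerivWithinAt) (fun y hy => by simpa using h1 y hy) hwm hwh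
  calc _ = ‖f (w + h) - (w + h) * _root_.deriv f w - (f w - w * _root_.deriv f w)‖ := by
        congr 1; ring
    _ ≤ K * ‖h‖ * ‖w + h - w‖ := this
    _ = _ := by rw [add_sub_cancel_left]; ring

open BoundedContinuousFunction

lemma StripHol.exists_bcf {a : ℝ} {f : ℂ → ℂ} (hf : StripHol a f) (c : ℝ) (v : ℂ)
    (hv : a < v.re + c) :
    ∃ g : ℝ →ᵇ ℂ, ∀ τ : ℝ, g τ = f (v + ((c : ℂ) + (τ : ℂ) * Complex.I)) := by
  obtain ⟨K, hK0, hK⟩ := hf.2 (v.re + c) (v.re + c) hv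
  refine ⟨BoundedContinuousFunction.ofNormedAddCommGroup
    (fun τ : ℝ => f (v + ((c : ℂ) + (τ : ℂ) * Complex.I))) ?_ K ?_, fun τ => rfl⟩
  · refine hf.1.continuousOn.comp_continuous (by fun_prop) (fun τ => ?_)
    simpa using hv
  · intro τ
    exact hK _ (by simp) (by simp)

lemma StripHol.exists_analytic {a : ℝ} {f : ℂ → ℂ} (hf : StripHol a f) (c : ℝ) :
    ∃ F : ℂ → (ℝ →ᵇ ℂ), AnalyticOnNhd ℂ F {v : ℂ | a - c < v.re} ∧
      ∀ v : ℂ, a - c < v.re → ∀ τ : ℝ, F v τ = f (v + ((c : ℂ) + (τ : ℂ) * Complex.I)) := by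
  have key : ∀ v : ℂ, ∃ g : ℝ →ᵇ ℂ, a - c < v.re →
      ∀ τ : ℝ, g τ = f (v + ((c : ℂ) + (τ : ℂ) * Complex.I)) := by
    intro v
    by_cases hv : a - c < v.re
    · obtain ⟨g, hg⟩ := hf.exists_bcf c v (by linarith)
      exact ⟨g, fun _ => hg⟩
    · exact ⟨0, fun h => absurd h hv⟩
  choose F hF using key
  refine ⟨F, ?_, hF⟩
  refine DifferentiableOn.analyticOnNhd ?_ (isOpen_halfplane _)
  intro v hv
  have hv' : a - c < v.re := hv
  obtain ⟨D, hD⟩ := hf.deriv.exists_bcf c v (by linarith)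
  suffices HasDerivAt F D v from this.differentiableAt.differentiableWithinAt
  rw [hasDerivAt_iff_isLittleO_nhds_zero]
  set r := (v.re + c - a) / 2 with hr
  have hr0 : 0 < r := by rw [hr]; linarith
  obtain ⟨K, hK⟩ := hf.remainder (x := v.re + c) (r := r) (by rw [hr]; linarith)
  have hO : (fun h : ℂ => F (v + h) - F v - h • D) =O[nhds 0] (fun h : ℂ => ‖h‖ ^ 2) := by
    refine Asymptotics.IsBigO.of_bound (max K 0) ?_
    filter_upwards [Metric.ball_mem_nhds (0 : ℂ) hr0] with h hh
    rw [mem_ball_zero_iff] at hh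
    rw [BoundedContinuousFunction.norm_le (by positivity)]
    intro τ
    have hvh : a - c < (v + h).re := by
      have := (re_near (w := v) (y := v + h) (r := r) (by simpa using hh.le)).1
      rw [hr] at this
      linarith
    have h1 := hK (v + ((c : ℂ) + (τ : ℂ) * Complex.I)) h (by simp) hh.le
    have : (F (v + h) - F v - h • D) τ = f (v + ((c : ℂ) + (τ : ℂ) * Complex.I) + h)
        - f (v + ((c : ℂ) + (τ : ℂ) * Complex.I))
        - h * _root_.deriv f (v + ((c : ℂ) + (τ : ℂ) * Complex.I)) := by
      simp only [BoundedContinuousFunction.coe_sub, BoundedContinuousFunction.coe_smul,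
        Pi.sub_apply, smul_eq_mul]
      rw [hF _ hvh, hF _ hv', hD, add_right_comm]
    rw [this, Real.norm_of_nonneg (by positivity)]
    exact h1.trans (by gcongr; exact le_max_left _ _)
  refine hO.trans_isLittleO ?_
  have := Asymptotics.isLittleO_norm_pow_id (E' := ℂ) (n := 2) one_lt_two
  exact this

lemma stripHol_Gamma : StripHol 0 Complex.Gamma := by
  constructor
  · intro w hw
    refine (Complex.differentiableAt_Gamma w ?_).differentiableWithinAt
    rintro m rfl
    have hw' : (0:ℝ) < (-(m : ℂ)).re := hw
    simp only [Complex.neg_re, Complex.natCast_re] at hw'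
    linarith [(Nat.cast_nonneg m : (0:ℝ) ≤ m)]
  · intro x₁ x₂ hx
    have hc : ContinuousOn Real.Gamma (Set.Icc x₁ x₂) := by
      intro x hx'
      refine (Real.differentiableAt_Gamma ?_).continuousAt.continuousWithinAt
      intro m h
      linarith [hx'.1, (Nat.cast_nonneg m : (0:ℝ) ≤ m)]
    obtain ⟨K, hK⟩ := isCompact_Icc.exists_bound_of_continuousOn hc
    refine ⟨max K 0, le_max_right _ _, fun w h1 h2 => ?_⟩
    have hw : 0 < w.re := by linarith
    have : ‖Complex.Gamma w‖ ≤ Real.Gamma w.re := by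
      rw [Complex.Gamma_eq_integral hw, Real.Gamma_eq_integral hw, Complex.GammaIntegral]
      refine (norm_integral_le_integral_norm _).trans (le_of_eq ?_)
      refine setIntegral_congr_fun measurableSet_Ioi fun x hx => ?_
      simp only [norm_mul]
      rw [Complex.norm_cpow_eq_rpow_re_of_pos hx, Complex.norm_real,
        Real.norm_of_nonneg (Real.exp_pos _).le]
      simp
    exact this.trans ((le_abs_self _).trans ((hK _ ⟨h1, h2⟩).trans (le_max_left _ _)))

lemma stripHol_zeta : StripHol 1 riemannZeta := by
  constructor
  · intro w hw
    refine (differentiableAt_riemannZeta ?_).differentiableWithinAt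
    rintro rfl
    simp at hw
  · intro x₁ x₂ hx
    have hs : Summable (fun n : ℕ => 1 / ((n : ℝ) + 1) ^ x₁) := by
      have := (summable_nat_add_iff 1).2 (Real.summable_one_div_nat_rpow.2 hx)
      simpa using this
    refine ⟨∑' n : ℕ, 1 / ((n : ℝ) + 1) ^ x₁, tsum_nonneg fun n => by positivity, fun w h1 _ => ?_⟩
    rw [zeta_eq_tsum_one_div_nat_add_one_cpow (by linarith)]
    refine tsum_of_norm_bounded hs.hasSum fun n => ?_
    have hn : (0 : ℝ) < (n : ℝ) + 1 := by positivity
    have e : ((n : ℂ) + 1) = (((n : ℝ) + 1 : ℝ) : ℂ) := by push_cast; rfl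
    rw [norm_div, norm_one, e, Complex.norm_cpow_eq_rpow_re_of_pos hn]
    gcongr
    linarith [(Nat.cast_nonneg n : (0:ℝ) ≤ n)]

/-- reflected form of `Γ(-z)ζ(-z)` -/
lemma Gamma_neg_mul_zeta_neg {z : ℂ} (hz : 0 < z.re) (hs : Complex.sin (Real.pi * z) ≠ 0) :
    Complex.Gamma (-z) * riemannZeta (-z) =
      (2 * Real.pi : ℂ) ^ (-z) * riemannZeta (1 + z) / (2 * Complex.cos (Real.pi * z / 2)) := by
  have hpi : (Real.pi : ℂ) ≠ 0 := by exact_mod_cast Real.pi_ne_zero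
  have h1 := riemannZeta_one_sub (s := 1 + z) (by
    intro n h
    have := congrArg Complex.re h
    simp at this
    linarith [(Nat.cast_nonneg n : (0:ℝ) ≤ n)]) (by
    intro h
    have := congrArg Complex.re h
    simp at this
    linarith)
  have h2 := Complex.Gamma_mul_Gamma_one_sub (-z)
  have e : (1 : ℂ) - (1 + z) = -z := by ring
  rw [e] at h1
  rw [sub_neg_eq_add, mul_neg, Complex.sin_neg] at h2
  have h3 : Complex.sin (Real.pi * z) =
      2 * Complex.sin (Real.pi * z / 2) * Complex.cos (Real.pi * z / 2) := by
    rw [← Complex.sin_two_mul]; congr 1; ring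
  have h4 : Complex.cos (Real.pi * (1 + z) / 2) = - Complex.sin (Real.pi * z / 2) := by
    rw [← Complex.cos_add_pi_div_two]; congr 1; ring
  have h5 : (2 * Real.pi : ℂ) ^ (-(1 + z)) = (2 * Real.pi : ℂ) ^ (-z) / (2 * Real.pi) := by
    rw [neg_add_rev, ← sub_eq_add_neg, Complex.cpow_sub _ _ (by simp [hpi]), Complex.cpow_one]
  rw [h3] at hs h2
  have hsin : Complex.sin (Real.pi * z / 2) ≠ 0 := by
    intro h; simp [h] at hs
  have hcos : Complex.cos (Real.pi * z / 2) ≠ 0 := by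
    intro h; simp [h] at hs
  rw [h1, h4, h5]
  calc _ = 2 * ((2 * Real.pi : ℂ) ^ (-z) / (2 * Real.pi)) *
        (Complex.Gamma (-z) * Complex.Gamma (1 + z)) *
        (-Complex.sin (Real.pi * z / 2)) * riemannZeta (1 + z) := by ring
    _ = _ := by
      rw [h2]
      field_simp

lemma norm_cos_lower (x y : ℝ) :
    |Real.cos x| * Real.cosh y ≤ ‖Complex.cos ((x : ℂ) + (y : ℂ) * Complex.I)‖ := by
  have : Complex.cos ((x : ℂ) + (y : ℂ) * Complex.I) =
      ((Real.cos x * Real.cosh y : ℝ) : ℂ) + ((-(Real.sin x * Real.sinh y) : ℝ) : ℂ) * Complex.I := by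
    rw [Complex.cos_add_mul_I]; push_cast; ring
  have h2 := Complex.abs_re_le_norm (Complex.cos ((x : ℂ) + (y : ℂ) * Complex.I))
  rw [this] at h2 ⊢
  refine le_trans (le_of_eq ?_) h2
  simp [abs_mul, abs_of_pos (Real.cosh_pos y), -Complex.ofReal_cos, -Complex.ofReal_cosh,
    -Complex.ofReal_sin, -Complex.ofReal_sinh, Complex.cos_ofReal_re, Complex.cosh_ofReal_re]

lemma cosh_lower (y : ℝ) : (1 + y ^ 2) / 4 ≤ Real.cosh y := by
  rw [← Real.cosh_abs, Real.cosh_eq]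
  have h1 := Real.quadratic_le_exp_of_nonneg (abs_nonneg y)
  have h2 := Real.exp_pos (-|y|)
  rw [sq_abs] at h1
  nlinarith [abs_nonneg y]

/-- The kernel `Γ(-z)ζ(-z)` -/
noncomputable def kern (c τ : ℝ) : ℂ :=
  Complex.Gamma (-((c : ℂ) + (τ : ℂ) * Complex.I)) *
    riemannZeta (-((c : ℂ) + (τ : ℂ) * Complex.I))

lemma sin_pi_line_ne_zero {c : ℝ} (hc : ∀ n : ℤ, c ≠ n) (τ : ℝ) :
    Complex.sin (Real.pi * ((c : ℂ) + (τ : ℂ) * Complex.I)) ≠ 0 := by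
  intro h
  rw [Complex.sin_eq_zero_iff] at h
  obtain ⟨k, hk⟩ := h
  have hpi : (Real.pi : ℂ) ≠ 0 := by exact_mod_cast Real.pi_ne_zero
  rw [mul_comm (k : ℂ)] at hk
  have := congrArg Complex.re (mul_left_cancel₀ hpi hk)
  simp at this
  exact hc k this

lemma kern_continuous {c : ℝ} (hc0 : 0 < c) (hc : ∀ n : ℤ, c ≠ n) : Continuous (kern c) := by
  rw [continuous_iff_continuousAt]
  intro τ
  have hz : ContinuousAt (fun τ : ℝ => -((c : ℂ) + (τ : ℂ) * Complex.I)) τ := by fun_prop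
  refine ContinuousAt.mul ?_ ?_
  · refine ContinuousAt.comp (f := fun τ : ℝ => -((c : ℂ) + (τ : ℂ) * Complex.I))
      (Complex.differentiableAt_Gamma _ ?_).continuousAt hz
    intro m h
    have := congrArg Complex.re h
    simp at this
    exact hc m (by exact_mod_cast this)
  · refine ContinuousAt.comp (f := fun τ : ℝ => -((c : ℂ) + (τ : ℂ) * Complex.I))
      (differentiableAt_riemannZeta ?_).continuousAt hz
    intro h
    have := congrArg Complex.re h
    simp at this
    linarith

lemma kern_integrable {c : ℝ} (hc0 : 0 < c) (hc : ∀ n : ℤ, c ≠ n) : Integrable (kern c) := by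
  obtain ⟨K, hK0, hK⟩ := stripHol_zeta.2 (1 + c) (1 + c) (by linarith)
  have hcos : 0 < |Real.cos (Real.pi * c / 2)| := by
    rw [abs_pos]
    intro h
    have h3 : Complex.cos (Real.pi * c / 2) = 0 := by exact_mod_cast congrArg Complex.ofReal h
    apply sin_pi_line_ne_zero hc 0
    have : (Real.pi : ℂ) * ((c : ℂ) + ((0 : ℝ) : ℂ) * Complex.I) = 2 * (Real.pi * c / 2) := by
      push_cast; ring
    rw [this, Complex.sin_two_mul, h3, mul_zero]
  set A := |Real.cos (Real.pi * c / 2)| with hA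
  have hint : Integrable (fun τ : ℝ => (2 * Real.pi) ^ (-c) * K * (2 / A) * (1 + τ ^ 2)⁻¹) :=
    integrable_inv_one_add_sq.const_mul _
  refine hint.mono' (kern_continuous hc0 hc).aestronglyMeasurable (Filter.Eventually.of_forall fun τ => ?_)
  set z : ℂ := (c : ℂ) + (τ : ℂ) * Complex.I with hz
  have hzre : z.re = c := by simp [hz]
  have e1 : kern c τ = _ := Gamma_neg_mul_zeta_neg (z := z) (by rw [hzre]; exact hc0)
    (sin_pi_line_ne_zero hc τ)
  have e2 : (Real.pi : ℂ) * z / 2 =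
      ((Real.pi * c / 2 : ℝ) : ℂ) + ((Real.pi * τ / 2 : ℝ) : ℂ) * Complex.I := by
    rw [hz]; push_cast; ring
  have l1 := norm_cos_lower (Real.pi * c / 2) (Real.pi * τ / 2)
  rw [← e2, ← hA] at l1
  have l2 := cosh_lower (Real.pi * τ / 2)
  have l3 : (1 + τ ^ 2) / 4 ≤ Real.cosh (Real.pi * τ / 2) := by
    refine le_trans ?_ l2
    have : 1 ≤ Real.pi / 2 := by linarith [Real.two_le_pi]
    have : 1 ≤ (Real.pi / 2) ^ 2 := by nlinarith
    nlinarith [sq_nonneg τ]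
  have l4 : A * ((1 + τ ^ 2) / 4) ≤ ‖Complex.cos (Real.pi * z / 2)‖ :=
    le_trans (by gcongr) l1
  have e3 : ‖(2 * Real.pi : ℂ) ^ (-z)‖ = (2 * Real.pi) ^ (-c) := by
    have : (2 * Real.pi : ℂ) = ((2 * Real.pi : ℝ) : ℂ) := by push_cast; rfl
    rw [this, Complex.norm_cpow_eq_rpow_re_of_pos (by positivity), Complex.neg_re, hzre]
  have e4 : ‖riemannZeta (1 + z)‖ ≤ K := hK _ (by simp [hzre]) (by simp [hzre])
  rw [e1, norm_div, norm_mul, norm_mul, e3, Complex.norm_two]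
  calc _ ≤ (2 * Real.pi) ^ (-c) * K / (2 * (A * ((1 + τ ^ 2) / 4))) := by gcongr
    _ = _ := by field_simp; ring

lemma kern_mul_integrable {c : ℝ} (hc0 : 0 < c) (hc : ∀ n : ℤ, c ≠ n) (g : ℝ →ᵇ ℂ) :
    Integrable (fun τ => kern c τ * g τ) :=
  (kern_integrable hc0 hc).mul_bdd (c := ‖g‖) g.continuous.aestronglyMeasurable
    (Filter.Eventually.of_forall g.norm_coe_le_norm)

lemma exists_functional {c : ℝ} (hc0 : 0 < c) (hc : ∀ n : ℤ, c ≠ n) :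
    ∃ L : (ℝ →ᵇ ℂ) →L[ℂ] ℂ, ∀ g, L g = ∫ τ, kern c τ * g τ := by
  let L₀ : (ℝ →ᵇ ℂ) →ₗ[ℂ] ℂ :=
    { toFun := fun g => ∫ τ, kern c τ * g τ
      map_add' := fun f g => by
        rw [← integral_add (kern_mul_integrable hc0 hc f) (kern_mul_integrable hc0 hc g)]
        simp [mul_add]
      map_smul' := fun a f => by
        simp only [RingHom.id_apply, smul_eq_mul]
        rw [← integral_const_mul]
        congr 1; ext τ; simp; ring }
  refine ⟨L₀.mkContinuous (∫ τ, ‖kern c τ‖) fun g => ?_, fun g => rfl⟩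
  change ‖∫ τ, kern c τ * g τ‖ ≤ _
  rw [← integral_mul_const]
  refine norm_integral_le_of_norm_le ((kern_integrable hc0 hc).norm.mul_const _)
    (Filter.Eventually.of_forall fun τ => ?_)
  rw [norm_mul]
  gcongr
  exact g.norm_coe_le_norm τ

/-- For a positive integer `M` and `0 < η < 1`, the Mellin–Barnes integral `I(s₁,s₂;M-η)`
converges absolutely and is analytic on the region
`F₂(M,η) = {(s₁,s₂) : Re(s₁+s₂) > 1-M+η and Re s₂ > -M+η}`; in particular, for
`(m₁,m₂) ∈ ℤ²`, if `M ≥ max{-m₂, 1-m₁-m₂} + 1` then it is analytic in a neighborhood of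
`(m₁,m₂)`. -/
theorem statement9 (M : ℕ) (hM : 1 ≤ M) (η : ℝ) (hη₁ : 0 < η) (hη₂ : η < 1) :
    (∀ p : ℂ × ℂ, p ∈ {p : ℂ × ℂ | 1 - (M : ℝ) + η < (p.1 + p.2).re ∧
        -(M : ℝ) + η < p.2.re} →
      Integrable (fun τ : ℝ => mbIntegrand p.1 p.2 ((M : ℝ) - η) τ)) ∧
    AnalyticOnNhd ℂ (mbIntegral ((M : ℝ) - η))
      {p : ℂ × ℂ | 1 - (M : ℝ) + η < (p.1 + p.2).re ∧ -(M : ℝ) + η < p.2.re} ∧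
    ∀ m₁ m₂ : ℤ, max (-m₂) (1 - m₁ - m₂) + 1 ≤ (M : ℤ) →
      AnalyticAt ℂ (mbIntegral ((M : ℝ) - η)) ((m₁ : ℂ), (m₂ : ℂ)) := by
  set c : ℝ := (M : ℝ) - η with hcdef
  have hM' : (1 : ℝ) ≤ M := by exact_mod_cast hM
  have hc0 : 0 < c := by rw [hcdef]; linarith
  have hc : ∀ n : ℤ, c ≠ n := by
    intro n h
    have h1 : (n : ℝ) < (M : ℤ) := by push_cast; linarith
    have h2 : ((M : ℤ) : ℝ) - 1 < n := by push_cast; linarith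
    have h1' : n < (M : ℤ) := by exact_mod_cast h1
    have h2' : (M : ℤ) - 1 < n := by exact_mod_cast h2
    omega
  obtain ⟨F, hFa, hF⟩ := stripHol_Gamma.exists_analytic c
  obtain ⟨Z, hZa, hZ⟩ := stripHol_zeta.exists_analytic c
  obtain ⟨L, hL⟩ := exists_functional hc0 hc
  have heq : ∀ p : ℂ × ℂ, 1 - (M : ℝ) + η < (p.1 + p.2).re → -(M : ℝ) + η < p.2.re →
      (fun τ : ℝ => mbIntegrand p.1 p.2 c τ) =
        fun τ => kern c τ * (F p.2 * Z (p.1 + p.2)) τ := by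
    intro p h1 h2
    ext τ
    rw [BoundedContinuousFunction.coe_mul, Pi.mul_apply, hF _ (by rw [hcdef]; linarith),
      hZ _ (by rw [hcdef]; linarith), mbIntegrand, kern]
    ring
  have hopen : IsOpen {p : ℂ × ℂ | 1 - (M : ℝ) + η < (p.1 + p.2).re ∧ -(M : ℝ) + η < p.2.re} :=
    IsOpen.inter (s := {p : ℂ × ℂ | 1 - (M : ℝ) + η < (p.1 + p.2).re})
      (t := {p : ℂ × ℂ | -(M : ℝ) + η < p.2.re})
      (isOpen_lt continuous_const
        (Complex.continuous_re.comp (continuous_fst.add continuous_snd)))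
      (isOpen_lt continuous_const (Complex.continuous_re.comp continuous_snd))
  have hana : AnalyticOnNhd ℂ (mbIntegral c)
      {p : ℂ × ℂ | 1 - (M : ℝ) + η < (p.1 + p.2).re ∧ -(M : ℝ) + η < p.2.re} := by
    intro p hp
    have a1 : AnalyticAt ℂ (fun p : ℂ × ℂ => F p.2) p :=
      AnalyticAt.comp (g := F) (f := fun p : ℂ × ℂ => p.2)
        (hFa p.2 (by simp only [Set.mem_ofPred_eq]; rw [hcdef]; linarith [hp.2])) analyticAt_snd
    have a2 : AnalyticAt ℂ (fun p : ℂ × ℂ => Z (p.1 + p.2)) p :=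
      AnalyticAt.comp (g := Z) (f := fun p : ℂ × ℂ => p.1 + p.2)
        (hZa (p.1 + p.2) (by simp only [Set.mem_ofPred_eq]; rw [hcdef]; linarith [hp.1]))
        (analyticAt_fst.add analyticAt_snd)
    have a3 : AnalyticAt ℂ (fun p : ℂ × ℂ => L (F p.2 * Z (p.1 + p.2))) p :=
      AnalyticAt.comp (g := L) (f := fun p : ℂ × ℂ => F p.2 * Z (p.1 + p.2))
        (L.analyticAt _) (a1.mul a2)
    have a4 : AnalyticAt ℂ
        (fun p : ℂ × ℂ => (2 * (Real.pi : ℂ))⁻¹ * L (F p.2 * Z (p.1 + p.2))) p :=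
      analyticAt_const.mul a3
    refine a4.congr ?_
    filter_upwards [hopen.mem_nhds hp] with q hq
    rw [mbIntegral, heq q hq.1 hq.2, hL]
  refine ⟨fun p hp => ?_, hana, fun m₁ m₂ hm => hana _ ?_⟩
  · rw [heq p hp.1 hp.2]
    exact kern_mul_integrable hc0 hc _
  · have h1 : -m₂ + 1 ≤ (M : ℤ) := le_trans (by gcongr; exact le_max_left _ _) hm
    have h2 : 1 - m₁ - m₂ + 1 ≤ (M : ℤ) := le_trans (by gcongr; exact le_max_right _ _) hm
    have h1' : -(m₂ : ℝ) + 1 ≤ M := by exact_mod_cast h1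
    have h2' : 1 - (m₁ : ℝ) - m₂ + 1 ≤ M := by exact_mod_cast h2
    simp only [Set.mem_ofPred_eq, Complex.add_re, Complex.intCast_re]
    constructor <;> linarith
end

section
/- There exists a function h₁(s₁,s₂), analytic on the open region {(s₁,s₂) ∈ ℂ² : Re s₁ > 1/2 and Re s₂ > 1/2}, such that for every (s₁,s₂) in this region satisfying Re s₂ > 1 and Re(s₁+s₂) > 2 one has ζ₂(s₁,s₂) = (1/(s₂−1)) ζ(s₁+s₂−1) + h₁(s₁,s₂). -/
open Filter Topology Set

namespace Z2

/-- The summand correction. -/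
noncomputable def phi (n : ℕ) (s : ℂ) : ℂ :=
  ((n : ℂ) + 1) ^ (-s) - ∫ x in (n : ℝ)..(n + 1 : ℝ), (x : ℂ) ^ (-s)

lemma integral_eq (n : ℕ) (hn : 0 < n) (s : ℂ) (hs : s ≠ 1) :
    ∫ x in (n : ℝ)..(n + 1 : ℝ), (x : ℂ) ^ (-s)
      = (s - 1)⁻¹ * ((n : ℂ) ^ (1 - s) - ((n : ℂ) + 1) ^ (1 - s)) := by
  have hn' : (0 : ℝ) < n := by exact_mod_cast hn
  rw [integral_cpow]
  · have h1 : s - 1 ≠ 0 := sub_ne_zero.mpr hs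
    have h2 : -s + 1 ≠ 0 := by
      intro h; apply h1; linear_combination -h
    have h3 : -s + 1 = 1 - s := by ring
    push_cast
    rw [h3] at h2 ⊢
    field_simp
    ring
  · right
    refine ⟨fun h => hs (neg_injective h), ?_⟩
    rw [uIcc_of_le (by linarith)]
    intro h
    linarith [h.1]

lemma integral_one (n : ℕ) (hn : 0 < n) :
    ∫ x in (n : ℝ)..(n + 1 : ℝ), (x : ℂ) ^ (-(1 : ℂ))
      = Complex.log ((n : ℂ) + 1) - Complex.log n := by
  have hn' : (0 : ℝ) < n := by exact_mod_cast hn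
  have h : ∀ x : ℝ, (x : ℂ) ^ (-(1 : ℂ)) = ((x⁻¹ : ℝ) : ℂ) := by
    intro x; rw [Complex.cpow_neg_one]; push_cast; rfl
  simp_rw [h]
  rw [intervalIntegral.integral_ofReal, integral_inv_of_pos hn' (by linarith),
    Real.log_div (by linarith) (by linarith)]
  push_cast [Complex.ofReal_log hn'.le, Complex.ofReal_log (by linarith : (0 : ℝ) ≤ n + 1)]
  rfl

lemma phi_differentiable (n : ℕ) (hn : 0 < n) : Differentiable ℂ (phi n) := by
  have h0 : (n : ℂ) ≠ 0 := by exact_mod_cast hn.ne'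
  have h1 : (n : ℂ) + 1 ≠ 0 := by exact_mod_cast (Nat.succ_ne_zero n)
  set G : ℂ → ℂ := fun s => (n : ℂ) ^ (1 - s) - ((n : ℂ) + 1) ^ (1 - s) with hG
  have hd : ∀ s, HasDerivAt G ((n : ℂ) ^ (1 - s) * Complex.log n * (-1)
      - ((n : ℂ) + 1) ^ (1 - s) * Complex.log ((n : ℂ) + 1) * (-1)) s := by
    intro s
    exact (((hasDerivAt_id s).const_sub 1).const_cpow (Or.inl h0)).sub
      (((hasDerivAt_id s).const_sub 1).const_cpow (Or.inl h1))
  have hD : Differentiable ℂ (dslope G 1) := by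
    rw [← differentiableOn_univ, Complex.differentiableOn_dslope univ_mem]
    exact fun s _ => (hd s).differentiableAt.differentiableWithinAt
  have heq : phi n = fun s => ((n : ℂ) + 1) ^ (-s) - dslope G 1 s := by
    funext s
    unfold phi
    congr 1
    by_cases hs : s = 1
    · subst hs
      rw [integral_one n hn, dslope_same, (hd 1).deriv]
      simp
      ring
    · rw [integral_eq n hn s hs, dslope_of_ne _ hs, slope_def_field]
      simp [hG]
      ring
  rw [heq]
  refine Differentiable.sub ?_ hD
  exact fun s => (((hasDerivAt_id s).neg).const_cpow (Or.inl h1)).differentiableAt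

lemma phi_bound (n : ℕ) (hn : 0 < n) (s : ℂ) (hs : 0 < s.re) :
    ‖phi n s‖ ≤ ‖s‖ * (n : ℝ) ^ (-(s.re + 1)) := by
  have hn' : (0 : ℝ) < n := by exact_mod_cast hn
  have hs0 : s ≠ 0 := by rintro rfl; simp at hs
  have hint : IntervalIntegrable (fun x : ℝ => (x : ℂ) ^ (-s)) MeasureTheory.volume
      (n : ℝ) (n + 1 : ℝ) := by
    apply intervalIntegral.intervalIntegrable_cpow
    right
    rw [uIcc_of_le (by linarith)]
    intro h
    linarith [h.1]
  have h1 : phi n s = ∫ x in (n : ℝ)..(n + 1 : ℝ), (((n : ℂ) + 1) ^ (-s) - (x : ℂ) ^ (-s)) := by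
    rw [intervalIntegral.integral_sub (by simp) hint]
    simp [phi]
  rw [h1]
  have h2 := intervalIntegral.norm_integral_le_of_norm_le_const (a := (n : ℝ)) (b := (n + 1 : ℝ))
    (f := fun x : ℝ => ((n : ℂ) + 1) ^ (-s) - (x : ℂ) ^ (-s))
    (C := ‖s‖ * (n : ℝ) ^ (-(s.re + 1))) ?_
  · simpa using h2
  intro x hx
  rw [uIoc_of_le (by linarith)] at hx
  have hx0 : 0 < x := hn'.trans hx.1
  have hder : ∀ y ∈ Icc x (n + 1 : ℝ), HasDerivWithinAt (fun y : ℝ => (y : ℂ) ^ (-s))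
      (-s * (y : ℂ) ^ (-s - 1)) (Icc x (n + 1 : ℝ)) y := by
    intro y hy
    exact (hasDerivAt_ofReal_cpow_const (by linarith [hy.1]) (neg_ne_zero.mpr hs0)).hasDerivWithinAt
  have h3 := norm_image_sub_le_of_norm_deriv_le_segment' (C := ‖s‖ * (n : ℝ) ^ (-(s.re + 1)))
    hder ?_ (n + 1 : ℝ) (right_mem_Icc.mpr hx.2)
  · push_cast at h3
    refine h3.trans ?_
    have : (0 : ℝ) ≤ ‖s‖ * (n : ℝ) ^ (-(s.re + 1)) := by positivity
    nlinarith [hx.1]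
  · intro y hy
    have hy0 : 0 < y := hx0.trans_le hy.1
    rw [norm_mul, norm_neg, Complex.norm_cpow_eq_rpow_re_of_pos hy0]
    gcongr
    have e : (-s - 1).re = -(s.re + 1) := by simp; ring
    rw [e]
    exact Real.rpow_le_rpow_of_nonpos hn' (by linarith [hy.1, hx.1]) (by linarith)

lemma summable_pair (α β : ℝ) (hβ : 1 < β) (hαβ : 2 < α + β) :
    Summable (fun p : ℕ × ℕ => ((p.1 + 1 : ℕ) : ℝ) ^ (-α) * ((p.1 + p.2 + 1 : ℕ) : ℝ) ^ (-β)) := by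
  obtain ⟨ε, h0, h1, h2⟩ : ∃ ε : ℝ, 0 < ε ∧ ε ≤ β - 1 ∧ ε < α + β - 2 := by
    refine ⟨min (β - 1) ((α + β - 2) / 2), lt_min (by linarith) (by linarith), min_le_left _ _, ?_⟩
    exact (min_le_right _ _).trans_lt (by linarith)
  have hs : ∀ c : ℝ, 1 < c → Summable (fun i : ℕ => ((i + 1 : ℕ) : ℝ) ^ (-c)) := fun c hc =>
    (summable_nat_add_iff 1).mpr (Real.summable_nat_rpow.mpr (by linarith : -c < -1))
  have hprod := (hs (α + (β - 1 - ε)) (by linarith)).mul_of_nonneg (hs (1 + ε) (by linarith))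
    (fun i => by positivity) (fun i => by positivity)
  refine hprod.of_nonneg_of_le (fun p => by positivity) ?_
  rintro ⟨i, j⟩
  have hi : (0 : ℝ) < ((i + 1 : ℕ) : ℝ) := by positivity
  have hj : (0 : ℝ) < ((j + 1 : ℕ) : ℝ) := by positivity
  have hij : (0 : ℝ) < ((i + j + 1 : ℕ) : ℝ) := by positivity
  show ((i + 1 : ℕ) : ℝ) ^ (-α) * ((i + j + 1 : ℕ) : ℝ) ^ (-β)
    ≤ ((i + 1 : ℕ) : ℝ) ^ (-(α + (β - 1 - ε))) * ((j + 1 : ℕ) : ℝ) ^ (-(1 + ε))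
  have e1 : -(α + (β - 1 - ε)) = -α + -(β - 1 - ε) := by ring
  have e2 : -β = -(β - 1 - ε) + -(1 + ε) := by ring
  rw [e1, Real.rpow_add hi, mul_assoc]
  gcongr
  rw [e2, Real.rpow_add hij]
  gcongr ?_ * ?_
  · exact Real.rpow_le_rpow_of_nonpos hi (by push_cast; linarith [(Nat.cast_nonneg j : (0:ℝ) ≤ j)]) (by linarith)
  · exact Real.rpow_le_rpow_of_nonpos hj (by push_cast; linarith [(Nat.cast_nonneg i : (0:ℝ) ≤ i)]) (by linarith)

open BoundedContinuousFunction in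
lemma exists_A : ∃ A : ℂ → (ℕ →ᵇ ℂ), (∀ s : ℂ, 0 < s.re → ∀ i : ℕ, A s i = ((i + 1 : ℕ) : ℂ) ^ (-s)) ∧
    DifferentiableOn ℂ A {s | 0 < s.re} := by
  have hn : ∀ (s : ℂ) (i : ℕ), ‖((i + 1 : ℕ) : ℂ) ^ (-s)‖ = ((i + 1 : ℕ) : ℝ) ^ (-s.re) := by
    intro s i
    rw [Complex.norm_natCast_cpow_of_pos (Nat.succ_pos i), Complex.neg_re]
  have hb : ∀ s : ℂ, 0 < s.re → ∀ i : ℕ, ‖((i + 1 : ℕ) : ℂ) ^ (-s)‖ ≤ 1 := by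
    intro s hs i
    rw [hn]
    exact Real.rpow_le_one_of_one_le_of_nonpos (by push_cast; linarith [(Nat.cast_nonneg i : (0:ℝ) ≤ i)]) (by linarith)
  classical
  let A : ℂ → (ℕ →ᵇ ℂ) := fun s =>
    if h : 0 < s.re then ofNormedAddCommGroupDiscrete (fun i : ℕ => ((i + 1 : ℕ) : ℂ) ^ (-s)) 1 (hb s h) else 0
  have hA : ∀ s : ℂ, 0 < s.re → ∀ i : ℕ, A s i = ((i + 1 : ℕ) : ℂ) ^ (-s) := by
    intro s hs i
    simp only [A, dif_pos hs]
    rfl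
  refine ⟨A, hA, ?_⟩
  let δ : ℕ → (ℕ →ᵇ ℂ) := fun k => ofNormedAddCommGroupDiscrete (fun i : ℕ => if i = k then (1 : ℂ) else 0) 1
    (by intro i; split_ifs <;> simp)
  have hδ : ∀ k i, δ k i = if i = k then (1 : ℂ) else 0 := fun k i => rfl
  let F : ℕ → ℂ → (ℕ →ᵇ ℂ) := fun N s => ∑ k ∈ Finset.range N, (((k + 1 : ℕ) : ℂ) ^ (-s)) • δ k
  have hF : ∀ N s i, F N s i = if i < N then ((i + 1 : ℕ) : ℂ) ^ (-s) else 0 := by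
    intro N s i
    have : F N s i = ∑ k ∈ Finset.range N, (((k + 1 : ℕ) : ℂ) ^ (-s)) * δ k i := by
      have := map_sum (BoundedContinuousFunction.evalCLM ℂ i : (ℕ →ᵇ ℂ) →L[ℂ] ℂ)
        (fun k => (((k + 1 : ℕ) : ℂ) ^ (-s)) • δ k) (Finset.range N)
      exact this
    rw [this]
    simp [hδ]
  have hFd : ∀ N, Differentiable ℂ (F N) := by
    intro N
    refine Differentiable.fun_sum fun k _ => Differentiable.smul_const ?_ _
    exact fun s => (((hasDerivAt_id s).neg).const_cpow
      (Or.inl (by exact_mod_cast Nat.succ_ne_zero k))).differentiableAt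
  intro s hs
  have hs' : 0 < s.re := hs
  have hopen : IsOpen {z : ℂ | s.re / 2 < z.re} := isOpen_lt continuous_const Complex.continuous_re
  have hU : TendstoUniformlyOn F A atTop {z : ℂ | s.re / 2 < z.re} := by
    rw [Metric.tendstoUniformlyOn_iff]
    intro ε hε
    have ht : Tendsto (fun N : ℕ => ((N + 1 : ℕ) : ℝ) ^ (-(s.re / 2))) atTop (𝓝 0) :=
      (tendsto_rpow_neg_atTop (by linarith : 0 < s.re / 2)).comp
        (tendsto_natCast_atTop_atTop.comp (tendsto_add_atTop_nat 1))
    filter_upwards [ht.eventually (gt_mem_nhds hε)] with N hN z hz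
    have hz' : s.re / 2 < z.re := hz
    refine lt_of_le_of_lt ?_ hN
    rw [BoundedContinuousFunction.dist_le (by positivity)]
    intro i
    rw [hA z (by linarith), hF, dist_eq_norm]
    split_ifs with h
    · rw [sub_self, norm_zero]; positivity
    · rw [sub_zero, hn]
      push Not at h
      have h1 : ((N + 1 : ℕ) : ℝ) ≤ ((i + 1 : ℕ) : ℝ) := by exact_mod_cast Nat.succ_le_succ h
      calc ((i + 1 : ℕ) : ℝ) ^ (-z.re) ≤ ((i + 1 : ℕ) : ℝ) ^ (-(s.re / 2)) :=
            Real.rpow_le_rpow_of_exponent_le (by push_cast; linarith [(Nat.cast_nonneg i : (0:ℝ) ≤ i)]) (by linarith)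
        _ ≤ _ := Real.rpow_le_rpow_of_nonpos (by positivity) h1 (by linarith)
  have := hU.tendstoLocallyUniformlyOn.differentiableOn
    (Eventually.of_forall fun N => (hFd N).differentiableOn) hopen
  exact (this.differentiableAt (hopen.mem_nhds (by show s.re / 2 < s.re; linarith))).differentiableWithinAt

/-- The correction term. -/
noncomputable def f (p : ℕ × ℕ) (s₁ s₂ : ℂ) : ℂ := ((p.1 + 1 : ℕ) : ℂ) ^ (-s₁) * phi (p.1 + p.2 + 1) s₂

/-- The analytic remainder. -/
noncomputable def h (q : ℂ × ℂ) : ℂ := ∑' p : ℕ × ℕ, f p q.1 q.2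

lemma f_summable (s₁ s₂ : ℂ) (h1 : 1 / 2 < s₁.re) (h2 : 1 / 2 < s₂.re) :
    Summable (fun p => f p s₁ s₂) := by
  have := (summable_pair s₁.re (s₂.re + 1) (by linarith) (by linarith)).mul_left ‖s₂‖
  refine Summable.of_norm_bounded this ?_
  intro p
  unfold f
  rw [norm_mul, Complex.norm_natCast_cpow_of_pos (Nat.succ_pos _), Complex.neg_re]
  have := phi_bound (p.1 + p.2 + 1) (Nat.succ_pos _) s₂ (by linarith)
  calc _ ≤ ((p.1 + 1 : ℕ) : ℝ) ^ (-s₁.re) * (‖s₂‖ * ((p.1 + p.2 + 1 : ℕ) : ℝ) ^ (-(s₂.re + 1))) := by gcongr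
    _ = _ := by ring

open BoundedContinuousFunction in
lemma h_analytic : AnalyticOnNhd ℂ h {p : ℂ × ℂ | 1 / 2 < p.1.re ∧ 1 / 2 < p.2.re} := by
  rintro ⟨p₁, p₂⟩ ⟨hp1, hp2⟩
  simp only at hp1 hp2
  obtain ⟨a, ha, ha1, ha2⟩ : ∃ a : ℝ, 1 / 2 < a ∧ a < p₁.re ∧ a < p₂.re := by
    obtain ⟨a, h1, h2⟩ := exists_between (lt_min hp1 hp2)
    exact ⟨a, h1, h2.trans_le (min_le_left _ _), h2.trans_le (min_le_right _ _)⟩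
  obtain ⟨A, hA, hAd⟩ := exists_A
  let c : ℕ × ℕ → ℂ → ℂ := fun p s => ((p.1 + 1 : ℕ) : ℂ) ^ (-(a : ℂ)) * phi (p.1 + p.2 + 1) s
  let T : ℕ × ℕ → ℂ → ((ℕ →ᵇ ℂ) →L[ℂ] ℂ) := fun p s => c p s • BoundedContinuousFunction.evalCLM ℂ p.1
  let U : Set ℂ := {s | a < s.re} ∩ Metric.ball 0 (‖p₂‖ + 1)
  have hU : IsOpen U := (isOpen_lt continuous_const Complex.continuous_re).inter Metric.isOpen_ball
  have hpU : p₂ ∈ U := ⟨ha2, by simp⟩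
  let u : ℕ × ℕ → ℝ := fun p => (‖p₂‖ + 1) * (((p.1 + 1 : ℕ) : ℝ) ^ (-a) * ((p.1 + p.2 + 1 : ℕ) : ℝ) ^ (-(a + 1)))
  have hu : Summable u := (summable_pair a (a + 1) (by linarith) (by linarith)).mul_left _
  have hTle : ∀ p s, s ∈ U → ‖T p s‖ ≤ u p := by
    intro p s hs
    have hs1 : a < s.re := hs.1
    have hs2 : ‖s‖ < ‖p₂‖ + 1 := by simpa using hs.2
    have hev : ‖(BoundedContinuousFunction.evalCLM ℂ p.1 : (ℕ →ᵇ ℂ) →L[ℂ] ℂ)‖ ≤ 1 :=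
      ContinuousLinearMap.opNorm_le_bound _ zero_le_one fun g => by
        rw [one_mul]; exact g.norm_coe_le_norm p.1
    have hphi := phi_bound (p.1 + p.2 + 1) (Nat.succ_pos _) s (by linarith)
    have hmono : ((p.1 + p.2 + 1 : ℕ) : ℝ) ^ (-(s.re + 1)) ≤ ((p.1 + p.2 + 1 : ℕ) : ℝ) ^ (-(a + 1)) :=
      Real.rpow_le_rpow_of_exponent_le (by exact_mod_cast Nat.succ_pos _) (by linarith)
    calc ‖T p s‖ = ‖c p s‖ * ‖(BoundedContinuousFunction.evalCLM ℂ p.1 : (ℕ →ᵇ ℂ) →L[ℂ] ℂ)‖ := norm_smul _ _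
      _ ≤ ‖c p s‖ * 1 := by gcongr
      _ = ((p.1 + 1 : ℕ) : ℝ) ^ (-a) * ‖phi (p.1 + p.2 + 1) s‖ := by
        simp only [c]
        rw [mul_one, norm_mul, Complex.norm_natCast_cpow_of_pos (Nat.succ_pos _), Complex.neg_re,
          Complex.ofReal_re]
      _ ≤ ((p.1 + 1 : ℕ) : ℝ) ^ (-a) * ((‖p₂‖ + 1) * ((p.1 + p.2 + 1 : ℕ) : ℝ) ^ (-(a + 1))) := by
        gcongr
        refine hphi.trans ?_
        gcongr
      _ = u p := by simp only [u]; ring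
  have hTd : ∀ p, DifferentiableOn ℂ (T p) U := by
    intro p
    have hc : Differentiable ℂ (c p) :=
      (phi_differentiable (p.1 + p.2 + 1) (Nat.succ_pos _)).const_mul _
    exact (hc.smul_const
      (BoundedContinuousFunction.evalCLM ℂ p.1 : (ℕ →ᵇ ℂ) →L[ℂ] ℂ)).differentiableOn
  let L : ℂ → ((ℕ →ᵇ ℂ) →L[ℂ] ℂ) := fun s => ∑' p, T p s
  have hL : DifferentiableOn ℂ L U := Complex.differentiableOn_tsum_of_summable_norm (F := T) hu hTd hU hTle
  have hLa : AnalyticAt ℂ L p₂ := hL.analyticAt (hU.mem_nhds hpU)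
  have hAa : AnalyticAt ℂ A (p₁ - a) :=
    hAd.analyticAt ((isOpen_lt continuous_const Complex.continuous_re).mem_nhds (by
      show 0 < (p₁ - a : ℂ).re
      simp; linarith))
  have hL2 : AnalyticAt ℂ (fun q : ℂ × ℂ => L q.2) (p₁, p₂) :=
    AnalyticAt.fun_comp (g := L) (f := fun q : ℂ × ℂ => q.2) hLa analyticAt_snd
  have hA2 : AnalyticAt ℂ (fun q : ℂ × ℂ => A (q.1 - a)) (p₁, p₂) :=
    AnalyticAt.fun_comp (g := A) (f := fun q : ℂ × ℂ => q.1 - a) hAa (analyticAt_fst.sub analyticAt_const)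
  have hbil : ∀ y, AnalyticAt ℂ (fun x : ((ℕ →ᵇ ℂ) →L[ℂ] ℂ) × (ℕ →ᵇ ℂ) => x.1 x.2) y := fun y =>
    ContinuousLinearMap.analyticAt_bilinear (ContinuousLinearMap.id ℂ ((ℕ →ᵇ ℂ) →L[ℂ] ℂ)) y
  have hfin : AnalyticAt ℂ (fun q : ℂ × ℂ => L q.2 (A (q.1 - a))) (p₁, p₂) :=
    AnalyticAt.comp₂ (h := fun x : ((ℕ →ᵇ ℂ) →L[ℂ] ℂ) × (ℕ →ᵇ ℂ) => x.1 x.2)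
      (hbil _) hL2 hA2
  refine hfin.congr ?_
  have hV : IsOpen {q : ℂ × ℂ | a < q.1.re ∧ q.2 ∈ U} :=
    (isOpen_lt continuous_const (Complex.continuous_re.comp continuous_fst)).inter
      (hU.preimage continuous_snd)
  filter_upwards [hV.mem_nhds ⟨ha1, hpU⟩] with q hq
  obtain ⟨hq1, hq2⟩ := hq
  have hsum : Summable (fun p => T p q.2) := Summable.of_norm_bounded hu (fun p => hTle p _ hq2)
  have := (ContinuousLinearMap.apply ℂ ℂ (A (q.1 - a))).map_tsum hsum
  refine Eq.trans this ?_
  unfold h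
  refine tsum_congr fun p => ?_
  show c p q.2 • (A (q.1 - a) p.1) = f p q.1 q.2
  rw [hA _ (by simp; linarith)]
  simp only [c, f, smul_eq_mul]
  have hne : ((p.1 + 1 : ℕ) : ℂ) ≠ 0 := by exact_mod_cast Nat.succ_ne_zero p.1
  have e : -q.1 = -(a : ℂ) + -(q.1 - a) := by ring
  rw [e, Complex.cpow_add _ _ hne]
  ring_nf

lemma zeta2_eq (s₁ s₂ : ℂ) : zeta2 s₁ s₂ =
    ∑' p : ℕ × ℕ, ((p.1 + 1 : ℕ) : ℂ) ^ (-s₁) * (((p.1 + p.2 + 1 : ℕ) : ℂ) + 1) ^ (-s₂) := by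
  unfold zeta2
  rw [← (Equiv.prodCongr Equiv.pnatEquivNat Equiv.pnatEquivNat).symm.tsum_eq]
  refine tsum_congr fun p => ?_
  simp [Equiv.prodCongr_symm]
  left
  congr 1
  ring

lemma main (s₁ s₂ : ℂ) (h1 : 1 / 2 < s₁.re) (h3 : 1 < s₂.re) (h4 : 2 < (s₁ + s₂).re) :
    zeta2 s₁ s₂ = (s₂ - 1)⁻¹ * riemannZeta (s₁ + s₂ - 1) + h (s₁, s₂) := by
  rw [Complex.add_re] at h4
  have hs2 : s₂ ≠ 1 := by rintro rfl; simp at h3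
  have hf := f_summable s₁ s₂ h1 (by linarith)
  set Z : ℕ × ℕ → ℂ := fun p =>
    ((p.1 + 1 : ℕ) : ℂ) ^ (-s₁) * (((p.1 + p.2 + 1 : ℕ) : ℂ) + 1) ^ (-s₂) with hZ
  have hZs : Summable Z := by
    refine Summable.of_norm_bounded (summable_pair s₁.re s₂.re h3 h4) ?_
    intro p
    simp only [hZ]
    have e : (((p.1 + p.2 + 1 : ℕ) : ℂ) + 1) = ((p.1 + p.2 + 1 + 1 : ℕ) : ℂ) := by push_cast; rfl
    rw [e, norm_mul, Complex.norm_natCast_cpow_of_pos (Nat.succ_pos _),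
      Complex.norm_natCast_cpow_of_pos (Nat.succ_pos _), Complex.neg_re, Complex.neg_re]
    refine mul_le_mul_of_nonneg_left ?_ (by positivity)
    exact Real.rpow_le_rpow_of_nonpos (by positivity) (by exact_mod_cast Nat.le_succ _) (by linarith)
  have hB := hZs.sub hf
  have hBeq : ∀ p : ℕ × ℕ, Z p - f p s₁ s₂ = ((p.1 + 1 : ℕ) : ℂ) ^ (-s₁) * ((s₂ - 1)⁻¹ *
      (((p.1 + p.2 + 1 : ℕ) : ℂ) ^ (1 - s₂) - ((p.1 + (p.2 + 1) + 1 : ℕ) : ℂ) ^ (1 - s₂))) := by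
    intro p
    simp only [hZ, f, phi]
    rw [integral_eq _ (Nat.succ_pos _) _ hs2, ← mul_sub, sub_sub_cancel]
    congr 4
    push_cast
    ring
  have hrow : ∀ i : ℕ, ∑' j : ℕ, (Z (i, j) - f (i, j) s₁ s₂)
      = (s₂ - 1)⁻¹ * (1 / ((i : ℂ) + 1) ^ (s₁ + s₂ - 1)) := by
    intro i
    have hs := hB.prod_factor i
    refine tendsto_nhds_unique hs.hasSum.tendsto_sum_nat ?_
    simp_rw [hBeq, ← Finset.mul_sum]
    have hsum : ∀ N : ℕ, ∑ j ∈ Finset.range N,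
        (((i + j + 1 : ℕ) : ℂ) ^ (1 - s₂) - ((i + (j + 1) + 1 : ℕ) : ℂ) ^ (1 - s₂))
        = ((i + 0 + 1 : ℕ) : ℂ) ^ (1 - s₂) - ((i + N + 1 : ℕ) : ℂ) ^ (1 - s₂) := fun N =>
      Finset.sum_range_sub' (fun j : ℕ => ((i + j + 1 : ℕ) : ℂ) ^ (1 - s₂)) N
    simp_rw [hsum]
    have ht : Tendsto (fun N : ℕ => ((i + N + 1 : ℕ) : ℂ) ^ (1 - s₂)) atTop (𝓝 0) := by
      rw [tendsto_zero_iff_norm_tendsto_zero]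
      have e : ∀ N : ℕ, ‖((i + N + 1 : ℕ) : ℂ) ^ (1 - s₂)‖ = ((N + (i + 1) : ℕ) : ℝ) ^ (-(s₂.re - 1)) := by
        intro N
        rw [Complex.norm_natCast_cpow_of_pos (Nat.succ_pos _)]
        have e1 : ((i + N).succ : ℕ) = N + (i + 1) := by omega
        have e2 : (1 - s₂).re = -(s₂.re - 1) := by simp
        rw [e1, e2]
      simp_rw [e]
      exact (tendsto_rpow_neg_atTop (by linarith : 0 < s₂.re - 1)).comp
        (tendsto_natCast_atTop_atTop.comp (tendsto_add_atTop_nat (i + 1)))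
    have := (((tendsto_const_nhds (x := ((i + 0 + 1 : ℕ) : ℂ) ^ (1 - s₂))).sub ht).const_mul
      ((s₂ - 1)⁻¹)).const_mul (((i + 1 : ℕ) : ℂ) ^ (-s₁))
    convert this using 2
    have hne : ((i : ℂ) + 1) ≠ 0 := by exact_mod_cast Nat.succ_ne_zero i
    have e : -(s₁ + s₂ - 1) = -s₁ + (1 - s₂) := by ring
    rw [one_div, ← Complex.cpow_neg, e, Complex.cpow_add _ _ hne]
    push_cast
    simp only [add_zero, sub_zero]
    ring
  have hsum : ∑' p, (Z p - f p s₁ s₂) = (s₂ - 1)⁻¹ * riemannZeta (s₁ + s₂ - 1) := by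
    rw [hB.tsum_prod, zeta_eq_tsum_one_div_nat_add_one_cpow (by simp; linarith), ← tsum_mul_left]
    exact tsum_congr hrow
  rw [hZs.tsum_sub hf] at hsum
  rw [zeta2_eq, ← hsum]
  unfold h
  simp only [sub_add_cancel]
  rfl

end Z2

/-- There is a function `h₁`, analytic on `{Re s₁ > 1/2, Re s₂ > 1/2}`, such that
`ζ₂(s₁,s₂) = ζ(s₁+s₂-1)/(s₂-1) + h₁(s₁,s₂)` whenever additionally `Re s₂ > 1` and
`Re(s₁+s₂) > 2`. -/
theorem statement10 :
    ∃ h₁ : ℂ × ℂ → ℂ,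
      AnalyticOnNhd ℂ h₁ {p : ℂ × ℂ | 1 / 2 < p.1.re ∧ 1 / 2 < p.2.re} ∧
      ∀ s₁ s₂ : ℂ, 1 / 2 < s₁.re → 1 / 2 < s₂.re → 1 < s₂.re → 2 < (s₁ + s₂).re →
        zeta2 s₁ s₂ = (s₂ - 1)⁻¹ * riemannZeta (s₁ + s₂ - 1) + h₁ (s₁, s₂) := by
  exact ⟨Z2.h, Z2.h_analytic, fun s₁ s₂ h1 _ h3 h4 => Z2.main s₁ s₂ h1 h3 h4⟩
end
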